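/- arXiv:1105.5380 — 12 statements merged into one kernel-verified Lean document; each statement's English description precedes it below -/
import Mathlib

section
/- Let K₁ ⊆ ℂ^{m₁×n₁} and K₂ ⊆ ℂ^{m₂×n₂} be complex linear subspaces, let x₁ ∈ K₁ and x₂ ∈ K₂ satisfy Tr[x₁x₁*] = Tr[x₂x₂*] = 1, and let G : ℝ → ℝ be continuous. Suppose the matrix G((x₁x₁*) ⊗ (x₂x₂*)) (continuous functional calculus applied to the positive semidefinite matrix (x₁x₁*) ⊗ (x₂x₂*)) lies in the linear span of the four matrices G(x₁x₁*) ⊗ G(x₂x₂*), G(x₁x₁*) ⊗ I, I ⊗ G(x₂x₂*), and I ⊗ I. If for i = 1, 2 one has Tr[G(xᵢxᵢ*)·xᵢyᵢ*] = 0 for every yᵢ ∈ Kᵢ with Tr[xᵢyᵢ*] = 0, then, setting x := x₁ ⊗ x₂, one has Tr[G(xx*)·xy*] = 0 for every y ∈ K₁⊗K₂ with Tr[xy*] = 0. -/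
open Matrix in
/-- A functional `y ↦ Tr[A·xy*]` on `K` vanishing on the orthogonal complement of the unit vector
`x ∈ K` is a multiple of `y ↦ Tr[xy*]`. -/
theorem exists_trace_mul_eq_of_orthogonal {m n : Type*} [Fintype m] [Fintype n]
    {K : Submodule ℂ (Matrix m n ℂ)} {x : Matrix m n ℂ} (hx : x ∈ K)
    (htr : trace (x * xᴴ) = 1) {A : Matrix m m ℂ}
    (h : ∀ y ∈ K, trace (x * yᴴ) = 0 → trace (A * (x * yᴴ)) = 0) :
    ∃ c : ℂ, ∀ y ∈ K, trace (A * (x * yᴴ)) = c * trace (x * yᴴ) := by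
  refine ⟨trace (A * (x * xᴴ)), fun y hy => ?_⟩
  have key := h (y - star (trace (x * yᴴ)) • x) (K.sub_mem hy (K.smul_mem _ hx))
    (by simp [conjTranspose_sub, conjTranspose_smul, Matrix.mul_sub, htr])
  simp only [conjTranspose_sub, conjTranspose_smul, star_star, Matrix.mul_sub, Matrix.mul_smul,
    trace_sub, trace_smul, smul_eq_mul] at key
  linear_combination key

open Matrix in
open scoped Kronecker in
/-- If `y ↦ Tr[Aᵢ·xᵢy*]` is `cᵢ` times `y ↦ Tr[xᵢy*]` on `Kᵢ` for `i = 1, 2`, then the same holds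
for `A₁ ⊗ A₂` and `x₁ ⊗ x₂` on `K₁ ⊗ K₂`, with factor `c₁ c₂`. -/
theorem trace_kronecker_mul_eq_of_mem_span {m₁ n₁ m₂ n₂ : Type*}
    [Fintype m₁] [Fintype n₁] [Fintype m₂] [Fintype n₂]
    {K₁ : Submodule ℂ (Matrix m₁ n₁ ℂ)} {K₂ : Submodule ℂ (Matrix m₂ n₂ ℂ)}
    {x₁ : Matrix m₁ n₁ ℂ} {x₂ : Matrix m₂ n₂ ℂ} {A₁ : Matrix m₁ m₁ ℂ} {A₂ : Matrix m₂ m₂ ℂ}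
    {c₁ c₂ : ℂ}
    (h₁ : ∀ y ∈ K₁, trace (A₁ * (x₁ * yᴴ)) = c₁ * trace (x₁ * yᴴ))
    (h₂ : ∀ y ∈ K₂, trace (A₂ * (x₂ * yᴴ)) = c₂ * trace (x₂ * yᴴ))
    {y : Matrix (m₁ × m₂) (n₁ × n₂) ℂ}
    (hy : y ∈ Submodule.span ℂ {z : Matrix (m₁ × m₂) (n₁ × n₂) ℂ |
      ∃ a ∈ K₁, ∃ b ∈ K₂, z = a ⊗ₖ b}) :
    trace ((A₁ ⊗ₖ A₂) * ((x₁ ⊗ₖ x₂) * yᴴ)) = c₁ * c₂ * trace ((x₁ ⊗ₖ x₂) * yᴴ) := by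
  induction hy using Submodule.span_induction with
  | mem z hz =>
    obtain ⟨a, ha, b, hb, rfl⟩ := hz
    rw [conjTranspose_kronecker, ← mul_kronecker_mul, ← mul_kronecker_mul, trace_kronecker,
      trace_kronecker, h₁ a ha, h₂ b hb]
    ring
  | zero => simp
  | add u v _ _ hu hv =>
    simp only [conjTranspose_add, Matrix.mul_add, trace_add, hu, hv, mul_add]
  | smul r u _ hu =>
    simp only [conjTranspose_smul, Matrix.mul_smul, trace_smul, hu, smul_eq_mul]
    ring


open Matrix in
open scoped Kronecker in
/-- If `G` plays the role of `F'`, criticality of `x ↦ Tr[F(xx*)]` on the unit trace sphere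
is `Tr[G(xx*)·xy*] = 0` for all `y` in the subspace orthogonal to `x`; such critical points
are closed under tensor (Kronecker) products, provided `G((x₁x₁*) ⊗ (x₂x₂*))` lies in the span
of `G ⊗ G`, `G ⊗ I`, `I ⊗ G`, `I ⊗ I`. -/
theorem firstDeriv_critical_tensor
    (m₁ n₁ m₂ n₂ : ℕ)
    (K₁ : Submodule ℂ (Matrix (Fin m₁) (Fin n₁) ℂ))
    (K₂ : Submodule ℂ (Matrix (Fin m₂) (Fin n₂) ℂ))
    (x₁ : Matrix (Fin m₁) (Fin n₁) ℂ) (x₂ : Matrix (Fin m₂) (Fin n₂) ℂ)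
    (hx₁ : x₁ ∈ K₁) (hx₂ : x₂ ∈ K₂)
    (htr₁ : Matrix.trace (x₁ * x₁ᴴ) = 1) (htr₂ : Matrix.trace (x₂ * x₂ᴴ) = 1)
    (G : ℝ → ℝ) (hG : Continuous G)
    (hspan : cfc G ((x₁ * x₁ᴴ) ⊗ₖ (x₂ * x₂ᴴ)) ∈
      Submodule.span ℂ
        ({cfc G (x₁ * x₁ᴴ) ⊗ₖ cfc G (x₂ * x₂ᴴ),
          cfc G (x₁ * x₁ᴴ) ⊗ₖ (1 : Matrix (Fin m₂) (Fin m₂) ℂ),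
          (1 : Matrix (Fin m₁) (Fin m₁) ℂ) ⊗ₖ cfc G (x₂ * x₂ᴴ),
          (1 : Matrix (Fin m₁) (Fin m₁) ℂ) ⊗ₖ (1 : Matrix (Fin m₂) (Fin m₂) ℂ)} :
          Set (Matrix (Fin m₁ × Fin m₂) (Fin m₁ × Fin m₂) ℂ)))
    (hcrit₁ : ∀ y₁ ∈ K₁, Matrix.trace (x₁ * y₁ᴴ) = 0 →
      Matrix.trace (cfc G (x₁ * x₁ᴴ) * (x₁ * y₁ᴴ)) = 0)
    (hcrit₂ : ∀ y₂ ∈ K₂, Matrix.trace (x₂ * y₂ᴴ) = 0 →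
      Matrix.trace (cfc G (x₂ * x₂ᴴ) * (x₂ * y₂ᴴ)) = 0) :
    ∀ y ∈ Submodule.span ℂ {z : Matrix (Fin m₁ × Fin m₂) (Fin n₁ × Fin n₂) ℂ |
        ∃ a ∈ K₁, ∃ b ∈ K₂, z = a ⊗ₖ b},
      Matrix.trace ((x₁ ⊗ₖ x₂) * yᴴ) = 0 →
      Matrix.trace (cfc G ((x₁ ⊗ₖ x₂) * (x₁ ⊗ₖ x₂)ᴴ) * ((x₁ ⊗ₖ x₂) * yᴴ)) = 0 := by
  intro y hy hxy
  obtain ⟨c₁, h₁⟩ := exists_trace_mul_eq_of_orthogonal hx₁ htr₁ hcrit₁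
  obtain ⟨c₂, h₂⟩ := exists_trace_mul_eq_of_orthogonal hx₂ htr₂ hcrit₂
  have e₁ : ∀ y ∈ K₁, trace ((1 : Matrix (Fin m₁) (Fin m₁) ℂ) * (x₁ * yᴴ)) =
      1 * trace (x₁ * yᴴ) := by simp
  have e₂ : ∀ y ∈ K₂, trace ((1 : Matrix (Fin m₂) (Fin m₂) ℂ) * (x₂ * yᴴ)) =
      1 * trace (x₂ * yᴴ) := by simp
  rw [conjTranspose_kronecker, ← mul_kronecker_mul]
  generalize cfc G ((x₁ * x₁ᴴ) ⊗ₖ (x₂ * x₂ᴴ)) = L at hspan ⊢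
  induction hspan using Submodule.span_induction with
  | mem M hM =>
    rcases hM with rfl | rfl | rfl | rfl
    · rw [trace_kronecker_mul_eq_of_mem_span h₁ h₂ hy, hxy, mul_zero]
    · rw [trace_kronecker_mul_eq_of_mem_span h₁ e₂ hy, hxy, mul_zero]
    · rw [trace_kronecker_mul_eq_of_mem_span e₁ h₂ hy, hxy, mul_zero]
    · rw [trace_kronecker_mul_eq_of_mem_span e₁ e₂ hy, hxy, mul_zero]
  | zero => simp
  | add M N _ _ hM hN => rw [Matrix.add_mul, trace_add, hM, hN, add_zero]
  | smul r M _ hM => rw [Matrix.smul_mul, trace_smul, hM, smul_zero]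
end

section
/- Let K₁ ⊆ ℂ^{m₁×n₁} and K₂ ⊆ ℂ^{m₂×n₂} be complex linear subspaces, and let x₁ ∈ K₁, x₂ ∈ K₂ satisfy Tr[xᵢxᵢ*] = 1 with xᵢxᵢ* positive definite for i = 1, 2. If for i = 1, 2 one has Tr[log(xᵢxᵢ*)·xᵢyᵢ*] = 0 for every yᵢ ∈ Kᵢ with Tr[xᵢyᵢ*] = 0, then, setting x := x₁ ⊗ x₂ (Kronecker product), one has Tr[log(xx*)·xy*] = 0 for every y ∈ K₁⊗K₂ with Tr[xy*] = 0. In other words, critical points of the von Neumann entropy x ↦ −Tr[xx* log xx*] on the unit trace sphere are closed under tensor products. -/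
namespace Matrix

open scoped Kronecker ComplexOrder MatrixOrder Matrix.Norms.L2Operator

/-- Tensoring a square matrix with the identity on the right, as a `⋆`-algebra homomorphism. -/
@[simps]
def kroneckerOneStarAlgHom (m n : Type*) [Fintype m] [DecidableEq m] [Fintype n]
    [DecidableEq n] : Matrix m m ℂ →⋆ₐ[ℝ] Matrix (m × n) (m × n) ℂ where
  toFun A := A ⊗ₖ (1 : Matrix n n ℂ)
  map_one' := one_kronecker_one
  map_mul' A B := by rw [← mul_kronecker_mul, one_mul]
  map_zero' := zero_kronecker _
  map_add' A B := add_kronecker _ _ _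
  commutes' r := by
    rw [Algebra.algebraMap_eq_smul_one, Algebra.algebraMap_eq_smul_one, smul_kronecker,
      one_kronecker_one]
  map_star' A := by
    rw [star_eq_conjTranspose, star_eq_conjTranspose, conjTranspose_kronecker, conjTranspose_one]

/-- Tensoring a square matrix with the identity on the left, as a `⋆`-algebra homomorphism. -/
@[simps]
def oneKroneckerStarAlgHom (m n : Type*) [Fintype m] [DecidableEq m] [Fintype n]
    [DecidableEq n] : Matrix n n ℂ →⋆ₐ[ℝ] Matrix (m × n) (m × n) ℂ where
  toFun B := (1 : Matrix m m ℂ) ⊗ₖ B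
  map_one' := one_kronecker_one
  map_mul' A B := by rw [← mul_kronecker_mul, one_mul]
  map_zero' := kronecker_zero _
  map_add' A B := kronecker_add _ _ _
  commutes' r := by
    rw [Algebra.algebraMap_eq_smul_one, Algebra.algebraMap_eq_smul_one, kronecker_smul,
      one_kronecker_one]
  map_star' A := by
    rw [star_eq_conjTranspose, star_eq_conjTranspose, conjTranspose_kronecker, conjTranspose_one]

variable {m n : Type*} [Fintype m] [DecidableEq m] [Fintype n] [DecidableEq n]

theorem exp_kronecker_add_kronecker (A : Matrix m m ℂ) (B : Matrix n n ℂ) :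
    NormedSpace.exp (A ⊗ₖ (1 : Matrix n n ℂ) + (1 : Matrix m m ℂ) ⊗ₖ B) =
      NormedSpace.exp A ⊗ₖ NormedSpace.exp B := by
  let _ : NormedAlgebra ℚ (Matrix m m ℂ) := .restrictScalars ℚ ℂ _
  let _ : NormedAlgebra ℚ (Matrix n n ℂ) := .restrictScalars ℚ ℂ _
  have hA := NormedSpace.map_exp (kroneckerOneStarAlgHom m n)
    (LinearMap.continuous_of_finiteDimensional
      (kroneckerOneStarAlgHom m n).toAlgHom.toLinearMap) A
  have hB := NormedSpace.map_exp (oneKroneckerStarAlgHom m n)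
    (LinearMap.continuous_of_finiteDimensional
      (oneKroneckerStarAlgHom m n).toAlgHom.toLinearMap) B
  simp only [kroneckerOneStarAlgHom_apply, oneKroneckerStarAlgHom_apply] at hA hB
  rw [Matrix.exp_add_of_commute, ← hA, ← hB, ← mul_kronecker_mul, one_mul, mul_one]
  rw [Commute, SemiconjBy, ← mul_kronecker_mul, ← mul_kronecker_mul]
  simp only [one_mul, mul_one]

theorem PosDef.cfc_log_kronecker {A : Matrix m m ℂ} {B : Matrix n n ℂ}
    (hA : A.PosDef) (hB : B.PosDef) :
    cfc Real.log (A ⊗ₖ B) =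
      cfc Real.log A ⊗ₖ (1 : Matrix n n ℂ) + (1 : Matrix m m ℂ) ⊗ₖ cfc Real.log B := by
  have hsa : IsSelfAdjoint
      (CFC.log A ⊗ₖ (1 : Matrix n n ℂ) + (1 : Matrix m m ℂ) ⊗ₖ CFC.log B) :=
    (IsSelfAdjoint.log.map (kroneckerOneStarAlgHom m n)).add
      (IsSelfAdjoint.log.map (oneKroneckerStarAlgHom m n))
  have h := CFC.log_exp _ hsa
  rwa [exp_kronecker_add_kronecker, CFC.exp_log A hA.isStrictlyPositive,
    CFC.exp_log B hB.isStrictlyPositive] at h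

/-- If `L * x` is orthogonal to the orthogonal complement of the unit vector `x` in `K`, then
pairing with `L * x` is a scalar multiple of pairing with `x` on `K`. -/
theorem trace_mul_conjTranspose_eq_of_orthogonal {p q : Type*} [Fintype p] [Fintype q]
    {K : Submodule ℂ (Matrix p q ℂ)} {x : Matrix p q ℂ} {L : Matrix p p ℂ}
    (hx : x ∈ K) (htr : trace (x * xᴴ) = 1)
    (h : ∀ y ∈ K, trace (x * yᴴ) = 0 → trace (L * (x * yᴴ)) = 0)
    {y : Matrix p q ℂ} (hy : y ∈ K) :
    trace (L * (x * yᴴ)) = trace (L * (x * xᴴ)) * trace (x * yᴴ) := by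
  have key := h (y - star (trace (x * yᴴ)) • x) (K.sub_mem hy (K.smul_mem _ hx))
  simp only [conjTranspose_sub, conjTranspose_smul, star_star, Matrix.mul_sub, Matrix.mul_smul,
    trace_sub, trace_smul, htr, smul_eq_mul, mul_one, sub_self, forall_const] at key
  linear_combination key

end Matrix



open Matrix in
open scoped Kronecker ComplexOrder in
/-- Critical points of the von Neumann entropy `x ↦ −Tr[xx* log xx*]` on the unit trace
sphere are closed under tensor (Kronecker) products: criticality is expressed as
`Tr[log(xx*)·xy*] = 0` for all `y` in the subspace orthogonal to `x`. -/
theorem vonNeumann_critical_tensor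
    (m₁ n₁ m₂ n₂ : ℕ)
    (K₁ : Submodule ℂ (Matrix (Fin m₁) (Fin n₁) ℂ))
    (K₂ : Submodule ℂ (Matrix (Fin m₂) (Fin n₂) ℂ))
    (x₁ : Matrix (Fin m₁) (Fin n₁) ℂ) (x₂ : Matrix (Fin m₂) (Fin n₂) ℂ)
    (hx₁ : x₁ ∈ K₁) (hx₂ : x₂ ∈ K₂)
    (htr₁ : Matrix.trace (x₁ * x₁ᴴ) = 1) (htr₂ : Matrix.trace (x₂ * x₂ᴴ) = 1)
    (hpd₁ : (x₁ * x₁ᴴ).PosDef) (hpd₂ : (x₂ * x₂ᴴ).PosDef)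
    (hcrit₁ : ∀ y₁ ∈ K₁, Matrix.trace (x₁ * y₁ᴴ) = 0 →
      Matrix.trace (cfc Real.log (x₁ * x₁ᴴ) * (x₁ * y₁ᴴ)) = 0)
    (hcrit₂ : ∀ y₂ ∈ K₂, Matrix.trace (x₂ * y₂ᴴ) = 0 →
      Matrix.trace (cfc Real.log (x₂ * x₂ᴴ) * (x₂ * y₂ᴴ)) = 0) :
    ∀ y ∈ Submodule.span ℂ {z : Matrix (Fin m₁ × Fin m₂) (Fin n₁ × Fin n₂) ℂ |
        ∃ a ∈ K₁, ∃ b ∈ K₂, z = a ⊗ₖ b},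
      Matrix.trace ((x₁ ⊗ₖ x₂) * yᴴ) = 0 →
      Matrix.trace (cfc Real.log ((x₁ ⊗ₖ x₂) * (x₁ ⊗ₖ x₂)ᴴ) * ((x₁ ⊗ₖ x₂) * yᴴ)) = 0 := by
  intro y hy hxy
  rw [conjTranspose_kronecker, ← mul_kronecker_mul, hpd₁.cfc_log_kronecker hpd₂]
  set L₁ := cfc Real.log (x₁ * x₁ᴴ)
  set L₂ := cfc Real.log (x₂ * x₂ᴴ)
  have key : trace ((L₁ ⊗ₖ (1 : Matrix (Fin m₂) (Fin m₂) ℂ) +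
        (1 : Matrix (Fin m₁) (Fin m₁) ℂ) ⊗ₖ L₂) * ((x₁ ⊗ₖ x₂) * yᴴ)) =
      (trace (L₁ * (x₁ * x₁ᴴ)) + trace (L₂ * (x₂ * x₂ᴴ))) * trace ((x₁ ⊗ₖ x₂) * yᴴ) := by
    clear hxy
    induction hy using Submodule.span_induction with
    | mem z hz =>
      obtain ⟨a, ha, b, hb, rfl⟩ := hz
      rw [conjTranspose_kronecker, ← mul_kronecker_mul, Matrix.add_mul, ← mul_kronecker_mul,
        ← mul_kronecker_mul, Matrix.one_mul, Matrix.one_mul, trace_add, trace_kronecker,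
        trace_kronecker, trace_kronecker,
        trace_mul_conjTranspose_eq_of_orthogonal hx₁ htr₁ hcrit₁ ha,
        trace_mul_conjTranspose_eq_of_orthogonal hx₂ htr₂ hcrit₂ hb]
      ring
    | zero => simp
    | add u v _ _ hu hv =>
      simp only [conjTranspose_add, Matrix.mul_add, trace_add] at hu hv ⊢
      linear_combination hu + hv
    | smul c u _ hu =>
      simp only [conjTranspose_smul, Matrix.mul_smul, trace_smul, smul_eq_mul] at hu ⊢
      linear_combination star c * hu
  rw [key, hxy, mul_zero]
end

section
/- Let p be a natural number with p ≥ 2, let K₁ ⊆ ℂ^{m₁×n₁} and K₂ ⊆ ℂ^{m₂×n₂} be complex linear subspaces, and let x₁ ∈ K₁, x₂ ∈ K₂ satisfy Tr[x₁x₁*] = Tr[x₂x₂*] = 1. If for i = 1, 2 one has Tr[(xᵢxᵢ*)^{p−1}·xᵢyᵢ*] = 0 for every yᵢ ∈ Kᵢ with Tr[xᵢyᵢ*] = 0, then, setting x := x₁ ⊗ x₂ (Kronecker product), one has Tr[(xx*)^{p−1}·xy*] = 0 for every y ∈ K₁⊗K₂ with Tr[xy*] = 0. In other words, critical points of the p-norm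 function x ↦ Tr[(xx*)^p] on the unit trace sphere are closed under tensor products. -/
open scoped Kronecker in
/-- The power of a Kronecker product of square matrices is the Kronecker product of the powers. -/
theorem Matrix.kronecker_pow_eq {R m n : Type*} [CommSemiring R] [Fintype m] [Fintype n]
    [DecidableEq m] [DecidableEq n] (A : Matrix m m R) (B : Matrix n n R) (k : ℕ) :
    (A ⊗ₖ B) ^ k = (A ^ k) ⊗ₖ (B ^ k) := by
  induction k with
  | zero => simp
  | succ k ih => rw [pow_succ, pow_succ, pow_succ, ih, Matrix.mul_kronecker_mul]

open Matrix in
/-- Lagrange multiplier form of criticality: if `y ↦ Tr[B·xy*]` vanishes on the part of `K`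
orthogonal to the unit vector `x ∈ K`, then on `K` it is a multiple of `y ↦ Tr[xy*]`. -/
theorem Matrix.trace_mul_conjTranspose_eq_mul_of_forall_orthogonal {m n : Type*}
    [Fintype m] [Fintype n] (K : Submodule ℂ (Matrix m n ℂ)) (B : Matrix m m ℂ)
    {x : Matrix m n ℂ} (hx : x ∈ K) (htr : (x * xᴴ).trace = 1)
    (hcrit : ∀ y ∈ K, (x * yᴴ).trace = 0 → (B * (x * yᴴ)).trace = 0)
    {y : Matrix m n ℂ} (hy : y ∈ K) :
    (B * (x * yᴴ)).trace = (B * (x * xᴴ)).trace * (x * yᴴ).trace := by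
  have h := hcrit (y - star (x * yᴴ).trace • x) (K.sub_mem hy (K.smul_mem _ hx))
  simp only [conjTranspose_sub, conjTranspose_smul, star_star, Matrix.mul_sub, Matrix.mul_smul,
    trace_sub, trace_smul, htr, smul_eq_mul, mul_one, sub_self, forall_const] at h
  rw [sub_eq_zero.mp h, mul_comm]

open Matrix in
open scoped Kronecker in
/-- Critical points of the p-norm function `x ↦ Tr[(xx*)^p]` on the unit trace sphere are
closed under tensor (Kronecker) products: criticality is expressed as
`Tr[(xx*)^{p−1}·xy*] = 0` for all `y` in the subspace orthogonal to `x`. -/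
theorem pNorm_critical_tensor
    (p : ℕ) (hp : 2 ≤ p)
    (m₁ n₁ m₂ n₂ : ℕ)
    (K₁ : Submodule ℂ (Matrix (Fin m₁) (Fin n₁) ℂ))
    (K₂ : Submodule ℂ (Matrix (Fin m₂) (Fin n₂) ℂ))
    (x₁ : Matrix (Fin m₁) (Fin n₁) ℂ) (x₂ : Matrix (Fin m₂) (Fin n₂) ℂ)
    (hx₁ : x₁ ∈ K₁) (hx₂ : x₂ ∈ K₂)
    (htr₁ : Matrix.trace (x₁ * x₁ᴴ) = 1) (htr₂ : Matrix.trace (x₂ * x₂ᴴ) = 1)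
    (hcrit₁ : ∀ y₁ ∈ K₁, Matrix.trace (x₁ * y₁ᴴ) = 0 →
      Matrix.trace ((x₁ * x₁ᴴ) ^ (p - 1) * (x₁ * y₁ᴴ)) = 0)
    (hcrit₂ : ∀ y₂ ∈ K₂, Matrix.trace (x₂ * y₂ᴴ) = 0 →
      Matrix.trace ((x₂ * x₂ᴴ) ^ (p - 1) * (x₂ * y₂ᴴ)) = 0) :
    ∀ y ∈ Submodule.span ℂ {z : Matrix (Fin m₁ × Fin m₂) (Fin n₁ × Fin n₂) ℂ |
        ∃ a ∈ K₁, ∃ b ∈ K₂, z = a ⊗ₖ b},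
      Matrix.trace ((x₁ ⊗ₖ x₂) * yᴴ) = 0 →
      Matrix.trace (((x₁ ⊗ₖ x₂) * (x₁ ⊗ₖ x₂)ᴴ) ^ (p - 1) * ((x₁ ⊗ₖ x₂) * yᴴ)) = 0 := by
  intro y hy hxy
  have key : Matrix.trace (((x₁ ⊗ₖ x₂) * (x₁ ⊗ₖ x₂)ᴴ) ^ (p - 1) * ((x₁ ⊗ₖ x₂) * yᴴ)) =
      Matrix.trace ((x₁ * x₁ᴴ) ^ (p - 1) * (x₁ * x₁ᴴ)) *
        Matrix.trace ((x₂ * x₂ᴴ) ^ (p - 1) * (x₂ * x₂ᴴ)) *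
        Matrix.trace ((x₁ ⊗ₖ x₂) * yᴴ) := by
    clear hxy
    induction hy using Submodule.span_induction with
    | mem z hz =>
      obtain ⟨a, ha, b, hb, rfl⟩ := hz
      simp only [conjTranspose_kronecker, ← mul_kronecker_mul, kronecker_pow_eq, trace_kronecker]
      rw [trace_mul_conjTranspose_eq_mul_of_forall_orthogonal K₁ _ hx₁ htr₁ hcrit₁ ha,
        trace_mul_conjTranspose_eq_mul_of_forall_orthogonal K₂ _ hx₂ htr₂ hcrit₂ hb]
      ring
    | zero => simp
    | add u v _ _ hu hv =>
      simp only [conjTranspose_add, Matrix.mul_add, trace_add, hu, hv, mul_add]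
    | smul c u _ hu =>
      simp only [conjTranspose_smul, Matrix.mul_smul, trace_smul, hu, smul_eq_mul]
      ring
  rw [key, hxy, mul_zero]
end

section
/- Let x ∈ ℂ^{m×n} be the block matrix x = [[x₁₁, 0],[0, 0]] where x₁₁ ∈ ℂ^{r×r} is invertible, and let y ∈ ℂ^{m×n} be a block matrix y = [[y₁₁, y₁₂],[y₂₁, y₂₂]] with y₁₁ ∈ ℂ^{r×r} and conformal remaining blocks. Then xx* commutes with xy* if and only if y₂₁ = 0 and x₁₁x₁₁* commutes with x₁₁y₁₁*; moreover, given the invertibility of x₁₁, the commutation of x₁₁x₁₁* with x₁₁y₁₁* is equivalent to the identity x₁₁*x₁₁y₁₁* = y₁₁*x₁₁x₁₁*. -/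
open Matrix in
/-- Local commutativity in block form: for `x = [[x₁₁,0],[0,0]]` with `x₁₁` invertible,
`xx*` commutes with `xy*` iff `y₂₁ = 0` and `x₁₁x₁₁*` commutes with `x₁₁y₁₁*`; moreover
the latter commutation is equivalent to `x₁₁*x₁₁y₁₁* = y₁₁*x₁₁x₁₁*`. -/
theorem local_commutativity_block
    (r s t : ℕ)
    (x₁₁ : Matrix (Fin r) (Fin r) ℂ) (hx₁₁ : IsUnit x₁₁)
    (y₁₁ : Matrix (Fin r) (Fin r) ℂ) (y₁₂ : Matrix (Fin r) (Fin t) ℂ)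
    (y₂₁ : Matrix (Fin s) (Fin r) ℂ) (y₂₂ : Matrix (Fin s) (Fin t) ℂ)
    (x : Matrix (Fin r ⊕ Fin s) (Fin r ⊕ Fin t) ℂ)
    (y : Matrix (Fin r ⊕ Fin s) (Fin r ⊕ Fin t) ℂ)
    (hx : x = Matrix.fromBlocks x₁₁ 0 0 0)
    (hy : y = Matrix.fromBlocks y₁₁ y₁₂ y₂₁ y₂₂) :
    (Commute (x * xᴴ) (x * yᴴ) ↔ y₂₁ = 0 ∧ Commute (x₁₁ * x₁₁ᴴ) (x₁₁ * y₁₁ᴴ)) ∧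
    (Commute (x₁₁ * x₁₁ᴴ) (x₁₁ * y₁₁ᴴ) ↔ x₁₁ᴴ * x₁₁ * y₁₁ᴴ = y₁₁ᴴ * x₁₁ * x₁₁ᴴ) := by
  subst hx hy
  have hu : IsUnit (x₁₁ * x₁₁ᴴ * x₁₁) := (hx₁₁.mul hx₁₁.star).mul hx₁₁
  have hzero : x₁₁ * x₁₁ᴴ * (x₁₁ * y₂₁ᴴ) = 0 ↔ y₂₁ = 0 := by
    refine ⟨fun h => ?_, fun h => by simp [h]⟩
    obtain ⟨u, hu⟩ := hu
    rw [← Matrix.mul_assoc, ← hu] at h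
    have h' : (↑u⁻¹ : Matrix (Fin r) (Fin r) ℂ) * (u.val * y₂₁ᴴ) = 0 := by
      rw [h, Matrix.mul_zero]
    rwa [← Matrix.mul_assoc, u.inv_mul, Matrix.one_mul,
      Matrix.conjTranspose_eq_zero] at h'
  constructor
  · simp only [commute_iff_eq, Matrix.fromBlocks_conjTranspose, Matrix.fromBlocks_multiply,
      Matrix.conjTranspose_zero, Matrix.mul_zero, Matrix.zero_mul, add_zero,
      Matrix.fromBlocks_inj, and_true, hzero]
    exact and_comm
  · rw [commute_iff_eq, ← hx₁₁.mul_right_inj (b := x₁₁ᴴ * x₁₁ * y₁₁ᴴ)]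
    simp only [Matrix.mul_assoc]
end

section
/- Let x, y ∈ ℂ^{m×n} satisfy Tr[xx*] = 1, Tr[yy*] = 1, Tr[xy*] = 0, with xx* positive definite and xx* commuting with xy*. Then the function ε ↦ rH(x + εy) of the real variable ε has second derivative at ε = 0 equal to 2·Tr[xx* log xx*] − 2·Tr[yy* log xx*] − Tr[(xy* + yx*)²(xx*)⁻¹]. -/
open Matrix
open scoped ComplexOrder

/-- The normalized von Neumann entropy `rH(z) = −Tr[(zz*/Tr zz*) log(zz*/Tr zz*)]`,
defined via continuous functional calculus of `t ↦ t·log t` (with `0·log 0 = 0`). -/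
noncomputable def rH {m n : ℕ} (z : Matrix (Fin m) (Fin n) ℂ) : ℝ :=
  -(Matrix.trace (cfc (fun t : ℝ => t * Real.log t)
      ((Matrix.trace (z * zᴴ))⁻¹ • (z * zᴴ)))).re

section BanachAlgebra

open scoped RightActions

variable {𝔸 : Type*} [NormedRing 𝔸] [NormedAlgebra ℂ 𝔸]

/-- The power series `∑ b ^ (k + 1) / (k + 1)` of `-log (1 - b)` in a Banach algebra. -/
noncomputable def negLogOneSub (b : 𝔸) : 𝔸 :=
  ∑' k : ℕ, ((k : ℂ) + 1)⁻¹ • b ^ (k + 1)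

/-- Along a derivative of the power map, a trace collapses to a single product. -/
lemma trace_mul_fderiv_pow_apply (τ : 𝔸 →L[ℂ] ℂ) (hτ : ∀ a b, τ (a * b) = τ (b * a))
    {K b : 𝔸} (hK : Commute K b) (h : 𝔸) (k : ℕ) :
    τ (K * (((k : ℂ) + 1)⁻¹ • ∑ i ∈ Finset.range (k + 1), b ^ (k - i) * h * b ^ i)) =
      τ (K * b ^ k * h) := by
  have key : ∀ i ∈ Finset.range (k + 1), τ (K * (b ^ (k - i) * h * b ^ i)) = τ (K * b ^ k * h) := by
    intro i hi
    have hik : i ≤ k := Nat.lt_succ_iff.mp (Finset.mem_range.mp hi)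
    rw [← mul_assoc, hτ, ← mul_assoc, ← mul_assoc, ← (hK.pow_right i).eq, mul_assoc K, ← pow_add,
      Nat.add_sub_cancel' hik]
  rw [mul_smul_comm, map_smul, Finset.mul_sum, map_sum, Finset.sum_congr rfl key]
  have : (k : ℂ) + 1 ≠ 0 := by exact_mod_cast k.succ_ne_zero
  simp [this]

variable [NormOneClass 𝔸]

lemma norm_fderiv_pow_le {r : ℝ} {b : 𝔸} (hb : ‖b‖ ≤ r) (k : ℕ) :
    ‖((k : ℂ) + 1)⁻¹ • ∑ i ∈ Finset.range (k + 1),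
      b ^ (k - i) •> ContinuousLinearMap.id ℂ 𝔸 <• b ^ i‖ ≤ r ^ k := by
  have hr : 0 ≤ r := (norm_nonneg b).trans hb
  have key : ∀ i ∈ Finset.range (k + 1),
      ‖b ^ (k - i) •> ContinuousLinearMap.id ℂ 𝔸 <• b ^ i‖ ≤ r ^ k := by
    intro i hi
    have hik : i ≤ k := Nat.lt_succ_iff.mp (Finset.mem_range.mp hi)
    refine ContinuousLinearMap.opNorm_le_bound _ (by positivity) fun h => ?_
    calc _ = ‖b ^ (k - i) * (h * b ^ i)‖ := by simp [mul_assoc]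
      _ ≤ ‖b‖ ^ (k - i) * (‖h‖ * ‖b‖ ^ i) := by
          refine (norm_mul_le _ _).trans ?_
          gcongr
          · exact norm_pow_le _ _
          · refine (norm_mul_le _ _).trans ?_
            gcongr
            exact norm_pow_le _ _
      _ ≤ r ^ (k - i) * (‖h‖ * r ^ i) := by gcongr
      _ = r ^ k * ‖h‖ := by
          rw [mul_comm ‖h‖, ← mul_assoc, ← pow_add, Nat.sub_add_cancel hik]
  have hk : ‖((k : ℂ) + 1)⁻¹‖ = ((k : ℝ) + 1)⁻¹ := by
    rw [norm_inv]
    norm_cast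
  rw [norm_smul, hk, inv_mul_le_iff₀ (by positivity)]
  refine (norm_sum_le_of_le _ key).trans ?_
  simp

variable [CompleteSpace 𝔸]

/-- The derivative of `b ↦ -log (1 - b)`, tested by a trace against elements commuting with `b`,
is that of the commutative case. -/
lemma exists_hasFDerivAt_negLogOneSub (τ : 𝔸 →L[ℂ] ℂ) (hτ : ∀ a b, τ (a * b) = τ (b * a))
    {b : 𝔸} (hb : ‖b‖ < 1) :
    ∃ D : 𝔸 →L[ℂ] 𝔸, HasFDerivAt negLogOneSub D b ∧
      ∀ K h : 𝔸, Commute K b → τ (K * (1 - b) * D h) = τ (K * h) := by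
  obtain ⟨r, hbr, hr1⟩ := exists_between hb
  have hr0 : 0 ≤ r := (norm_nonneg b).trans hbr.le
  have hu : Summable fun k : ℕ => r ^ k := summable_geometric_of_lt_one hr0 hr1
  let f' : ℕ → 𝔸 → 𝔸 →L[ℂ] 𝔸 := fun k x => ((k : ℂ) + 1)⁻¹ • ∑ i ∈ Finset.range (k + 1),
    x ^ (k - i) •> ContinuousLinearMap.id ℂ 𝔸 <• x ^ i
  have hf' : ∀ k x, x ∈ Metric.ball (0 : 𝔸) r → ‖f' k x‖ ≤ r ^ k := fun k x hx =>
    norm_fderiv_pow_le (by simpa using (mem_ball_zero_iff.mp hx).le) k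
  have hbm : b ∈ Metric.ball (0 : 𝔸) r := mem_ball_zero_iff.mpr hbr
  have hs : Summable fun k => f' k b := .of_norm_bounded hu fun k => hf' k b hbm
  refine ⟨∑' k, f' k b, ?_, fun K h hK => ?_⟩
  · refine hasFDerivAt_tsum_of_isPreconnected (x₀ := 0) hu Metric.isOpen_ball
      (convex_ball (0 : 𝔸) r).isPreconnected (fun k x _ => ?_) hf' ?_ ?_ hbm
    · have := hasFDerivAt_pow' (𝕜 := ℂ) (k + 1) (x := x)
      exact this.const_smul ((k : ℂ) + 1)⁻¹
    · exact Metric.mem_ball_self ((norm_nonneg b).trans_lt hbr)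
    · simp
  · have hterm : ∀ k, f' k b h =
        ((k : ℂ) + 1)⁻¹ • ∑ i ∈ Finset.range (k + 1), b ^ (k - i) * h * b ^ i := by
      intro k
      simp [f', mul_assoc]
    have hK' : Commute (K * (1 - b)) b := hK.mul_left ((Commute.one_left b).sub_left (.refl b))
    have h1 := ((hs.hasSum.mapL (ContinuousLinearMap.apply ℂ 𝔸 h)).mul_left (K * (1 - b))).mapL τ
    have h2 := (((summable_geometric_of_norm_lt_one hb).hasSum.mul_left (K * (1 - b))).mul_right
      h).mapL τ
    simp only [ContinuousLinearMap.apply_apply, hterm,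
      trace_mul_fderiv_pow_apply τ hτ hK'] at h1
    rw [h1.unique h2, mul_assoc K, mul_neg_geom_series b hb, mul_one]

/-- The derivative of `-log A` along a curve `A`, tested by a trace. -/
lemma exists_hasDerivAt_negLogOneSub (τ : 𝔸 →L[ℂ] ℂ) (hτ : ∀ a b, τ (a * b) = τ (b * a))
    {A : ℂ → 𝔸} {A' : 𝔸} {z : ℂ} (hA : HasDerivAt A A' z) (hz : ‖1 - A z‖ < 1) :
    ∃ N' : 𝔸, HasDerivAt (fun w => negLogOneSub (1 - A w)) N' z ∧
      ∀ K : 𝔸, Commute K (A z) → τ (K * A z * N') = -τ (K * A') := by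
  obtain ⟨D, hD, hKD⟩ := exists_hasFDerivAt_negLogOneSub τ hτ hz
  refine ⟨D (-A'), hD.comp_hasDerivAt (f := fun w => 1 - A w) z (hA.const_sub 1), fun K hK => ?_⟩
  have := hKD K (-A') ((Commute.one_right K).sub_right hK)
  rw [sub_sub_cancel] at this
  rw [this, mul_neg, map_neg]

/-- The derivative of `-Tr (A log A)` along a curve `A`. -/
lemma hasDerivAt_trace_mul_negLogOneSub (τ : 𝔸 →L[ℂ] ℂ) (hτ : ∀ a b, τ (a * b) = τ (b * a))
    {A : ℂ → 𝔸} {A' : 𝔸} {z : ℂ} (hA : HasDerivAt A A' z) (hz : ‖1 - A z‖ < 1) :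
    HasDerivAt (fun w => τ (A w * negLogOneSub (1 - A w)))
      (τ (A' * negLogOneSub (1 - A z)) - τ A') z := by
  obtain ⟨N', hN, hK⟩ := exists_hasDerivAt_negLogOneSub τ hτ hA hz
  have h := τ.hasFDerivAt.comp_hasDerivAt z (hA.mul hN)
  have h1 := hK 1 (Commute.one_left _)
  rw [one_mul, one_mul] at h1
  rw [map_add, h1, ← sub_eq_add_neg] at h
  exact h

lemma hasDerivAt_trace_deriv_mul_negLogOneSub (τ : 𝔸 →L[ℂ] ℂ)
    (hτ : ∀ a b, τ (a * b) = τ (b * a)) {A A' : ℂ → 𝔸} {A'' R : 𝔸} {z : ℂ}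
    (hA : HasDerivAt A (A' z) z) (hA' : HasDerivAt A' A'' z) (hz : ‖1 - A z‖ < 1)
    (hAR : A z * R = 1) (hRA : R * A z = 1) (hcomm : Commute (A' z) (A z)) :
    HasDerivAt (fun w => τ (A' w * negLogOneSub (1 - A w)) - τ (A' w))
      (τ (A'' * negLogOneSub (1 - A z)) - τ (A' z ^ 2 * R) - τ A'') z := by
  obtain ⟨N', hN, hK⟩ := exists_hasDerivAt_negLogOneSub τ hτ hA hz
  have h := (τ.hasFDerivAt.comp_hasDerivAt z (hA'.mul hN)).sub (τ.hasFDerivAt.comp_hasDerivAt z hA')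
  have hR : Commute R (A z) := hRA.trans hAR.symm
  have h1 := hK (A' z * R) (hcomm.mul_left hR)
  rw [mul_assoc (A' z) R (A z), hRA, mul_one, mul_assoc, hτ (A' z) (R * A' z), mul_assoc, ← sq,
    hτ R] at h1
  rw [map_add, h1, ← sub_eq_add_neg] at h
  exact h

end BanachAlgebra

section Matrix

open scoped Matrix.Norms.L2Operator

variable {m : Type*} [Fintype m] [DecidableEq m]

lemma Matrix.cfc_log_eq_neg_negLogOneSub [Nonempty m] {A : Matrix m m ℂ} (hA : A.IsHermitian)
    (h : ‖1 - A‖ < 1) : cfc Real.log A = -negLogOneSub (1 - A) := by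
  have hsa : IsSelfAdjoint A := hA
  have hsub : cfc (fun s : ℝ => 1 - s) A = 1 - A := by
    rw [cfc_sub .., cfc_const_one .., cfc_id' ℝ A]
  have hspec : ∀ s ∈ spectrum ℝ A, |1 - s| < 1 := fun s hs =>
    (norm_apply_le_norm_cfc (fun s : ℝ => 1 - s) A hs).trans_lt (by rwa [hsub])
  let F : ℕ → ℝ → ℝ := fun n s => ∑ k ∈ Finset.range n, ((k : ℝ) + 1)⁻¹ * (1 - s) ^ (k + 1)
  have hF : ∀ s ∈ spectrum ℝ A,
      Filter.Tendsto (fun n => F n s) Filter.atTop (nhds (-Real.log s)) := by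
    intro s hs
    simpa [F, div_eq_inv_mul] using
      (Real.hasSum_pow_div_log_of_abs_lt_one (hspec s hs)).tendsto_sum_nat
  have hunif : TendstoUniformlyOn F (fun s => -Real.log s) Filter.atTop (spectrum ℝ A) := by
    rw [Metric.tendstoUniformlyOn_iff]
    intro ε hε
    rw [Filter.eventually_all_finite Matrix.finite_real_spectrum]
    intro s hs
    filter_upwards [Metric.tendsto_nhds.mp (hF s hs) ε hε] with n hn
    rwa [dist_comm]
  have hlim := tendsto_cfc_fun (a := A) hunif (.of_forall fun n => by fun_prop)
  have hFA : ∀ n, cfc (F n) A =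
      ∑ k ∈ Finset.range n, ((k : ℂ) + 1)⁻¹ • (1 - A) ^ (k + 1) := by
    intro n
    rw [show F n = ∑ k ∈ Finset.range n, fun s : ℝ => ((k : ℝ) + 1)⁻¹ * (1 - s) ^ (k + 1) by
      ext s; simp [F], cfc_sum _ _ _ (fun k _ => by fun_prop)]
    refine Finset.sum_congr rfl fun k _ => ?_
    rw [cfc_const_mul .., cfc_pow .., hsub]
    ext i j
    simp [Complex.real_smul]
  simp only [hFA] at hlim
  have hsum : Summable fun k : ℕ => ((k : ℂ) + 1)⁻¹ • (1 - A) ^ (k + 1) := by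
    refine .of_norm_bounded ((summable_nat_add_iff 1).mpr
      (summable_geometric_of_lt_one (norm_nonneg _) h)) fun k => ?_
    rw [norm_smul, norm_inv]
    have : (1 : ℝ) ≤ ‖(k : ℂ) + 1‖ := by
      norm_cast
      omega
    calc _ ≤ 1 * ‖1 - A‖ ^ (k + 1) := by
          gcongr
          · exact inv_le_one_of_one_le₀ this
          · exact norm_pow_le _ _
      _ = _ := one_mul _
  have := tendsto_nhds_unique hlim hsum.hasSum.tendsto_sum_nat
  rw [cfc_neg] at this
  rw [negLogOneSub, ← this, neg_neg]

lemma Matrix.PosDef.norm_one_sub_lt_one {A : Matrix m m ℂ} (hA : A.PosDef) (htr : A.trace = 1) :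
    ‖1 - A‖ < 1 := by
  have hsa : IsSelfAdjoint A := hA.isHermitian
  have hsub : cfc (fun s : ℝ => 1 - s) A = 1 - A := by
    rw [cfc_sub .., cfc_const_one .., cfc_id' ℝ A]
  rw [← hsub]
  refine norm_cfc_lt one_pos fun s hs => ?_
  rw [hA.isHermitian.spectrum_real_eq_range_eigenvalues] at hs
  obtain ⟨i, rfl⟩ := hs
  have hsum : ∑ j, hA.isHermitian.eigenvalues j = 1 := by
    have := hA.isHermitian.trace_eq_sum_eigenvalues.symm.trans htr
    simpa using congrArg Complex.re this
  have hle := Finset.single_le_sum (fun j _ => (hA.eigenvalues_pos j).le) (Finset.mem_univ i)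
  rw [hsum] at hle
  have hpos := hA.eigenvalues_pos i
  rw [Real.norm_eq_abs, abs_lt]
  constructor <;> linarith

end Matrix

lemma Matrix.cfc_mul_log_smul {m : Type*} [Fintype m] [DecidableEq m] {A : Matrix m m ℂ}
    (hA : A.IsHermitian) {c : ℝ} (hc : c ≠ 0) :
    cfc (fun t : ℝ => t * Real.log t) ((c : ℂ) • A) =
      ((c * Real.log c : ℝ) : ℂ) • A + (c : ℂ) • (A * cfc Real.log A) := by
  have hsa : IsSelfAdjoint A := hA
  have hsmul : ∀ (r : ℝ) (B : Matrix m m ℂ), (r : ℂ) • B = r • B := fun r B => by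
    ext i j
    simp [Complex.real_smul]
  have hcont : ∀ f : ℝ → ℝ, ContinuousOn f (spectrum ℝ A) := fun f =>
    Matrix.finite_real_spectrum.continuousOn f
  rw [hsmul, hsmul, hsmul, ← cfc_comp_const_mul c _ A
      ((Matrix.finite_real_spectrum.image _).continuousOn _)]
  have hfun : (fun t : ℝ => c * t * Real.log (c * t)) =
      fun t => c * Real.log c * t + c * (t * Real.log t) := by
    ext t
    rcases eq_or_ne t 0 with rfl | ht
    · simp
    · rw [Real.log_mul hc ht]
      ring
  rw [hfun, cfc_add _ _ _ (hcont _) (hcont _), cfc_const_mul _ _ _ (hcont _),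
    cfc_const_mul _ _ _ (hcont _), cfc_mul _ _ _ (hcont _) (hcont _), cfc_id' ℝ A]

lemma iteratedDeriv_two_entropy {S G G1 : ℝ → ℝ} {G2 : ℝ}
    (hG : ∀ᶠ ε in nhds 0, HasDerivAt G (G1 ε) ε) (hG1 : HasDerivAt G1 G2 0)
    (hS : ∀ᶠ ε in nhds 0, S ε = (1 + ε ^ 2)⁻¹ * G ε + Real.log (1 + ε ^ 2)) :
    iteratedDeriv 2 S 0 = G2 - 2 * G 0 + 2 := by
  have hpos : ∀ ε : ℝ, 1 + ε ^ 2 ≠ 0 := fun ε => by positivity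
  have hq : ∀ ε : ℝ, HasDerivAt (fun ε : ℝ => 1 + ε ^ 2) (2 * ε) ε := fun ε => by
    simpa using (hasDerivAt_pow 2 ε).const_add 1
  have hderiv : deriv S =ᶠ[nhds 0] fun ε =>
      -(2 * ε) / (1 + ε ^ 2) ^ 2 * G ε + (1 + ε ^ 2)⁻¹ * G1 ε + 2 * ε / (1 + ε ^ 2) := by
    filter_upwards [hG, hS.eventually_nhds] with ε hε hSε
    rw [Filter.EventuallyEq.deriv_eq hSε]
    exact ((((hq ε).fun_inv (hpos ε)).fun_mul hε).fun_add ((hq ε).log (hpos ε))).deriv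
  rw [iteratedDeriv_succ, iteratedDeriv_one, hderiv.deriv_eq]
  have hlin : HasDerivAt (fun ε : ℝ => 2 * ε) 2 0 := by
    simpa using (hasDerivAt_id (0 : ℝ)).const_mul 2
  have h1 := (hlin.fun_neg.fun_div ((hq 0).fun_pow 2) (pow_ne_zero 2 (hpos 0))).fun_mul
    hG.self_of_nhds
  have h2 := ((hq 0).fun_inv (hpos 0)).fun_mul hG1
  have h3 := hlin.fun_div (hq 0) (hpos 0)
  rw [((h1.fun_add h2).fun_add h3).deriv]
  simp
  ring

/-- Second directional derivative of the normalized von Neumann entropy, under the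
local commutativity assumption:
`D²_y rH(x) = 2Tr[xx* log xx*] − 2Tr[yy* log xx*] − Tr[(xy*+yx*)²(xx*)⁻¹]`. -/
theorem secondDeriv_vonNeumann
    (m n : ℕ) (x y : Matrix (Fin m) (Fin n) ℂ)
    (htrx : Matrix.trace (x * xᴴ) = 1) (htry : Matrix.trace (y * yᴴ) = 1)
    (horth : Matrix.trace (x * yᴴ) = 0)
    (hpd : (x * xᴴ).PosDef)
    (hcomm : Commute (x * xᴴ) (x * yᴴ)) :
    iteratedDeriv 2 (fun ε : ℝ => rH (x + (ε : ℂ) • y)) 0 =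
      2 * (Matrix.trace ((x * xᴴ) * cfc Real.log (x * xᴴ))).re
        - 2 * (Matrix.trace ((y * yᴴ) * cfc Real.log (x * xᴴ))).re
        - (Matrix.trace ((x * yᴴ + y * xᴴ) ^ 2 * (x * xᴴ)⁻¹)).re := by
  open scoped Matrix.Norms.L2Operator in (
    set P := x * xᴴ with hP
    set H := x * yᴴ + y * xᴴ with hH
    set Q := y * yᴴ with hQ
    have hne : Nonempty (Fin m) := by
      by_contra hm
      rw [not_nonempty_iff] at hm
      simp [Matrix.trace] at htrx
    have hPH : P.IsHermitian := hpd.isHermitian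
    have hcH : Commute H P := by
      have h2 := hcomm.star_star
      simp only [star_eq_conjTranspose, hPH.eq, conjTranspose_mul, conjTranspose_conjTranspose] at h2
      exact (hcomm.add_right h2).symm
    have htrH : H.trace = 0 := by
      have h2 := congrArg star horth
      rw [← trace_conjTranspose, conjTranspose_mul, conjTranspose_conjTranspose, star_zero] at h2
      rw [hH, trace_add, horth, h2, add_zero]
    let τ : Matrix (Fin m) (Fin m) ℂ →L[ℂ] ℂ :=
      LinearMap.toContinuousLinearMap (traceLinearMap (Fin m) ℂ ℂ)
    have hτ' : ∀ a, τ a = a.trace := fun a => rfl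
    have hτ : ∀ a b, τ (a * b) = τ (b * a) := fun a b => trace_mul_comm a b
    let A : ℂ → Matrix (Fin m) (Fin m) ℂ := fun z => P + z • H + z ^ 2 • Q
    let A' : ℂ → Matrix (Fin m) (Fin m) ℂ := fun z => H + (2 * z) • Q
    have hA : ∀ z, HasDerivAt A (A' z) z := fun z => by
      have h1 := ((hasDerivAt_id z).smul_const H).const_add P
      have h2 := (hasDerivAt_pow 2 z).smul_const Q
      simpa [A, A'] using h1.fun_add h2
    have hA' : HasDerivAt A' ((2 : ℂ) • Q) 0 := by
      simpa [A'] using (((hasDerivAt_id (0 : ℂ)).const_mul 2).smul_const Q).const_add H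
    have hA_zero : A 0 = P := by simp [A]
    have hA'_zero : A' 0 = H := by simp [A']
    have hP1 : ‖1 - P‖ < 1 := hpd.norm_one_sub_lt_one htrx
    have hnear : ∀ᶠ z in nhds (0 : ℂ), ‖1 - A z‖ < 1 := by
      have hc : ContinuousAt (fun z => ‖1 - A z‖) 0 :=
        (continuousAt_const.sub (hA 0).continuousAt).norm
      exact hc.eventually_lt_const (by simpa only [hA_zero] using hP1)
    have hnearR : ∀ᶠ ε : ℝ in nhds 0, ‖1 - A ε‖ < 1 :=
      (Complex.continuous_ofReal.tendsto' 0 0 Complex.ofReal_zero).eventually hnear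
    have hfactor : ∀ ε : ℝ, (x + (ε : ℂ) • y) * (x + (ε : ℂ) • y)ᴴ = A ε := fun ε => by
      simp only [A, hP, hH, hQ, conjTranspose_add, conjTranspose_smul, Matrix.add_mul, Matrix.mul_add,
        Matrix.smul_mul, Matrix.mul_smul, smul_add, smul_smul, Complex.star_def, Complex.conj_ofReal,
        sq]
      abel
    have htrA : ∀ ε : ℝ, (A ε).trace = ((1 + ε ^ 2 : ℝ) : ℂ) := fun ε => by
      simp [A, trace_add, htrx, htry, htrH]
    have hlogP : cfc Real.log P = -negLogOneSub (1 - P) := cfc_log_eq_neg_negLogOneSub hPH hP1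
    have hdet : IsUnit P.det := (isUnit_iff_isUnit_det _).mp hpd.isUnit
    have hG : ∀ᶠ ε : ℝ in nhds 0, HasDerivAt
        (fun ε : ℝ => (τ (A ε * negLogOneSub (1 - A ε))).re)
        (τ (A' ε * negLogOneSub (1 - A ε)) - τ (A' ε)).re ε := by
      filter_upwards [hnearR] with ε hε
      exact (hasDerivAt_trace_mul_negLogOneSub τ hτ (hA ε) hε).real_of_complex
    have hG1 := (hasDerivAt_trace_deriv_mul_negLogOneSub τ hτ (R := P⁻¹) (hA 0) hA' (by rwa [hA_zero])
      (by rw [hA_zero, mul_nonsing_inv _ hdet]) (by rw [hA_zero, nonsing_inv_mul _ hdet])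
      (by rwa [hA_zero, hA'_zero])).real_of_complex (z := 0)
    have hS : ∀ᶠ ε : ℝ in nhds 0, rH (x + (ε : ℂ) • y) =
        (1 + ε ^ 2)⁻¹ * (τ (A ε * negLogOneSub (1 - A ε))).re + Real.log (1 + ε ^ 2) := by
      filter_upwards [hnearR] with ε hε
      have hpos : (1 + ε ^ 2 : ℝ) ≠ 0 := by positivity
      have hAH : (A ε).IsHermitian := hfactor ε ▸ isHermitian_mul_conjTranspose_self _
      rw [rH, hfactor, htrA, ← Complex.ofReal_inv, cfc_mul_log_smul hAH (inv_ne_zero hpos),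
        cfc_log_eq_neg_negLogOneSub hAH hε, trace_add, trace_smul, trace_smul, htrA, mul_neg,
        trace_neg, ← hτ', smul_eq_mul, smul_eq_mul, Complex.add_re, ← Complex.ofReal_mul,
        Complex.ofReal_re, Complex.re_ofReal_mul, Complex.neg_re, Real.log_inv]
      field_simp
      ring
    rw [iteratedDeriv_two_entropy hG hG1 hS, hlogP]
    simp [hA_zero, hA'_zero, hτ', htry]
    ring)
end

section
/- Let x, y ∈ ℂ^{m×n} satisfy Tr[xx*] = 1, Tr[yy*] = 1, and Tr[xy* + yx*] = 0. Then the function ε ↦ rH₂(x + εy) of the real variable ε has first derivative at ε = 0 equal to 2·Tr[xx*(xy* + yx*)] and second derivative at ε = 0 equal to 2·Tr[(xy* + yx*)²] + 4·Tr[xx*yy*] − 4·Tr[(xx*)²]. -/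
open Matrix

/-- The normalized 2-norm entropy function `rH₂(z) = Tr[(zz*)²]/(Tr[zz*])²`. -/
noncomputable def rH₂ {m n : ℕ} (z : Matrix (Fin m) (Fin n) ℂ) : ℝ :=
  (Matrix.trace ((z * zᴴ) ^ 2)).re / ((Matrix.trace (z * zᴴ)).re) ^ 2

theorem hasDerivAt_quartic_div_one_add_sq_sq (a b c d e t : ℝ) :
    HasDerivAt (fun t : ℝ => (a + b * t + c * t ^ 2 + d * t ^ 3 + e * t ^ 4) / (1 + t ^ 2) ^ 2)
      (((b + 2 * c * t + 3 * d * t ^ 2 + 4 * e * t ^ 3) * (1 + t ^ 2)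
        - 4 * t * (a + b * t + c * t ^ 2 + d * t ^ 3 + e * t ^ 4)) / (1 + t ^ 2) ^ 3) t := by
  have hpow (k : ℕ) := hasDerivAt_pow k t
  have hnum := (((((hasDerivAt_id t).const_mul b).const_add a).add ((hpow 2).const_mul c)).add
    ((hpow 3).const_mul d)).add ((hpow 4).const_mul e)
  have hden := ((hpow 2).const_add 1).pow 2
  have hne : 1 + t ^ 2 ≠ 0 := by positivity
  refine (hnum.div hden (by simpa using pow_ne_zero 2 hne)).congr_deriv ?_
  simp only [Pi.add_apply, Pi.pow_apply, id]
  field_simp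
  push_cast
  ring

theorem deriv_quartic_div_one_add_sq_sq (a b c d e : ℝ) :
    deriv (fun t : ℝ => (a + b * t + c * t ^ 2 + d * t ^ 3 + e * t ^ 4) / (1 + t ^ 2) ^ 2) 0
      = b := by
  simp [(hasDerivAt_quartic_div_one_add_sq_sq a b c d e 0).deriv]

theorem iteratedDeriv_two_quartic_div_one_add_sq_sq (a b c d e : ℝ) :
    iteratedDeriv 2
        (fun t : ℝ => (a + b * t + c * t ^ 2 + d * t ^ 3 + e * t ^ 4) / (1 + t ^ 2) ^ 2) 0
      = 2 * c - 4 * a := by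
  rw [iteratedDeriv_succ, iteratedDeriv_one,
    funext fun t => (hasDerivAt_quartic_div_one_add_sq_sq a b c d e t).deriv]
  have hpow (k : ℕ) := hasDerivAt_pow k (0 : ℝ)
  have hid := hasDerivAt_id (0 : ℝ)
  have hden := (hpow 2).const_add 1
  have hquartic := ((((hid.const_mul b).const_add a).add ((hpow 2).const_mul c)).add
    ((hpow 3).const_mul d)).add ((hpow 4).const_mul e)
  have hcubic := (((hid.const_mul (2 * c)).const_add b).add ((hpow 2).const_mul (3 * d))).add
    ((hpow 3).const_mul (4 * e))
  have h := ((hcubic.mul hden).sub ((hid.const_mul 4).mul hquartic)).div (hden.pow 3) (by simp)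
  refine (h.congr_deriv ?_).deriv
  simp

theorem add_smul_mul_conjTranspose {m n : ℕ} (x y : Matrix (Fin m) (Fin n) ℂ) (t : ℝ) :
    (x + (t : ℂ) • y) * (x + (t : ℂ) • y)ᴴ
      = x * xᴴ + (t : ℂ) • (x * yᴴ + y * xᴴ) + (t : ℂ) ^ 2 • (y * yᴴ) := by
  simp only [conjTranspose_add, conjTranspose_smul, Complex.star_def, Complex.conj_ofReal,
    Matrix.add_mul, Matrix.mul_add, Matrix.smul_mul, Matrix.mul_smul, smul_smul, smul_add, sq]
  abel

theorem trace_sq_quadratic {m : ℕ} (A B C : Matrix (Fin m) (Fin m) ℂ) (t : ℂ) :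
    trace ((A + t • B + t ^ 2 • C) ^ 2)
      = trace (A ^ 2) + 2 * trace (A * B) * t + (trace (B ^ 2) + 2 * trace (A * C)) * t ^ 2
        + 2 * trace (B * C) * t ^ 3 + trace (C ^ 2) * t ^ 4 := by
  simp only [sq (_ : Matrix _ _ ℂ), Matrix.add_mul, Matrix.mul_add, Matrix.smul_mul,
    Matrix.mul_smul, trace_add, trace_smul, smul_eq_mul]
  rw [trace_mul_comm B A, trace_mul_comm C A, trace_mul_comm C B]
  ring

/-- First and second directional derivatives of the normalized 2-norm entropy:
`D_y rH₂(x) = 2Tr[xx*(xy*+yx*)]` and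
`D²_y rH₂(x) = 2Tr[(xy*+yx*)²] + 4Tr[xx*yy*] − 4Tr[(xx*)²]`. -/
theorem deriv_rH₂
    (m n : ℕ) (x y : Matrix (Fin m) (Fin n) ℂ)
    (htrx : Matrix.trace (x * xᴴ) = 1) (htry : Matrix.trace (y * yᴴ) = 1)
    (horth : Matrix.trace (x * yᴴ + y * xᴴ) = 0) :
    deriv (fun ε : ℝ => rH₂ (x + (ε : ℂ) • y)) 0
        = 2 * (Matrix.trace ((x * xᴴ) * (x * yᴴ + y * xᴴ))).re ∧
    iteratedDeriv 2 (fun ε : ℝ => rH₂ (x + (ε : ℂ) • y)) 0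
        = 2 * (Matrix.trace ((x * yᴴ + y * xᴴ) ^ 2)).re
          + 4 * (Matrix.trace (x * xᴴ * (y * yᴴ))).re
          - 4 * (Matrix.trace ((x * xᴴ) ^ 2)).re := by
  have hfun : (fun ε : ℝ => rH₂ (x + (ε : ℂ) • y)) = fun t : ℝ =>
      ((trace ((x * xᴴ) ^ 2)).re
        + 2 * (trace (x * xᴴ * (x * yᴴ + y * xᴴ))).re * t
        + ((trace ((x * yᴴ + y * xᴴ) ^ 2)).re + 2 * (trace (x * xᴴ * (y * yᴴ))).re) * t ^ 2
        + 2 * (trace ((x * yᴴ + y * xᴴ) * (y * yᴴ))).re * t ^ 3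
        + (trace ((y * yᴴ) ^ 2)).re * t ^ 4) / (1 + t ^ 2) ^ 2 := by
    funext t
    have h2 (z : ℂ) : (2 * z).re = 2 * z.re := by simp
    rw [rH₂, add_smul_mul_conjTranspose, trace_sq_quadratic, trace_add, trace_add, trace_smul,
      trace_smul, htrx, htry, horth]
    simp only [← Complex.ofReal_pow, Complex.add_re, Complex.re_mul_ofReal, smul_eq_mul, mul_zero,
      mul_one, add_zero, Complex.one_re, Complex.ofReal_re, h2]
  rw [hfun]
  refine ⟨deriv_quartic_div_one_add_sq_sq _ _ _ _ _, ?_⟩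
  rw [iteratedDeriv_two_quartic_div_one_add_sq_sq]
  ring
end

section
/- Let x, y ∈ ℂ^{m×n} with Tr[xx*] = Tr[yy*] = 1, xx* positive definite, and Tr[xy* + yx*] = 0. Define A(ε) := (x + εy)(x + εy)* and A₁(ε) := xx* + ε(xy* + yx*) for real ε, and S(C) := −Tr[C log C] for positive semidefinite C (with 0·log 0 = 0). Then there exist constants C₀ > 0 and δ > 0 such that for all real ε with |ε| < δ, the matrix A₁(ε) is positive definite and |S(A(ε)/Tr A(ε)) − S(A₁(ε)) − ε²·Tr[(xx* − yy*) log xx*]| ≤ C₀|ε|³. -/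
open Matrix
open scoped ComplexOrder

/-- The von Neumann entropy `S(C) = −Tr[C log C]` of a matrix, defined via continuous
functional calculus of `t ↦ −t·log t` (with `0·log 0 = 0`). -/
noncomputable def vnS {k : ℕ} (C : Matrix (Fin k) (Fin k) ℂ) : ℝ :=
  (Matrix.trace (cfc (fun t : ℝ => -(t * Real.log t)) C)).re

lemma Matrix.IsHermitian.trace_mul_self_nonneg {ι : Type*} [Fintype ι] {X : Matrix ι ι ℂ}
    (hX : X.IsHermitian) :
    0 ≤ (trace (X * X)).re := by
  have h := (posSemidef_conjTranspose_mul_self X).trace_nonneg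
  rw [hX.eq] at h
  exact (Complex.le_def.mp h).1

lemma Matrix.IsHermitian.ofReal_smul {ι : Type*} {X : Matrix ι ι ℂ} (hX : X.IsHermitian)
    (s : ℝ) : ((s : ℂ) • X).IsHermitian := by
  simp [IsHermitian, conjTranspose_smul, hX.eq]

section JointSpectralWeights

variable {ι : Type*} [Fintype ι] [DecidableEq ι] {A B : Matrix ι ι ℂ}

/-- The joint spectral weights `p i j = |⟨uᵢ, vⱼ⟩|²` of two Hermitian matrices. -/
lemma Matrix.IsHermitian.exists_trace_cfc_mul_cfc (hA : A.IsHermitian) (hB : B.IsHermitian) :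
    ∃ p : ι → ι → ℝ, (∀ i j, 0 ≤ p i j) ∧ (∀ i, ∑ j, p i j = 1) ∧
      ∀ f g : ℝ → ℝ, (trace (cfc f A * cfc g B)).re =
        ∑ i, ∑ j, p i j * (f (hA.eigenvalues i) * g (hB.eigenvalues j)) := by
  set U : Matrix ι ι ℂ := hA.eigenvectorUnitary.1 with hU
  set V : Matrix ι ι ℂ := hB.eigenvectorUnitary.1 with hV
  have hUU : star U * U = 1 := Unitary.coe_star_mul_self hA.eigenvectorUnitary
  have hVV : V * star V = 1 := Unitary.coe_mul_star_self hB.eigenvectorUnitary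
  set W : Matrix ι ι ℂ := star U * V with hW
  have hWW : W * star W = 1 := by
    calc W * star W = star U * (V * star V) * U := by
          simp only [hW, star_mul, star_star, mul_assoc]
      _ = 1 := by rw [hVV, mul_one, hUU]
  refine ⟨fun i j => Complex.normSq (W i j), fun i j => Complex.normSq_nonneg _, fun i => ?_,
    fun f g => ?_⟩
  · have h := congrFun (congrFun hWW i) i
    rw [mul_apply, one_apply_eq] at h
    have h' : ((∑ j, Complex.normSq (W i j) : ℝ) : ℂ) = 1 := by
      rw [← h]
      push_cast
      refine Finset.sum_congr rfl fun j _ => ?_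
      rw [star_apply, Complex.star_def, Complex.mul_conj]
    exact_mod_cast h'
  · set D : Matrix ι ι ℂ := diagonal (RCLike.ofReal ∘ f ∘ hA.eigenvalues) with hD
    set E : Matrix ι ι ℂ := diagonal (RCLike.ofReal ∘ g ∘ hB.eigenvalues) with hE
    have h1 : cfc f A = U * D * star U := by
      rw [hA.cfc_eq, IsHermitian.cfc, Unitary.conjStarAlgAut_apply]
    have h2 : cfc g B = V * E * star V := by
      rw [hB.cfc_eq, IsHermitian.cfc, Unitary.conjStarAlgAut_apply]
    have h3 : trace (cfc f A * cfc g B) = trace (D * W * E * star W) := by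
      calc trace (cfc f A * cfc g B) = trace (U * (D * star U * V * E * star V)) := by
            rw [h1, h2]; simp only [mul_assoc]
        _ = trace (D * W * E * star W) := by
            rw [trace_mul_comm]
            simp only [hW, star_mul, star_star, mul_assoc]
    have h4 : trace (D * W * E * star W) =
        ((∑ i, ∑ j, Complex.normSq (W i j) *
          (f (hA.eigenvalues i) * g (hB.eigenvalues j)) : ℝ) : ℂ) := by
      simp only [trace, diag_apply]
      push_cast
      refine Finset.sum_congr rfl fun i _ => ?_
      rw [mul_apply]
      refine Finset.sum_congr rfl fun j _ => ?_
      rw [hD, hE, mul_diagonal, diagonal_mul, star_apply, Complex.star_def, ← Complex.mul_conj]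
      simp only [Function.comp_apply, Complex.coe_algebraMap]
      ring
    rw [h3, h4, Complex.ofReal_re]

lemma Matrix.cfc_mul_cfc (A : Matrix ι ι ℂ) (f g : ℝ → ℝ) :
    cfc f A * cfc g A = cfc (fun t => f t * g t) A :=
  (cfc_mul f g A (A.finite_real_spectrum.continuousOn f)
    (A.finite_real_spectrum.continuousOn g)).symm

lemma Matrix.IsHermitian.cfc_one (hA : A.IsHermitian) : cfc (fun _ : ℝ => (1 : ℝ)) A = 1 :=
  cfc_const_one ℝ A (ha := hA.isSelfAdjoint)

lemma Matrix.IsHermitian.cfc_id (hA : A.IsHermitian) : cfc (fun t : ℝ => t) A = A :=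
  cfc_id' ℝ A (ha := hA.isSelfAdjoint)

/-- The squared Frobenius distance `Tr[(f(A) − g(B))²]` in terms of joint spectral weights. -/
lemma Matrix.IsHermitian.exists_trace_sub_sq (hA : A.IsHermitian) (hB : B.IsHermitian) :
    ∃ p : ι → ι → ℝ, (∀ i j, 0 ≤ p i j) ∧ (∀ i, ∑ j, p i j = 1) ∧
      ∀ f g : ℝ → ℝ, (trace ((cfc f A - cfc g B) * (cfc f A - cfc g B))).re =
        ∑ i, ∑ j, p i j * (f (hA.eigenvalues i) - g (hB.eigenvalues j)) ^ 2 := by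
  obtain ⟨p, hp, hp1, h⟩ := hA.exists_trace_cfc_mul_cfc hB
  refine ⟨p, hp, hp1, fun f g => ?_⟩
  have h1 := h (fun t => f t * f t) (fun _ => 1)
  have h2 := h (fun _ => 1) (fun t => g t * g t)
  have h3 := h f g
  rw [hB.cfc_one, mul_one, ← Matrix.cfc_mul_cfc] at h1
  rw [hA.cfc_one, one_mul, ← Matrix.cfc_mul_cfc] at h2
  have h4 : trace ((cfc f A - cfc g B) * (cfc f A - cfc g B)) =
      trace (cfc f A * cfc f A) + trace (cfc g B * cfc g B) - trace (cfc f A * cfc g B)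
        - trace (cfc f A * cfc g B) := by
    rw [sub_mul, mul_sub, mul_sub, trace_sub, trace_sub, trace_sub,
      trace_mul_comm (cfc g B) (cfc f A)]
    ring
  rw [h4, Complex.sub_re, Complex.sub_re, Complex.add_re, h1, h2, h3]
  simp only [← Finset.sum_add_distrib, ← Finset.sum_sub_distrib]
  exact Finset.sum_congr rfl fun i _ => Finset.sum_congr rfl fun j _ => by ring

/-- A lower bound on the spectrum is perturbed by at most the Frobenius distance. -/
lemma Matrix.IsHermitian.sub_le_eigenvalues (hA : A.IsHermitian) (hB : B.IsHermitian) {c r : ℝ}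
    (hr : 0 ≤ r) (hc : ∀ j, c ≤ hB.eigenvalues j)
    (h : (trace ((A - B) * (A - B))).re ≤ r ^ 2) (i : ι) : c - r ≤ hA.eigenvalues i := by
  obtain ⟨p, hp, hp1, hq⟩ := hA.exists_trace_sub_sq hB
  have hq' := hq (fun t => t) (fun t => t)
  rw [hA.cfc_id, hB.cfc_id] at hq'
  by_contra! hlt
  have h1 : (c - hA.eigenvalues i) ^ 2 ≤
      ∑ j, p i j * (hA.eigenvalues i - hB.eigenvalues j) ^ 2 := by
    calc (c - hA.eigenvalues i) ^ 2 = ∑ j, p i j * (c - hA.eigenvalues i) ^ 2 := by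
          rw [← Finset.sum_mul, hp1, one_mul]
      _ ≤ _ := by
          refine Finset.sum_le_sum fun j _ => mul_le_mul_of_nonneg_left ?_ (hp i j)
          have := hc j
          nlinarith
  have h2 : ∑ j, p i j * (hA.eigenvalues i - hB.eigenvalues j) ^ 2 ≤
      ∑ i, ∑ j, p i j * (hA.eigenvalues i - hB.eigenvalues j) ^ 2 :=
    Finset.single_le_sum
      (f := fun i => ∑ j, p i j * (hA.eigenvalues i - hB.eigenvalues j) ^ 2)
      (fun i _ => Finset.sum_nonneg fun j _ => mul_nonneg (hp i j) (sq_nonneg _))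
      (Finset.mem_univ i)
  nlinarith

lemma Real.sq_log_sub_log_le {a s t : ℝ} (ha : 0 < a) (hs : a ≤ s) (ht : a ≤ t) :
    (Real.log s - Real.log t) ^ 2 ≤ a⁻¹ ^ 2 * (s - t) ^ 2 := by
  have key : ∀ u v : ℝ, a ≤ u → a ≤ v → Real.log u - Real.log v ≤ a⁻¹ * |u - v| := by
    intro u v hu hv
    have hu0 : 0 < u := ha.trans_le hu
    have hv0 : 0 < v := ha.trans_le hv
    rw [← Real.log_div hu0.ne' hv0.ne']
    calc Real.log (u / v) ≤ u / v - 1 := Real.log_le_sub_one_of_pos (div_pos hu0 hv0)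
      _ = v⁻¹ * (u - v) := by field_simp
      _ ≤ v⁻¹ * |u - v| := by gcongr; exact le_abs_self _
      _ ≤ a⁻¹ * |u - v| := by gcongr
  rw [← sq_abs (s - t), ← mul_pow]
  refine sq_le_sq' ?_ (key s t hs ht)
  have := key t s ht hs
  rw [abs_sub_comm] at this
  linarith

/-- The logarithm is Lipschitz in Frobenius norm on matrices with spectrum bounded below. -/
lemma Matrix.IsHermitian.trace_cfc_log_sub_sq_le (hA : A.IsHermitian) (hB : B.IsHermitian) {a : ℝ}
    (ha : 0 < a) (hAa : ∀ i, a ≤ hA.eigenvalues i) (hBa : ∀ j, a ≤ hB.eigenvalues j) :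
    (trace ((cfc Real.log A - cfc Real.log B) * (cfc Real.log A - cfc Real.log B))).re ≤
      a⁻¹ ^ 2 * (trace ((A - B) * (A - B))).re := by
  obtain ⟨p, hp, -, hq⟩ := hA.exists_trace_sub_sq hB
  have hq' := hq (fun t => t) (fun t => t)
  rw [hA.cfc_id, hB.cfc_id] at hq'
  rw [hq, hq', Finset.mul_sum]
  refine Finset.sum_le_sum fun i _ => ?_
  rw [Finset.mul_sum]
  refine Finset.sum_le_sum fun j _ => ?_
  calc _ ≤ p i j * (a⁻¹ ^ 2 * (hA.eigenvalues i - hB.eigenvalues j) ^ 2) :=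
        mul_le_mul_of_nonneg_left (Real.sq_log_sub_log_le ha (hAa i) (hBa j)) (hp i j)
    _ = _ := by ring

/-- Weighted Cauchy–Schwarz inequality for the trace pairing of Hermitian matrices. -/
lemma Matrix.IsHermitian.two_mul_abs_trace_mul_le (hA : A.IsHermitian) (hB : B.IsHermitian)
    (t : ℝ) : 2 * (t * |(trace (A * B)).re|) ≤
      t ^ 2 * (trace (A * A)).re + (trace (B * B)).re := by
  have key : ∀ s : ℝ, 0 ≤ s ^ 2 * (trace (A * A)).re + 2 * s * (trace (A * B)).re
      + (trace (B * B)).re := by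
    intro s
    have hX : ((s : ℂ) • A + B).IsHermitian := (hA.ofReal_smul s).add hB
    have h := hX.trace_mul_self_nonneg
    have e : trace (((s : ℂ) • A + B) * ((s : ℂ) • A + B)) =
        ((s ^ 2 : ℝ) : ℂ) * trace (A * A) + ((2 * s : ℝ) : ℂ) * trace (A * B)
          + trace (B * B) := by
      simp only [add_mul, mul_add, smul_mul_assoc, mul_smul_comm, trace_add, trace_smul,
        trace_mul_comm B A, smul_eq_mul]
      push_cast
      ring
    rwa [e, Complex.add_re, Complex.add_re, Complex.re_ofReal_mul, Complex.re_ofReal_mul] at h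
  rcases abs_cases (trace (A * B)).re with ⟨h, -⟩ | ⟨h, -⟩ <;> rw [h]
  · linarith [key (-t)]
  · linarith [key t]

end JointSpectralWeights

/-- Klein's inequality: `S(A) − S(B) ≤ −Tr[(A − B) log B] − Tr[A − B]`. -/
lemma vnS_sub_le {k : ℕ} {A B : Matrix (Fin k) (Fin k) ℂ} (hA : A.PosDef) (hB : B.PosDef) :
    vnS A - vnS B ≤ -(trace ((A - B) * cfc Real.log B)).re - (trace (A - B)).re := by
  have hA' := hA.isHermitian
  have hB' := hB.isHermitian
  obtain ⟨p, hp, -, h⟩ := hA'.exists_trace_cfc_mul_cfc hB'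
  have h1 := h (fun t => -(t * Real.log t)) (fun _ => 1)
  have h2 := h (fun _ => 1) (fun t => -(t * Real.log t))
  have h3 := h (fun t => t) Real.log
  have h4 := h (fun _ => 1) (fun t => t * Real.log t)
  have h5 := h (fun t => t) (fun _ => 1)
  have h6 := h (fun _ => 1) (fun t => t)
  rw [hB'.cfc_one, mul_one] at h1 h5
  rw [hA'.cfc_one, one_mul] at h2 h4 h6
  rw [hA'.cfc_id] at h3 h5
  rw [hB'.cfc_id] at h6
  rw [← Matrix.cfc_mul_cfc, hB'.cfc_id] at h4
  rw [vnS, vnS, sub_mul, trace_sub, trace_sub, Complex.sub_re, Complex.sub_re, h1, h2, h3, h4, h5,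
    h6]
  simp only [← Finset.sum_neg_distrib, ← Finset.sum_sub_distrib]
  refine Finset.sum_le_sum fun i _ => Finset.sum_le_sum fun j _ => ?_
  have ha := hA.eigenvalues_pos i
  have hb := hB.eigenvalues_pos j
  set a := hA'.eigenvalues i
  set b := hB'.eigenvalues j
  have hl : a * (Real.log b - Real.log a) ≤ b - a := by
    rw [← Real.log_div hb.ne' ha.ne']
    calc a * Real.log (b / a) ≤ a * (b / a - 1) :=
          mul_le_mul_of_nonneg_left (Real.log_le_sub_one_of_pos (div_pos hb ha)) ha.le
      _ = b - a := by field_simp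
  nlinarith [mul_le_mul_of_nonneg_left hl (hp i j)]

/-- Stability of positive definiteness and of `Tr[K log X]` under `X = B + εZ`. -/
lemma posDef_and_trace_mul_log_sub_le {ι : Type*} [Fintype ι] [DecidableEq ι]
    {B Z K : Matrix ι ι ℂ} (hB : B.IsHermitian) (hZ : Z.IsHermitian) (hK : K.IsHermitian) {c R ε : ℝ} (hc : 0 < c) (hR : 0 ≤ R)
    (hBc : ∀ j, c ≤ hB.eigenvalues j) (hZR : (trace (Z * Z)).re ≤ R ^ 2)
    (hε : |ε| * R ≤ c / 2) :
    (B + (ε : ℂ) • Z).PosDef ∧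
      |(trace (K * (cfc Real.log (B + (ε : ℂ) • Z) - cfc Real.log B))).re| ≤
        |ε| * (((trace (K * K)).re + (c / 2)⁻¹ ^ 2 * R ^ 2) / 2) := by
  have hX : (B + (ε : ℂ) • Z).IsHermitian := hB.add (hZ.ofReal_smul ε)
  have hd : (trace ((B + (ε : ℂ) • Z - B) * (B + (ε : ℂ) • Z - B))).re =
      ε ^ 2 * (trace (Z * Z)).re := by
    rw [add_sub_cancel_left, smul_mul_smul_comm, trace_smul, smul_eq_mul, ← Complex.ofReal_mul,
      Complex.re_ofReal_mul, sq]
  have hd' : (trace ((B + (ε : ℂ) • Z - B) * (B + (ε : ℂ) • Z - B))).re ≤ (|ε| * R) ^ 2 := by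
    rw [hd, mul_pow, sq_abs]
    exact mul_le_mul_of_nonneg_left hZR (sq_nonneg _)
  have hev : ∀ i, c / 2 ≤ hX.eigenvalues i := fun i => by
    have := hX.sub_le_eigenvalues hB (mul_nonneg (abs_nonneg ε) hR) hBc hd' i
    linarith
  refine ⟨hX.posDef_iff_eigenvalues_pos.mpr fun i => (half_pos hc).trans_le (hev i), ?_⟩
  have hlog := hX.trace_cfc_log_sub_sq_le hB (half_pos hc) hev
    (fun j => (half_le_self hc.le).trans (hBc j))
  set M := cfc Real.log (B + (ε : ℂ) • Z) - cfc Real.log B with hM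
  have hMh : M.IsHermitian :=
    IsHermitian.sub (cfc_predicate (p := IsSelfAdjoint) Real.log _)
      (cfc_predicate (p := IsSelfAdjoint) Real.log _)
  rcases eq_or_ne ε 0 with rfl | hε0
  · have : M = 0 := by simp [hM]
    simp [this]
  have hpos : 0 < |ε| := abs_pos.mpr hε0
  have hcs := hK.two_mul_abs_trace_mul_le hMh |ε|
  have hb : (trace (M * M)).re ≤ |ε| ^ 2 * ((c / 2)⁻¹ ^ 2 * R ^ 2) := by
    calc _ ≤ _ := hlog
      _ ≤ (c / 2)⁻¹ ^ 2 * (|ε| * R) ^ 2 := mul_le_mul_of_nonneg_left hd' (sq_nonneg _)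
      _ = _ := by ring
  refine le_of_mul_le_mul_left ?_ hpos
  nlinarith

/-- Second-order comparison of entropies along the normalised quadratic path
`(B + εH + ε²Y)/(1 + ε²)` and the affine path `B + εH`. -/
lemma exists_vnS_affine_comparison {k : ℕ} {B H Y : Matrix (Fin k) (Fin k) ℂ} (hB : B.PosDef)
    (hH : H.IsHermitian) (hY : Y.IsHermitian) (htB : trace B = 1) (htH : trace H = 0)
    (htY : trace Y = 1) :
    ∃ C₀ > (0 : ℝ), ∃ δ > (0 : ℝ), ∀ ε : ℝ, |ε| < δ →
      (B + (ε : ℂ) • H).PosDef ∧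
      |vnS (((1 + ε ^ 2 : ℝ) : ℂ)⁻¹ • (B + (ε : ℂ) • H + ((ε ^ 2 : ℝ) : ℂ) • Y))
          - vnS (B + (ε : ℂ) • H) - ε ^ 2 * (trace ((B - Y) * cfc Real.log B)).re|
        ≤ C₀ * |ε| ^ 3 := by
  have hBh := hB.isHermitian
  obtain ⟨c, hc, hBc⟩ : ∃ c > 0, ∀ j, c ≤ hBh.eigenvalues j := by
    rcases isEmpty_or_nonempty (Fin k) with h | h
    · exact ⟨1, one_pos, fun j => h.elim j⟩
    · obtain ⟨j, hj⟩ := Finite.exists_min hBh.eigenvalues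
      exact ⟨_, hB.eigenvalues_pos j, hj⟩
  set w : ℝ → ℂ := fun ε => (((1 + ε ^ 2)⁻¹ : ℝ) : ℂ) with hw
  have hwc : Continuous w := Complex.continuous_ofReal.comp
    (Continuous.inv₀ (by fun_prop) fun ε => by positivity)
  set K : ℝ → Matrix (Fin k) (Fin k) ℂ := fun ε => w ε • (Y - B - (ε : ℂ) • H) with hKdef
  set D : ℝ → Matrix (Fin k) (Fin k) ℂ := fun ε => w ε • (H + (ε : ℂ) • (Y - B)) with hDdef
  set Z : ℝ → Matrix (Fin k) (Fin k) ℂ := fun ε => H + (ε : ℂ) • K ε with hZdef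
  have hofR : Continuous fun ε : ℝ => (ε : ℂ) := Complex.continuous_ofReal
  have hKc : Continuous K := hwc.smul (continuous_const.sub (hofR.smul continuous_const))
  have hDc : Continuous D := hwc.smul (continuous_const.add (hofR.smul continuous_const))
  have hZc : Continuous Z := continuous_const.add (hofR.smul hKc)
  have hKh : ∀ ε, (K ε).IsHermitian := fun ε =>
    ((hY.sub hBh).sub (hH.ofReal_smul ε)).ofReal_smul _
  have hZh : ∀ ε, (Z ε).IsHermitian := fun ε => hH.add ((hKh ε).ofReal_smul ε)
  have bdd : ∀ F : ℝ → Matrix (Fin k) (Fin k) ℂ, Continuous F →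
      ∃ b : ℝ, 0 ≤ b ∧ ∀ ε : ℝ, |ε| ≤ 1 → |(trace (F ε)).re| ≤ b := by
    intro F hF
    obtain ⟨b, hb⟩ := (isCompact_Icc (a := (-1 : ℝ)) (b := 1)).exists_bound_of_continuousOn
      (Complex.continuous_re.comp hF.matrix_trace).continuousOn
    refine ⟨b, (abs_nonneg _).trans (hb 0 (by norm_num)), fun ε hε => hb ε (abs_le.mp hε)⟩
  obtain ⟨bK, hbK0, hbK⟩ := bdd (fun ε => K ε * K ε) (hKc.mul hKc)
  obtain ⟨bD, hbD0, hbD⟩ := bdd (fun ε => D ε * cfc Real.log B) (hDc.mul continuous_const)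
  obtain ⟨bZ, hbZ0, hbZ⟩ := bdd (fun ε => Z ε * Z ε) (hZc.mul hZc)
  set R : ℝ := 1 + bZ + |(trace (H * H)).re| with hRdef
  have hH0 := abs_nonneg (trace (H * H)).re
  have hR1 : 1 ≤ R := by linarith
  have hR0 : 0 < R := by linarith
  have hRsq : R ≤ R ^ 2 := by nlinarith
  set L : ℝ := (bK + (c / 2)⁻¹ ^ 2 * R ^ 2) / 2 with hL
  have hL0 : 0 < L := by positivity
  refine ⟨L + bD, by positivity, min 1 (c / 2 / R), by positivity, fun ε hε => ?_⟩
  have hε1 : |ε| ≤ 1 := (hε.trans_le (min_le_left _ _)).le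
  have hεR : |ε| * R ≤ c / 2 := (le_div_iff₀ hR0).mp (hε.trans_le (min_le_right _ _)).le
  have hHR : (trace (H * H)).re ≤ R ^ 2 := by linarith [le_abs_self (trace (H * H)).re]
  have hZR : (trace (Z ε * Z ε)).re ≤ R ^ 2 := by
    linarith [(le_abs_self _).trans (hbZ ε hε1)]
  obtain ⟨hP, hPlog⟩ := posDef_and_trace_mul_log_sub_le hBh hH (hKh ε) hc hR0.le hBc hHR hεR
  obtain ⟨hQ, hQlog⟩ := posDef_and_trace_mul_log_sub_le hBh (hZh ε) (hKh ε) hc hR0.le hBc hZR hεR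
  refine ⟨hP, ?_⟩
  have h1 : (1 + (ε : ℂ) ^ 2) ≠ 0 := by
    have : (1 + ε ^ 2 : ℝ) ≠ 0 := by positivity
    exact_mod_cast this
  have hQe : ((1 + ε ^ 2 : ℝ) : ℂ)⁻¹ • (B + (ε : ℂ) • H + ((ε ^ 2 : ℝ) : ℂ) • Y) =
      B + (ε : ℂ) • Z ε := by
    ext i j
    simp only [hZdef, hKdef, hw, Matrix.smul_apply, Matrix.add_apply, Matrix.sub_apply, smul_eq_mul]
    push_cast
    field_simp
    ring
  have hQP : B + (ε : ℂ) • Z ε - (B + (ε : ℂ) • H) = ((ε ^ 2 : ℝ) : ℂ) • K ε := by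
    simp only [hZdef, smul_add, smul_smul]
    push_cast
    rw [sq]
    abel
  have hKe : K ε = (Y - B) - (ε : ℂ) • D ε := by
    ext i j
    simp only [hDdef, hKdef, hw, Matrix.smul_apply, Matrix.add_apply, Matrix.sub_apply, smul_eq_mul]
    push_cast
    field_simp
    ring
  have htK : trace (K ε) = 0 := by
    simp [hKdef, trace_sub, trace_smul, htB, htH, htY]
  rw [hQe]
  set P := B + (ε : ℂ) • H with hPdef
  set Q := B + (ε : ℂ) • Z ε with hQdef
  have hup := vnS_sub_le hQ hP
  have hlo := vnS_sub_le hP hQ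
  rw [← neg_sub Q P, neg_mul, trace_neg, trace_neg, Complex.neg_re, Complex.neg_re] at hlo
  rw [hQP, trace_smul, htK, smul_zero, smul_mul_assoc, trace_smul, smul_eq_mul,
    Complex.re_ofReal_mul, Complex.zero_re] at hup hlo
  have hDB : (trace (K ε * cfc Real.log B)).re =
      -(trace ((B - Y) * cfc Real.log B)).re - ε * (trace (D ε * cfc Real.log B)).re := by
    rw [hKe, ← neg_sub B Y, sub_mul, neg_mul, smul_mul_assoc, trace_sub, trace_neg, trace_smul,
      smul_eq_mul, Complex.sub_re, Complex.neg_re, Complex.re_ofReal_mul]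
  have hεD : |ε * (trace (D ε * cfc Real.log B)).re| ≤ |ε| * bD := by
    rw [abs_mul]
    exact mul_le_mul_of_nonneg_left (hbD ε hε1) (abs_nonneg _)
  have hKL : |ε| * (((trace (K ε * K ε)).re + (c / 2)⁻¹ ^ 2 * R ^ 2) / 2) ≤ |ε| * L := by
    refine mul_le_mul_of_nonneg_left ?_ (abs_nonneg _)
    have := (le_abs_self _).trans (hbK ε hε1)
    simp only [hL]
    linarith
  have key : ∀ X : Matrix (Fin k) (Fin k) ℂ,
      |(trace (K ε * (cfc Real.log X - cfc Real.log B))).re| ≤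
        |ε| * (((trace (K ε * K ε)).re + (c / 2)⁻¹ ^ 2 * R ^ 2) / 2) →
      |(trace (K ε * cfc Real.log X)).re + (trace ((B - Y) * cfc Real.log B)).re| ≤
        |ε| * (L + bD) := by
    intro X hX
    rw [mul_sub, trace_sub, Complex.sub_re, hDB] at hX
    rw [abs_le] at hX hεD ⊢
    constructor <;> linarith
  have kP := abs_le.mp (key P hPlog)
  have kQ := abs_le.mp (key Q hQlog)
  have h3 : (L + bD) * |ε| ^ 3 = ε ^ 2 * (|ε| * (L + bD)) := by
    rw [← sq_abs ε]; ring
  have hs := sq_nonneg ε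
  have e1 := mul_le_mul_of_nonneg_left kP.1 hs
  have e2 := mul_le_mul_of_nonneg_left kQ.2 hs
  rw [h3, abs_le]
  constructor <;> linarith

/-- Affine parametrization of the second variation: with `A(ε) = (x+εy)(x+εy)*` and
`A₁(ε) = xx* + ε(xy*+yx*)`,
`S(A(ε)/Tr A(ε)) = S(A₁(ε)) + ε²·Tr[(xx* − yy*) log xx*] + O(ε³)`. -/
theorem affine_parametrization_second_variation
    (m n : ℕ) (x y : Matrix (Fin m) (Fin n) ℂ)
    (htrx : Matrix.trace (x * xᴴ) = 1) (htry : Matrix.trace (y * yᴴ) = 1)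
    (hpd : (x * xᴴ).PosDef)
    (horth : Matrix.trace (x * yᴴ + y * xᴴ) = 0) :
    ∃ C₀ > (0 : ℝ), ∃ δ > (0 : ℝ), ∀ ε : ℝ, |ε| < δ →
      (x * xᴴ + (ε : ℂ) • (x * yᴴ + y * xᴴ)).PosDef ∧
      |vnS ((Matrix.trace ((x + (ε : ℂ) • y) * (x + (ε : ℂ) • y)ᴴ))⁻¹ •
              ((x + (ε : ℂ) • y) * (x + (ε : ℂ) • y)ᴴ))
          - vnS (x * xᴴ + (ε : ℂ) • (x * yᴴ + y * xᴴ))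
          - ε ^ 2 * (Matrix.trace ((x * xᴴ - y * yᴴ) * cfc Real.log (x * xᴴ))).re|
        ≤ C₀ * |ε| ^ 3 := by
  have hH : (x * yᴴ + y * xᴴ).IsHermitian := by
    simp [IsHermitian, conjTranspose_add, conjTranspose_mul, add_comm]
  obtain ⟨C₀, hC₀, δ, hδ, h⟩ := exists_vnS_affine_comparison hpd hH
    (isHermitian_mul_conjTranspose_self y) htrx horth htry
  refine ⟨C₀, hC₀, δ, hδ, fun ε hε => ?_⟩
  have hA : (x + (ε : ℂ) • y) * (x + (ε : ℂ) • y)ᴴ =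
      x * xᴴ + (ε : ℂ) • (x * yᴴ + y * xᴴ) + ((ε ^ 2 : ℝ) : ℂ) • (y * yᴴ) := by
    simp only [conjTranspose_add, conjTranspose_smul, Complex.star_def, Complex.conj_ofReal,
      Matrix.add_mul, Matrix.mul_add, Matrix.smul_mul, Matrix.mul_smul, smul_add, smul_smul]
    push_cast
    rw [sq]
    abel
  have ht : trace ((x + (ε : ℂ) • y) * (x + (ε : ℂ) • y)ᴴ) = ((1 + ε ^ 2 : ℝ) : ℂ) := by
    rw [hA, trace_add, trace_add, trace_smul, trace_smul, htrx, horth, htry]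
    simp
  rw [ht, hA]
  exact h ε hε
end

section
/- Let K₁ ⊆ ℝ^{m₁×m₁} and K₂ ⊆ ℝ^{m₂×m₂} be real linear subspaces such that for i = 1, 2, Kᵢ contains the identity matrix I_{mᵢ} and a matrix Qᵢ that is both skew-symmetric (Qᵢᵀ = −Qᵢ) and orthogonal (QᵢQᵢᵀ = I). Set x := (1/√(2m₁m₂))·(Q₁ ⊗ Q₂ + I_{m₁m₂}). Then x lies in the span of Kronecker products K₁⊗K₂, Tr[xxᵀ] = 1, and H(x) = log(m₁m₂/2) = log m₁ + log m₂ − log 2; consequently, the minimum entropy output satisfies H(K₁⊗K₂) ≤ log(m₁m₂) − log 2. -/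
open Matrix
open scoped Kronecker

/-- The von Neumann entropy `H(x) = −∑ᵢ λᵢ log λᵢ`, where the `λᵢ` are the eigenvalues
of the real symmetric positive semidefinite matrix `xxᵀ` (convention `0·log 0 = 0`). -/
noncomputable def entropyEig {k : Type*} [Fintype k] [DecidableEq k]
    (x : Matrix k k ℝ) : ℝ :=
  letI := Classical.propDecidable
  if h : (x * xᵀ).IsHermitian then
    -∑ i, h.eigenvalues i * Real.log (h.eigenvalues i)
  else 0

/-- The entropy is a sum of `Real.negMulLog` over the eigenvalues of `xxᵀ`. -/
theorem entropyEig_eq_sum {k : Type*} [Fintype k] [DecidableEq k] {x : Matrix k k ℝ}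
    (h : (x * xᵀ).IsHermitian) :
    entropyEig x = -∑ i, h.eigenvalues i * Real.log (h.eigenvalues i) := by
  unfold entropyEig
  exact dif_pos h

theorem posSemidef_mul_transpose_self {k : Type*} [Fintype k] (x : Matrix k k ℝ) :
    (x * xᵀ).PosSemidef := by
  simpa [conjTranspose_eq_transpose_of_trivial] using posSemidef_self_mul_conjTranspose x

theorem entropyEig_nonneg {k : Type*} [Fintype k] [DecidableEq k] {x : Matrix k k ℝ}
    (htr : (x * xᵀ).trace = 1) : 0 ≤ entropyEig x := by
  have hpos := posSemidef_mul_transpose_self x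
  have hsum : ∑ i, hpos.isHermitian.eigenvalues i = 1 := by
    simpa [htr] using hpos.isHermitian.trace_eq_sum_eigenvalues.symm
  rw [entropyEig_eq_sum hpos.isHermitian, neg_nonneg]
  refine Finset.sum_nonpos fun i _ => ?_
  have hle : hpos.isHermitian.eigenvalues i ≤ 1 :=
    hsum ▸ Finset.single_le_sum (fun j _ => hpos.eigenvalues_nonneg j) (Finset.mem_univ i)
  exact Real.mul_log_nonpos (hpos.eigenvalues_nonneg i) hle

theorem eigenvalues_mul_self_of_mul_self {k : Type*} [Fintype k] [DecidableEq k]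
    {A : Matrix k k ℝ} (h : A.IsHermitian) {c : ℝ} (hA : A * A = c • A) (i : k) :
    h.eigenvalues i * h.eigenvalues i = c * h.eigenvalues i := by
  have hv := h.mulVec_eigenvectorBasis i
  have hne : (h.eigenvectorBasis i).ofLp ≠ 0 := by
    simpa using h.eigenvectorBasis.orthonormal.ne_zero i
  have hAv := congrArg (· *ᵥ (h.eigenvectorBasis i).ofLp) hA
  simp only [← mulVec_mulVec, smul_mulVec, hv, mulVec_smul, smul_smul] at hAv
  exact smul_left_injective ℝ hne hAv

/-- If `xxᵀ` has unit trace and is `c` times a projection, then `x` has entropy `-log c`. -/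
theorem entropyEig_eq_neg_log {k : Type*} [Fintype k] [DecidableEq k] {x : Matrix k k ℝ}
    {c : ℝ} (htr : (x * xᵀ).trace = 1) (hsq : (x * xᵀ) * (x * xᵀ) = c • (x * xᵀ)) :
    entropyEig x = -Real.log c := by
  have h := (posSemidef_mul_transpose_self x).isHermitian
  have hsum : ∑ i, h.eigenvalues i = 1 := by
    simpa [htr] using h.trace_eq_sum_eigenvalues.symm
  have hterm (i : k) :
      h.eigenvalues i * Real.log (h.eigenvalues i) = h.eigenvalues i * Real.log c := by
    by_cases h0 : h.eigenvalues i = 0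
    · simp [h0]
    · rw [mul_right_cancel₀ h0 (eigenvalues_mul_self_of_mul_self h hsq i)]
  rw [entropyEig_eq_sum h, Finset.sum_congr rfl fun i _ => hterm i, ← Finset.sum_mul, hsum,
    one_mul]

theorem trace_eq_zero_of_transpose_eq_neg {k : Type*} [Fintype k] {Q : Matrix k k ℝ}
    (h : Qᵀ = -Q) : Q.trace = 0 := by
  have := trace_transpose Q
  rw [h, trace_neg] at this
  linarith

/-- Gurvits' counterexample to additivity over the reals: if `Kᵢ` contains the identity
and a skew-symmetric orthogonal matrix `Qᵢ`, then
`x = (1/√(2m₁m₂))·(Q₁ ⊗ Q₂ + I)` lies in `K₁⊗K₂`, has unit trace `Tr[xxᵀ] = 1` and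
entropy `log(m₁m₂/2) = log m₁ + log m₂ − log 2`; hence
`H(K₁⊗K₂) ≤ log(m₁m₂) − log 2`. -/
theorem real_additivity_counterexample
    (m₁ m₂ : ℕ) (hm₁ : 0 < m₁) (hm₂ : 0 < m₂) (he₁ : Even m₁) (he₂ : Even m₂)
    (K₁ : Submodule ℝ (Matrix (Fin m₁) (Fin m₁) ℝ))
    (K₂ : Submodule ℝ (Matrix (Fin m₂) (Fin m₂) ℝ))
    (hI₁ : (1 : Matrix (Fin m₁) (Fin m₁) ℝ) ∈ K₁)
    (hI₂ : (1 : Matrix (Fin m₂) (Fin m₂) ℝ) ∈ K₂)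
    (Q₁ : Matrix (Fin m₁) (Fin m₁) ℝ) (Q₂ : Matrix (Fin m₂) (Fin m₂) ℝ)
    (hQ₁K : Q₁ ∈ K₁) (hQ₂K : Q₂ ∈ K₂)
    (hskew₁ : Q₁ᵀ = -Q₁) (hskew₂ : Q₂ᵀ = -Q₂)
    (horth₁ : Q₁ * Q₁ᵀ = 1) (horth₂ : Q₂ * Q₂ᵀ = 1) :
    let x : Matrix (Fin m₁ × Fin m₂) (Fin m₁ × Fin m₂) ℝ :=
      (1 / Real.sqrt (2 * m₁ * m₂)) • (Q₁ ⊗ₖ Q₂ + 1)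
    let T : Submodule ℝ (Matrix (Fin m₁ × Fin m₂) (Fin m₁ × Fin m₂) ℝ) :=
      Submodule.span ℝ {z | ∃ a ∈ K₁, ∃ b ∈ K₂, z = a ⊗ₖ b}
    x ∈ T ∧ Matrix.trace (x * xᵀ) = 1 ∧
    entropyEig x = Real.log ((m₁ * m₂ : ℝ) / 2) ∧
    Real.log ((m₁ * m₂ : ℝ) / 2) = Real.log m₁ + Real.log m₂ - Real.log 2 ∧
    sInf {h : ℝ | ∃ z ∈ T, Matrix.trace (z * zᵀ) = 1 ∧ h = entropyEig z}
      ≤ Real.log (m₁ * m₂ : ℝ) - Real.log 2 := by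
  intro x T
  have h₁ : (0 : ℝ) < m₁ := by exact_mod_cast hm₁
  have h₂ : (0 : ℝ) < m₂ := by exact_mod_cast hm₂
  have hxT : x ∈ T := by
    refine T.smul_mem _ (T.add_mem ?_ ?_)
    · exact Submodule.subset_span ⟨Q₁, hQ₁K, Q₂, hQ₂K, rfl⟩
    · exact Submodule.subset_span ⟨1, hI₁, 1, hI₂, one_kronecker_one.symm⟩
  have hsymm : (Q₁ ⊗ₖ Q₂)ᵀ = Q₁ ⊗ₖ Q₂ := by
    ext i j
    have e₁ := congrFun₂ hskew₁ i.1 j.1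
    have e₂ := congrFun₂ hskew₂ i.2 j.2
    simp only [transpose_apply] at e₁ e₂
    simp [kroneckerMap_apply, e₁, e₂]
  have hsq : (Q₁ ⊗ₖ Q₂) * (Q₁ ⊗ₖ Q₂) = 1 := by
    rw [← mul_kronecker_mul]
    have e₁ : Q₁ * Q₁ = -1 := by rw [← horth₁, hskew₁, mul_neg, neg_neg]
    have e₂ : Q₂ * Q₂ = -1 := by rw [← horth₂, hskew₂, mul_neg, neg_neg]
    rw [e₁, e₂]
    ext i j
    by_cases h : i.1 = j.1 <;> by_cases h' : i.2 = j.2 <;>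
      simp [kroneckerMap_apply, one_apply, Prod.ext_iff, h, h']
  have hproj : (Q₁ ⊗ₖ Q₂ + 1) * (Q₁ ⊗ₖ Q₂ + 1) = (2 : ℝ) • (Q₁ ⊗ₖ Q₂ + 1) := by
    rw [add_mul, mul_add, hsq, two_smul]
    simp only [mul_one, one_mul]
    abel
  have hxx : x * xᵀ = (1 / (m₁ * m₂ : ℝ)) • (Q₁ ⊗ₖ Q₂ + 1) := by
    simp only [x, transpose_smul, transpose_add, hsymm, transpose_one, Matrix.smul_mul,
      Matrix.mul_smul, hproj, smul_smul]
    congr 1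
    have hs := Real.mul_self_sqrt (show (0 : ℝ) ≤ 2 * m₁ * m₂ by positivity)
    rw [← mul_assoc, div_mul_div_comm, hs]
    field_simp
  have htr : (x * xᵀ).trace = 1 := by
    rw [hxx, trace_smul, trace_add, trace_kronecker, trace_eq_zero_of_transpose_eq_neg hskew₁,
      trace_one]
    simp only [zero_mul, zero_add, Fintype.card_prod, Fintype.card_fin, smul_eq_mul,
      Nat.cast_mul]
    field_simp
  have hent : entropyEig x = Real.log ((m₁ * m₂ : ℝ) / 2) := by
    rw [entropyEig_eq_neg_log (c := 2 / (m₁ * m₂ : ℝ)) htr, ← Real.log_inv, inv_div]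
    rw [hxx, Matrix.smul_mul, Matrix.mul_smul, hproj, smul_smul, smul_smul, smul_smul]
    congr 1
    ring
  have hlog : Real.log ((m₁ * m₂ : ℝ) / 2) = Real.log (m₁ * m₂ : ℝ) - Real.log 2 :=
    Real.log_div (by positivity) two_ne_zero
  refine ⟨hxT, htr, hent, ?_, ?_⟩
  · rw [hlog, Real.log_mul h₁.ne' h₂.ne']
  · rw [← hlog, ← hent]
    refine csInf_le ⟨0, ?_⟩ ⟨x, hxT, htr, rfl⟩
    rintro _ ⟨z, -, hz, rfl⟩
    exact entropyEig_nonneg hz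
end

section
/- Let K ⊆ ℝ^{m×m} be a real linear subspace such that every nonzero A ∈ K is of the form a·Q for some real scalar a and some orthogonal matrix Q, suppose I_m ∈ K, and let k := dim K ≥ 2. Then there exist matrices Q₁,…,Q_{k−1} ∈ ℝ^{m×m}, each skew-symmetric (Qᵢᵀ = −Qᵢ) and orthogonal (QᵢQᵢᵀ = I), which pairwise anticommute (QᵢQⱼ = −QⱼQᵢ for all i ≠ j), such that I_m, Q₁, …, Q_{k−1} form a basis of K. -/
open Matrix

/-- Polarization: in an orthogonal subspace, trace-orthogonal elements satisfy
`A * Bᵀ + B * Aᵀ = 0`. -/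
theorem mul_transpose_add_mul_transpose_eq_zero {m : ℕ}
    {K : Submodule ℝ (Matrix (Fin m) (Fin m) ℝ)}
    (hK : ∀ A ∈ K, A ≠ 0 →
      ∃ (a : ℝ) (Q : Matrix (Fin m) (Fin m) ℝ), Q * Qᵀ = 1 ∧ A = a • Q)
    {A B : Matrix (Fin m) (Fin m) ℝ} (hA : A ∈ K) (hB : B ∈ K)
    (h : trace (A * Bᵀ) = 0) : A * Bᵀ + B * Aᵀ = 0 := by
  have scalar : ∀ C ∈ K, ∃ c : ℝ, C * Cᵀ = c • (1 : Matrix (Fin m) (Fin m) ℝ) := by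
    intro C hC
    by_cases hC0 : C = 0
    · exact ⟨0, by simp [hC0]⟩
    · obtain ⟨a, Q, hQ, rfl⟩ := hK C hC hC0
      exact ⟨a * a, by simp [hQ, smul_smul]⟩
  obtain ⟨a, ha⟩ := scalar A hA
  obtain ⟨b, hb⟩ := scalar B hB
  obtain ⟨c, hc⟩ := scalar (A + B) (K.add_mem hA hB)
  have key : A * Bᵀ + B * Aᵀ = (c - a - b) • (1 : Matrix (Fin m) (Fin m) ℝ) := by
    rw [sub_smul, sub_smul, ← ha, ← hb, ← hc, transpose_add]
    noncomm_ring
  have htr : trace (B * Aᵀ) = 0 := by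
    rw [← trace_transpose, transpose_mul, transpose_transpose, h]
  have h0 : (c - a - b) * (m : ℝ) = 0 := by
    have := congrArg trace key
    simpa [trace_add, h, htr, eq_comm] using this
  rcases mul_eq_zero.mp h0 with h0 | h0
  · rw [key, h0, zero_smul]
  · obtain rfl : m = 0 := by exact_mod_cast h0
    exact Subsingleton.elim _ _

/-- Every subspace of real matrices contains a linearly independent family of maximal size which
is orthogonal for the trace form. -/
theorem exists_linearIndependent_trace_mul_transpose_eq_zero {m : ℕ}
    (S : Submodule ℝ (Matrix (Fin m) (Fin m) ℝ)) :
    ∃ v : Fin (Module.finrank ℝ S) → Matrix (Fin m) (Fin m) ℝ,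
      LinearIndependent ℝ v ∧ (∀ i, v i ∈ S) ∧
      ∀ i j, i ≠ j → trace (v i * (v j)ᵀ) = 0 := by
  let F : LinearMap.BilinForm ℝ S :=
    LinearMap.mk₂ ℝ (fun x y => trace ((x : Matrix (Fin m) (Fin m) ℝ) * (y.1)ᵀ))
      (by intros; simp [add_mul]) (by intros; simp)
      (by intros; simp [mul_add]) (by intros; simp)
  have hF : LinearMap.IsSymm F := ⟨fun x y => by
    change trace (x.1 * (y.1)ᵀ) = trace (y.1 * (x.1)ᵀ)
    rw [← trace_transpose, transpose_mul, transpose_transpose]⟩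
  let : Invertible (2 : ℝ) := invertibleOfNonzero two_ne_zero
  obtain ⟨v, hv⟩ := LinearMap.BilinForm.exists_orthogonal_basis (V := S) (B := F) hF
  exact ⟨fun i => v i, v.linearIndependent.map' S.subtype S.ker_subtype,
    fun i => (v i).2, fun i j hij => hv hij⟩

/-- Structural part of the Radon–Hurwitz theorem: an orthogonal subspace
`K ⊆ ℝ^{m×m}` containing the identity, of dimension `k ≥ 2`, has a basis
`I, Q₁, …, Q_{k−1}` where the `Qᵢ` are skew-symmetric, orthogonal, and pairwise
anticommuting. -/
theorem radon_hurwitz_basis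
    (m : ℕ) (K : Submodule ℝ (Matrix (Fin m) (Fin m) ℝ))
    (hK : ∀ A ∈ K, A ≠ 0 →
      ∃ (a : ℝ) (Q : Matrix (Fin m) (Fin m) ℝ), Q * Qᵀ = 1 ∧ A = a • Q)
    (hI : (1 : Matrix (Fin m) (Fin m) ℝ) ∈ K)
    (k : ℕ) (hk : k = Module.finrank ℝ K) (hk2 : 2 ≤ k) :
    ∃ Q : Fin (k - 1) → Matrix (Fin m) (Fin m) ℝ,
      (∀ i, (Q i)ᵀ = -(Q i)) ∧
      (∀ i, Q i * (Q i)ᵀ = 1) ∧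
      (∀ i j, i ≠ j → Q i * Q j = -(Q j * Q i)) ∧
      LinearIndependent ℝ (Fin.cons (1 : Matrix (Fin m) (Fin m) ℝ) Q) ∧
      Submodule.span ℝ (Set.range (Fin.cons (1 : Matrix (Fin m) (Fin m) ℝ) Q)) = K := by
  have hm : (m : ℝ) ≠ 0 := by
    rintro h
    obtain rfl : m = 0 := by exact_mod_cast h
    have : Module.finrank ℝ K = 0 := Module.finrank_zero_of_subsingleton
    omega
  let T : K →ₗ[ℝ] ℝ := traceLinearMap (Fin m) ℝ ℝ ∘ₗ K.subtype
  have hT : LinearMap.range T = ⊤ := by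
    refine LinearMap.range_eq_top.2 (LinearMap.surjective ?_)
    intro h
    apply hm
    simpa [T] using LinearMap.congr_fun h ⟨1, hI⟩
  have hdim : Module.finrank ℝ (LinearMap.ker T) = k - 1 := by
    have := LinearMap.finrank_range_add_finrank_ker T
    rw [hT, finrank_top, Module.finrank_self] at this
    omega
  obtain ⟨v, hvind, hvmem, hv⟩ : ∃ v : Fin (k - 1) → Matrix (Fin m) (Fin m) ℝ,
      LinearIndependent ℝ v ∧ (∀ i, v i ∈ (LinearMap.ker T).map K.subtype) ∧
      ∀ i j, i ≠ j → trace (v i * (v j)ᵀ) = 0 := by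
    rw [← hdim, ← Submodule.finrank_map_subtype_eq]
    exact exists_linearIndependent_trace_mul_transpose_eq_zero _
  have hvK : ∀ i, v i ∈ K := fun i => Submodule.map_subtype_le K _ (hvmem i)
  have hvtr : ∀ i, trace (v i) = 0 := fun i => by
    obtain ⟨x, hx, hxv⟩ := hvmem i
    rw [← hxv]
    exact hx
  choose a Q hQ hvQ using fun i => hK _ (hvK i) (hvind.ne_zero i)
  have ha : ∀ i, a i ≠ 0 := fun i h => hvind.ne_zero i (by rw [hvQ, h, zero_smul])
  have hQv : ∀ i, Q i = (a i)⁻¹ • v i := fun i => by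
    rw [hvQ, inv_smul_smul₀ (ha i)]
  have hQK : ∀ i, Q i ∈ K := fun i => hQv i ▸ K.smul_mem _ (hvK i)
  have hQtr : ∀ i, trace (Q i) = 0 := fun i => by
    rw [hQv, trace_smul, hvtr, smul_zero]
  have hskew : ∀ i, (Q i)ᵀ = -(Q i) := fun i => by
    have h := mul_transpose_add_mul_transpose_eq_zero hK (hQK i) hI (by simpa using hQtr i)
    rw [transpose_one, mul_one, one_mul] at h
    exact eq_neg_of_add_eq_zero_right h
  have hanti : ∀ i j, i ≠ j → Q i * Q j = -(Q j * Q i) := fun i j hij => by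
    have h := mul_transpose_add_mul_transpose_eq_zero hK (hQK i) (hQK j)
      (by rw [hQv i, hQv j]; simp [hv i j hij])
    rw [hskew, hskew, mul_neg, mul_neg, ← neg_add, neg_eq_zero] at h
    exact eq_neg_of_add_eq_zero_left h
  have hQind : LinearIndependent ℝ Q := by
    have h := hvind.units_smul fun i => (Units.mk0 (a i) (ha i))⁻¹
    rwa [show Q = (fun i => (Units.mk0 (a i) (ha i))⁻¹) • v from funext hQv]
  have hone : (1 : Matrix (Fin m) (Fin m) ℝ) ∉ Submodule.span ℝ (Set.range Q) := by
    intro h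
    have hle : Submodule.span ℝ (Set.range Q) ≤ LinearMap.ker (traceLinearMap (Fin m) ℝ ℝ) :=
      Submodule.span_le.2 (Set.range_subset_iff.2 hQtr)
    exact hm (by simpa using hle h)
  have hind : LinearIndependent ℝ (Fin.cons (1 : Matrix (Fin m) (Fin m) ℝ) Q) :=
    linearIndependent_finCons.2 ⟨hQind, hone⟩
  refine ⟨Q, hskew, hQ, hanti, hind, Submodule.eq_of_le_of_finrank_eq ?_ ?_⟩
  · rw [Submodule.span_le, Set.range_subset_iff]
    exact Fin.cases hI hQK
  · rw [finrank_span_eq_card hind, Fintype.card_fin]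
    omega
end

section
/- Let Q₁, …, Q_{k−1} ∈ ℝ^{m×m} be matrices that are each skew-symmetric (Qᵢᵀ = −Qᵢ) and orthogonal (QᵢQᵢᵀ = I) and that pairwise anticommute (QᵢQⱼ = −QⱼQᵢ for all i ≠ j). Then the span of {I_m, Q₁, …, Q_{k−1}} is a k-dimensional subspace of ℝ^{m×m} in which every nonzero element is a real scalar multiple of an orthogonal matrix. -/
open Matrix

section HurwitzEquations

variable {ι n : Type*} [Fintype ι] [Fintype n] [DecidableEq n]

/-- The Hurwitz equations `R a * (R b)ᵀ + R b * (R a)ᵀ = 2 δ_{ab}` turn a linear combination of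
the `R a` into a similarity whose squared scaling factor is the sum of squares of the
coefficients. -/
theorem sum_smul_mul_transpose_self {R : ι → Matrix n n ℝ} (hone : ∀ a, R a * (R a)ᵀ = 1)
    (hne : ∀ a b, a ≠ b → R a * (R b)ᵀ + R b * (R a)ᵀ = 0) (c : ι → ℝ) :
    (∑ a, c a • R a) * (∑ a, c a • R a)ᵀ = (∑ a, c a ^ 2) • (1 : Matrix n n ℝ) := by
  classical
  have expand : (∑ a, c a • R a) * (∑ a, c a • R a)ᵀ =
      ∑ a, ∑ b, (c a * c b) • (R a * (R b)ᵀ) := by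
    simp only [transpose_sum, transpose_smul, Finset.sum_mul_sum, smul_mul_smul_comm]
  have swap : ∑ a, ∑ b, (c a * c b) • (R a * (R b)ᵀ) =
      ∑ a, ∑ b, (c a * c b) • (R b * (R a)ᵀ) := by
    rw [Finset.sum_comm]
    simp only [mul_comm (c _) (c _)]
  have double : (2 : ℝ) • ∑ a, ∑ b, (c a * c b) • (R a * (R b)ᵀ) =
      (2 : ℝ) • (∑ a, c a ^ 2) • (1 : Matrix n n ℝ) := by
    rw [two_smul]
    nth_rewrite 2 [swap]
    simp only [← Finset.sum_add_distrib, ← smul_add]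
    rw [Finset.sum_smul, Finset.smul_sum]
    refine Finset.sum_congr rfl fun a _ => ?_
    rw [Finset.sum_eq_single a (fun b _ hb => by rw [hne a b hb.symm, smul_zero]) (by simp),
      hone, ← two_smul ℝ, smul_comm, sq]
  rw [expand]
  exact smul_right_injective _ (two_ne_zero (α := ℝ)) double

/-- Matrices satisfying the Hurwitz equations are linearly independent. -/
theorem linearIndependent_of_mul_transpose [Nonempty n] {R : ι → Matrix n n ℝ}
    (hone : ∀ a, R a * (R a)ᵀ = 1)
    (hne : ∀ a b, a ≠ b → R a * (R b)ᵀ + R b * (R a)ᵀ = 0) : LinearIndependent ℝ R := by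
  refine Fintype.linearIndependent_iff.2 fun c hc a => ?_
  have h := sum_smul_mul_transpose_self hone hne c
  rw [hc, zero_mul, eq_comm, smul_eq_zero_iff_left one_ne_zero,
    Finset.sum_eq_zero_iff_of_nonneg fun i _ => sq_nonneg (c i)] at h
  exact pow_eq_zero_iff two_ne_zero |>.1 (h a (Finset.mem_univ a))

/-- A nonzero real matrix with `A * Aᵀ` a nonnegative scalar is a multiple of an orthogonal
matrix. -/
theorem exists_smul_orthogonal_of_mul_transpose_eq_smul_one {A : Matrix n n ℝ} {s : ℝ}
    (hs : 0 ≤ s) (h : A * Aᵀ = s • (1 : Matrix n n ℝ)) (hA : A ≠ 0) :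
    ∃ (a : ℝ) (Q' : Matrix n n ℝ), Q' * Q'ᵀ = 1 ∧ A = a • Q' := by
  have hs0 : s ≠ 0 := by
    rintro rfl
    rw [zero_smul, ← conjTranspose_eq_transpose_of_trivial] at h
    exact hA (self_mul_conjTranspose_eq_zero.1 h)
  have hsqrt : √s ≠ 0 := (Real.sqrt_ne_zero hs).2 hs0
  refine ⟨√s, (√s)⁻¹ • A, ?_, (smul_inv_smul₀ hsqrt A).symm⟩
  rw [transpose_smul, smul_mul_smul_comm, h, smul_smul, ← mul_inv, Real.mul_self_sqrt hs,
    inv_mul_cancel₀ hs0, one_smul]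

end HurwitzEquations

/-- Converse part of the Radon–Hurwitz theorem: if `Q₁, …, Q_{k−1}` (here indexed by
`Fin j` with `k = j + 1`) are skew-symmetric orthogonal pairwise anticommuting matrices,
then `span(I, Q₁, …, Q_{k−1})` is a `k`-dimensional subspace in which every nonzero
element is a real scalar multiple of an orthogonal matrix. -/
theorem radon_hurwitz_converse
    (m j : ℕ) (hm : 0 < m)
    (Q : Fin j → Matrix (Fin m) (Fin m) ℝ)
    (hskew : ∀ i, (Q i)ᵀ = -(Q i))
    (horth : ∀ i, Q i * (Q i)ᵀ = 1)
    (hanti : ∀ i i', i ≠ i' → Q i * Q i' = -(Q i' * Q i)) :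
    Module.finrank ℝ
        (Submodule.span ℝ (Set.range (Fin.cons (1 : Matrix (Fin m) (Fin m) ℝ) Q)))
      = j + 1 ∧
    ∀ A ∈ Submodule.span ℝ (Set.range (Fin.cons (1 : Matrix (Fin m) (Fin m) ℝ) Q)),
      A ≠ 0 → ∃ (a : ℝ) (Q' : Matrix (Fin m) (Fin m) ℝ), Q' * Q'ᵀ = 1 ∧ A = a • Q' := by
  set R : Fin (j + 1) → Matrix (Fin m) (Fin m) ℝ := Fin.cons 1 Q with hR
  have : Nonempty (Fin m) := ⟨⟨0, hm⟩⟩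
  have hone : ∀ a, R a * (R a)ᵀ = 1 := by
    intro a
    refine Fin.cases ?_ (fun i => ?_) a
    · simp [hR]
    · simpa [hR] using horth i
  have hne : ∀ a b, a ≠ b → R a * (R b)ᵀ + R b * (R a)ᵀ = 0 := by
    intro a b
    refine Fin.cases ?_ (fun i => ?_) a <;> refine Fin.cases ?_ (fun i' => ?_) b
    · simp
    · simp [hR, hskew]
    · simp [hR, hskew]
    · intro h
      have h' : i ≠ i' := fun e => h (congrArg Fin.succ e)
      simp [hR, hskew, hanti i i' h']
  refine ⟨?_, fun A hA hA0 => ?_⟩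
  · rw [finrank_span_eq_card (linearIndependent_of_mul_transpose hone hne), Fintype.card_fin]
  · obtain ⟨c, rfl⟩ := (Submodule.mem_span_range_iff_exists_fun ℝ).1 hA
    exact exists_smul_orthogonal_of_mul_transpose_eq_smul_one
      (Finset.sum_nonneg fun i _ => sq_nonneg (c i))
      (sum_smul_mul_transpose_self hone hne c) hA0
end

section
/- Let x ∈ ℂ^{m×n} be the block matrix x = [[x₁₁, 0],[0, 0]] where x₁₁ ∈ ℂ^{r×r} is invertible and 1 ≤ r, and let y ∈ ℂ^{m×n} be arbitrary. Then the function ε ↦ H(x + εy) of the real variable ε is differentiable at ε = 0 (i.e., the first directional derivative D_y H(x) is a finite real number). -/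
open Matrix

/-- The von Neumann entropy `H(z) = −Tr[zz* log zz*]`, defined via continuous functional
calculus of `t ↦ t·log t` (with `0·log 0 = 0`). -/
noncomputable def vnEntropy {α β : Type*} [Fintype α] [Fintype β] [DecidableEq α]
    (z : Matrix α β ℂ) : ℝ :=
  -(Matrix.trace (cfc (fun t : ℝ => t * Real.log t) (z * zᴴ))).re

open Filter Topology Asymptotics Polynomial
open scoped ComplexOrder

/-- If `g ^ 2` is negligible against a continuous `q` at each zero of `q`, then on a compact
interval it is uniformly negligible where `q` is small. -/
theorem exists_forall_sq_le_of_isLittleO {g q : ℝ → ℝ} (hq : Continuous q) {R : ℝ}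
    (hq0 : ∀ t ∈ Set.Icc 0 R, 0 ≤ q t)
    (hg : ∀ a ∈ Set.Icc 0 R, q a = 0 → (fun t => g t ^ 2) =o[𝓝 a] q) {δ : ℝ} (hδ : 0 < δ) :
    ∃ η > 0, ∀ t ∈ Set.Icc 0 R, q t ≤ η → g t ^ 2 ≤ δ * q t := by
  suffices h : ∃ η > 0, ∀ t ∈ Set.Icc 0 R, q t ≤ η → g t ^ 2 ≤ δ * |q t| by
    obtain ⟨η, hη, h⟩ := h
    exact ⟨η, hη, fun t ht hle => abs_of_nonneg (hq0 t ht) ▸ h t ht hle⟩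
  refine isCompact_Icc.induction_on
    (p := fun s => ∃ η > 0, ∀ t ∈ s, q t ≤ η → g t ^ 2 ≤ δ * |q t|) ⟨1, one_pos, by simp⟩ ?_ ?_ ?_
  · rintro s t hst ⟨η, hη, h⟩
    exact ⟨η, hη, fun x hx => h x (hst hx)⟩
  · rintro s t ⟨η, hη, h⟩ ⟨η', hη', h'⟩
    refine ⟨min η η', lt_min hη hη', ?_⟩
    rintro x (hx | hx) hle
    · exact h x hx (hle.trans (min_le_left _ _))
    · exact h' x hx (hle.trans (min_le_right _ _))
  · intro a ha
    rcases (hq0 a ha).eq_or_lt with h0 | hpos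
    · refine ⟨_, mem_nhdsWithin_of_mem_nhds ((hg a ha h0.symm).def hδ), 1, one_pos, ?_⟩
      intro t ht _
      simpa using ht
    · refine ⟨{t | q a / 2 < q t}, mem_nhdsWithin_of_mem_nhds
        (hq.continuousAt.eventually_const_lt (half_lt_self hpos)), q a / 2, half_pos hpos, ?_⟩
      intro t ht hle
      exact absurd hle (not_le.2 ht)

theorem isBigO_self_mul_of_continuousAt {u h : ℝ → ℝ} {a : ℝ} (hh : ContinuousAt h a)
    (ha : h a ≠ 0) : u =O[𝓝 a] fun t => u t * h t := by
  have h1 : (fun _ : ℝ => (1 : ℝ)) =O[𝓝 a] h :=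
    (isBigO_const_left_iff_pos_le_norm one_ne_zero).2
      ⟨‖h a‖ / 2, half_pos (norm_pos_iff.2 ha),
        (hh.norm.eventually_const_lt (half_lt_self (norm_pos_iff.2 ha))).mono fun _ => le_of_lt⟩
  simpa using (isBigO_refl u (𝓝 a)).mul h1

/-- Hermite interpolation: a polynomial with prescribed values and derivatives on a finite set. -/
theorem exists_polynomial_eval_eq_derivative_eval_eq (S : Finset ℝ) (v d : ℝ → ℝ) :
    ∃ p : ℝ[X], ∀ a ∈ S, p.eval a = v a ∧ (derivative p).eval a = d a := by
  classical
  have hinj : Set.InjOn (id : ℝ → ℝ) S := Function.injective_id.injOn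
  set p₁ := Lagrange.interpolate S id v
  set N := Lagrange.nodal S (id : ℝ → ℝ)
  set p₂ := Lagrange.interpolate S id
    fun a => (d a - (derivative p₁).eval a) / (derivative N).eval a
  refine ⟨p₁ + N * p₂, fun a ha => ?_⟩
  have hN : N.eval a = 0 := Lagrange.eval_nodal_at_node (v := id) ha
  have hN' : (derivative N).eval a ≠ 0 := by
    have h := Lagrange.eval_nodal_derivative_eval_node_eq (v := (id : ℝ → ℝ)) ha
    simp only [id_eq] at h
    rw [h, Lagrange.eval_nodal, Finset.prod_ne_zero_iff]
    intro b hb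
    exact sub_ne_zero.2 (Finset.ne_of_mem_erase hb).symm
  have h₁ : p₁.eval a = v a := Lagrange.eval_interpolate_at_node _ hinj ha
  have h₂ : p₂.eval a = (d a - (derivative p₁).eval a) / (derivative N).eval a :=
    Lagrange.eval_interpolate_at_node _ hinj ha
  constructor
  · simp [hN, h₁]
  · simp only [derivative_add, derivative_mul, eval_add, eval_mul, hN, h₂]
    field_simp
    ring

theorem isLittleO_sq_mul_log_sub_polynomial {p : ℝ[X]} (hp : p.eval 0 = 0) :
    (fun t : ℝ => (t * Real.log t - p.eval t) ^ 2) =o[𝓝 0] fun t => t := by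
  have hf : Tendsto (fun t : ℝ => t * Real.log t) (𝓝 0) (𝓝 0) := by
    simpa using Real.continuous_mul_log.tendsto 0
  have hp0 : Tendsto (fun t : ℝ => p.eval t) (𝓝 0) (𝓝 0) := by
    simpa [hp] using p.continuous.tendsto 0
  have hpO : (fun t : ℝ => p.eval t) =O[𝓝 0] fun t => t := by
    simpa [hp] using (p.differentiableAt (x := 0)).isBigO_sub
  have hψ : Tendsto (fun t : ℝ => t * Real.log t ^ 2) (𝓝 0) (𝓝 0) := by
    have h : Tendsto (fun t : ℝ => 4 * (√|t| * Real.log √|t|) ^ 2) (𝓝 0) (𝓝 0) := by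
      have hc : Continuous fun t : ℝ => 4 * (√|t| * Real.log √|t|) ^ 2 :=
        ((Real.continuous_mul_log.comp (Real.continuous_sqrt.comp continuous_abs)).pow 2).const_mul 4
      simpa using hc.tendsto 0
    refine squeeze_zero_norm (fun t => le_of_eq ?_) h
    rw [Real.log_sqrt (abs_nonneg t), Real.log_abs, mul_pow, Real.sq_sqrt (abs_nonneg t),
      Real.norm_eq_abs, abs_mul, abs_of_nonneg (sq_nonneg (Real.log t))]
    ring
  have h1 : (fun t : ℝ => t * (t * Real.log t ^ 2)) =o[𝓝 0] fun t => t := by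
    simpa using (isBigO_refl (fun t : ℝ => t) (𝓝 0)).mul_isLittleO
      ((isLittleO_one_iff ℝ).2 hψ)
  have h2 : (fun t : ℝ => (p.eval t - 2 * (t * Real.log t)) * p.eval t) =o[𝓝 0] fun t => t := by
    have h : (fun t : ℝ => p.eval t - 2 * (t * Real.log t)) =o[𝓝 0] fun _ => (1 : ℝ) :=
      (isLittleO_one_iff ℝ).2 (by simpa using hp0.sub (hf.const_mul 2))
    simpa using h.mul_isBigO hpO
  refine (h1.add h2).congr_left fun t => ?_
  ring

/-- On a finite set `S` of nonnegative reals containing `0`, the function `t ↦ t log t` agrees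
with a polynomial up to an error whose square is negligible against the polynomial
`t ∏ (t - b) ^ 2`, the product being over the nonzero elements of `S`. -/
theorem exists_polynomial_sq_mul_log_sub_isLittleO (S : Finset ℝ) :
    ∃ p : ℝ[X], (∀ a ∈ S, a * Real.log a = p.eval a) ∧
      ∀ a ∈ S, (fun t : ℝ => (t * Real.log t - p.eval t) ^ 2) =o[𝓝 a]
        fun t => t * ∏ b ∈ S.erase 0, (t - b) ^ 2 := by
  obtain ⟨p, hp⟩ := exists_polynomial_eval_eq_derivative_eval_eq S
    (fun t => t * Real.log t) (fun t => Real.log t + 1)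
  refine ⟨p, fun a ha => (hp a ha).1.symm, fun a ha => ?_⟩
  rcases eq_or_ne a 0 with rfl | hne
  · refine (isLittleO_sq_mul_log_sub_polynomial (by simpa using (hp 0 ha).1)).trans_isBigO
      (isBigO_self_mul_of_continuousAt (Continuous.continuousAt (by fun_prop)) ?_)
    rw [Finset.prod_ne_zero_iff]
    intro b hb
    simpa using Finset.ne_of_mem_erase hb
  · have hd : HasDerivAt (fun t : ℝ => t * Real.log t - p.eval t) 0 a := by
      have h := (Real.hasDerivAt_mul_log hne).sub (p.hasDerivAt a)
      rwa [(hp a ha).2, sub_self] at h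
    have hg : (fun t : ℝ => t * Real.log t - p.eval t) =o[𝓝 a] fun t => t - a := by
      simpa [(hp a ha).1] using hd.isLittleO
    have hg2 : (fun t : ℝ => (t * Real.log t - p.eval t) ^ 2) =o[𝓝 a] fun t => (t - a) ^ 2 :=
      hg.pow two_pos
    have hmem : a ∈ S.erase 0 := Finset.mem_erase.2 ⟨hne, ha⟩
    refine (hg2.trans_isBigO (isBigO_self_mul_of_continuousAt
      (h := fun t => t * ∏ b ∈ (S.erase 0).erase a, (t - b) ^ 2)
      (Continuous.continuousAt (by fun_prop)) ?_)).congr_right fun t => ?_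
    · refine mul_ne_zero hne (Finset.prod_ne_zero_iff.2 fun b hb => ?_)
      exact pow_ne_zero 2 (sub_ne_zero.2 (Finset.ne_of_mem_erase hb).symm)
    · rw [← Finset.mul_prod_erase _ _ hmem]
      ring

/-- A nonnegative `C²` function vanishing at `0` is `O(ε²)` there. -/
theorem isBigO_sq_of_contDiff_of_nonneg {Q : ℝ → ℝ} (hQ : ContDiff ℝ 2 Q) (h0 : Q 0 = 0)
    (hpos : ∀ ε, 0 ≤ Q ε) : Q =O[𝓝 0] fun ε => ε ^ 2 := by
  have hd : deriv Q 0 = 0 :=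
    IsLocalMin.deriv_eq_zero (Eventually.of_forall fun ε => h0.symm ▸ hpos ε)
  have ht := taylor_isLittleO_univ (x₀ := 0) hQ
  simp only [taylorWithinEval_succ, taylor_within_zero_eval, iteratedDerivWithin_univ, h0,
    iteratedDeriv_one, zero_add, hd, smul_zero, sub_zero] at ht
  have h2 := ht.isBigO.add (isBigO_const_mul_self (2⁻¹ * iteratedDeriv 2 Q 0)
    (fun ε : ℝ => ε ^ 2) (𝓝 0))
  refine h2.congr_left fun ε => ?_
  norm_num
  ring

namespace Matrix

variable {n : Type*} [Fintype n] [DecidableEq n]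

theorem IsHermitian.trace_cfc {A : Matrix n n ℂ} (hA : A.IsHermitian) (f : ℝ → ℝ) :
    (trace (cfc f A)).re = ∑ i, f (hA.eigenvalues i) := by
  rw [hA.cfc_eq, IsHermitian.cfc, Unitary.conjStarAlgAut_apply, trace_mul_cycle]
  simp [trace]

theorem IsHermitian.trace_aeval {A : Matrix n n ℂ} (hA : A.IsHermitian) (p : ℝ[X]) :
    (trace (aeval A p)).re = ∑ i, p.eval (hA.eigenvalues i) := by
  rw [← cfc_polynomial p A hA.isSelfAdjoint, hA.trace_cfc]

theorem contDiff_trace_aeval {A : ℝ → Matrix n n ℂ} {k : WithTop ℕ∞}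
    (hA : ∀ i j, ContDiff ℝ k fun ε => A ε i j) (p : ℝ[X]) :
    ContDiff ℝ k fun ε => (trace (aeval (A ε) p)).re := by
  have hpow (m : ℕ) : ∀ i j, ContDiff ℝ k fun ε => (A ε ^ m) i j := by
    induction m with
    | zero => intro i j; simpa using contDiff_const
    | succ m ih =>
      intro i j
      simp only [pow_succ, mul_apply]
      exact ContDiff.sum fun l _ => (ih i l).mul (hA l j)
  refine Complex.reCLM.contDiff.comp (ContDiff.sum fun i _ => ?_)
  simp only [diag_apply, aeval_eq_sum_range, sum_apply, smul_apply]
  exact ContDiff.sum fun m _ => (hpow m i i).const_smul _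

/-- The trace of `A log A` is differentiable along a `C²` path of positive semidefinite
matrices. -/
theorem differentiableAt_trace_cfc_mul_log {A : ℝ → Matrix n n ℂ}
    (hA : ∀ i j, ContDiff ℝ 2 fun ε => A ε i j) (hpos : ∀ ε, (A ε).PosSemidef) :
    DifferentiableAt ℝ
      (fun ε => (trace (cfc (fun t : ℝ => t * Real.log t) (A ε))).re) 0 := by
  have hH (ε : ℝ) : (A ε).IsHermitian := (hpos ε).isHermitian
  set S : Finset ℝ := insert 0 (Finset.univ.image (hH 0).eigenvalues)
  have h0S : (0 : ℝ) ∈ S := Finset.mem_insert_self _ _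
  have hmem (i : n) : (hH 0).eigenvalues i ∈ S :=
    Finset.mem_insert_of_mem (Finset.mem_image_of_mem _ (Finset.mem_univ i))
  obtain ⟨p, hpS, hplo⟩ := exists_polynomial_sq_mul_log_sub_isLittleO S
  set g : ℝ → ℝ := fun t => t * Real.log t - p.eval t with hg
  set q : ℝ[X] := X * ∏ b ∈ S.erase 0, (X - C b) ^ 2 with hq
  have hqe (t : ℝ) : q.eval t = t * ∏ b ∈ S.erase 0, (t - b) ^ 2 := by
    simp [hq, eval_prod]
  have hqnonneg (t : ℝ) (ht : 0 ≤ t) : 0 ≤ q.eval t := by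
    rw [hqe]
    exact mul_nonneg ht (Finset.prod_nonneg fun b _ => sq_nonneg _)
  have hqzero (t : ℝ) : q.eval t = 0 ↔ t ∈ S := by
    rw [hqe, mul_eq_zero, Finset.prod_eq_zero_iff]
    constructor
    · rintro (rfl | ⟨b, hb, h⟩)
      · exact h0S
      · rw [sub_eq_zero.1 (pow_eq_zero_iff two_ne_zero |>.1 h)]
        exact Finset.mem_of_mem_erase hb
    · intro ht
      rcases eq_or_ne t 0 with h | h
      · exact Or.inl h
      · exact Or.inr ⟨t, Finset.mem_erase.2 ⟨h, ht⟩, by simp⟩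
  set Q : ℝ → ℝ := fun ε => (trace (aeval (A ε) q)).re
  have hQ (ε : ℝ) : Q ε = ∑ i, q.eval ((hH ε).eigenvalues i) := (hH ε).trace_aeval q
  have hev (ε : ℝ) (i : n) : 0 ≤ (hH ε).eigenvalues i := (hpos ε).eigenvalues_nonneg i
  have hqQ (ε : ℝ) (i : n) : q.eval ((hH ε).eigenvalues i) ≤ Q ε := by
    rw [hQ]
    exact Finset.single_le_sum (f := fun i => q.eval ((hH ε).eigenvalues i))
      (fun j _ => hqnonneg _ (hev ε j)) (Finset.mem_univ i)
  have hQ0 : Q 0 = 0 := by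
    rw [hQ]
    exact Finset.sum_eq_zero fun i _ => (hqzero _).2 (hmem i)
  have hQC : ContDiff ℝ 2 Q := contDiff_trace_aeval hA q
  have hQO : Q =O[𝓝 0] fun ε => ε ^ 2 := isBigO_sq_of_contDiff_of_nonneg hQC hQ0 fun ε => by
    rw [hQ]
    exact Finset.sum_nonneg fun i _ => hqnonneg _ (hev ε i)
  have hbdd : ∃ R, ∀ᶠ ε in 𝓝 (0 : ℝ), ∀ i, (hH ε).eigenvalues i ≤ R := by
    have hT : Continuous fun ε => (trace (aeval (A ε) (X : ℝ[X]))).re :=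
      (contDiff_trace_aeval hA X).continuous
    refine ⟨(trace (aeval (A 0) (X : ℝ[X]))).re + 1, (hT.continuousAt.eventually_lt_const (lt_add_one _)).mono
      fun ε hε i => ?_⟩
    refine le_trans ?_ hε.le
    rw [(hH ε).trace_aeval]
    simp only [eval_X]
    exact Finset.single_le_sum (f := (hH ε).eigenvalues) (fun j _ => hev ε j) (Finset.mem_univ i)
  obtain ⟨R, hR⟩ := hbdd
  set E : ℝ → ℝ := fun ε => ∑ i, g ((hH ε).eigenvalues i) with hE
  have hE0 : E 0 = 0 :=
    Finset.sum_eq_zero fun i _ => sub_eq_zero.2 (hpS _ (hmem i))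
  have hEo : E =o[𝓝 0] fun ε => ε := by
    obtain ⟨K, hK, hKb⟩ := hQO.exists_pos
    refine IsLittleO.fun_sum fun i _ => IsLittleO.of_bound fun c hc => ?_
    have hδ : 0 < c ^ 2 / K := by positivity
    obtain ⟨η, hη, hgη⟩ := exists_forall_sq_le_of_isLittleO (g := g) (q := fun t => q.eval t)
      (R := R) q.continuous (fun t ht => hqnonneg t ht.1)
      (fun a _ ha => by simpa only [hqe] using hplo a ((hqzero a).1 ha)) hδ
    have hQη : ∀ᶠ ε in 𝓝 (0 : ℝ), Q ε < η :=
      hQC.continuous.continuousAt.eventually_lt_const (hQ0.symm ▸ hη)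
    filter_upwards [hR, hQη, hKb.bound] with ε h1 h2 h3
    have h4 := hgη _ ⟨hev ε i, h1 i⟩ ((hqQ ε i).trans h2.le)
    have h5 : q.eval ((hH ε).eigenvalues i) ≤ K * ε ^ 2 := by
      refine (hqQ ε i).trans ((le_abs_self _).trans ?_)
      simpa using h3
    rw [Real.norm_eq_abs, Real.norm_eq_abs]
    refine abs_le_of_sq_le_sq ?_ (by positivity)
    calc g ((hH ε).eigenvalues i) ^ 2 ≤ c ^ 2 / K * (K * ε ^ 2) :=
          h4.trans (mul_le_mul_of_nonneg_left h5 hδ.le)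
      _ = (c * |ε|) ^ 2 := by rw [mul_pow, sq_abs]; field_simp
  have hEd : HasDerivAt E 0 0 := by
    rw [hasDerivAt_iff_isLittleO]
    simpa [hE0] using hEo
  have hG : DifferentiableAt ℝ (fun ε => (trace (aeval (A ε) p)).re) 0 :=
    (contDiff_trace_aeval hA p).differentiable two_ne_zero 0
  refine (hG.add hEd.differentiableAt).congr_of_eventuallyEq (Eventually.of_forall fun ε => ?_)
  simp [(hH ε).trace_cfc, (hH ε).trace_aeval, hE, hg]

end Matrix

/-- For `x = [[x₁₁,0],[0,0]]` with `x₁₁` invertible, the first directional derivative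
of the von Neumann entropy exists and is finite: `ε ↦ H(x + εy)` is differentiable at
`ε = 0` for every direction `y`. -/
theorem entropy_first_deriv_finite
    (r s t : ℕ) (hr : 1 ≤ r)
    (x₁₁ : Matrix (Fin r) (Fin r) ℂ) (hx₁₁ : IsUnit x₁₁)
    (x : Matrix (Fin r ⊕ Fin s) (Fin r ⊕ Fin t) ℂ)
    (hx : x = Matrix.fromBlocks x₁₁ 0 0 0)
    (y : Matrix (Fin r ⊕ Fin s) (Fin r ⊕ Fin t) ℂ) :
    DifferentiableAt ℝ (fun ε : ℝ => vnEntropy (x + (ε : ℂ) • y)) 0 := by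
  refine (Matrix.differentiableAt_trace_cfc_mul_log (fun i j => ?_)
    fun ε => Matrix.posSemidef_self_mul_conjTranspose (x + (ε : ℂ) • y)).neg
  have hentry (k l) : ContDiff ℝ 2 fun ε : ℝ => (x + (ε : ℂ) • y) k l := by
    simp only [Matrix.add_apply, Matrix.smul_apply, smul_eq_mul]
    exact contDiff_const.add (Complex.ofRealCLM.contDiff.mul contDiff_const)
  simp only [Matrix.mul_apply, Matrix.conjTranspose_apply]
  exact ContDiff.sum fun l _ => (hentry i l).mul (Complex.conjCLE.contDiff.comp (hentry j l))
end

section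
/- Let x ∈ ℂ^{m×n} be the block matrix x = [[x₁₁, 0],[0, 0]] where x₁₁ ∈ ℂ^{r×r} is invertible and 1 ≤ r, and let y ∈ ℂ^{m×n} be the block matrix y = [[y₁₁, y₁₂],[y₂₁, y₂₂]] with y₁₁ ∈ ℂ^{r×r} and conformal remaining blocks. Let L denote the derivative at ε = 0 of the function ε ↦ H(x + εy). Then y₂₂ ≠ 0 if and only if (H(x + εy) − H(x) − L·ε)/ε² tends to +∞ as ε → 0 over ε ≠ 0 (i.e., the second directional derivative D_y²H(x) is infinite). -/
open Matrix Filter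

open Polynomial in
/-- Division with remainder of a holomorphic function on the slit plane by a polynomial with
positive real roots. -/
lemma exists_eq_eval_add_prod_mul_of_differentiableOn (m : Multiset ℝ) (hm : ∀ a ∈ m, 0 < a)
    (f : ℂ → ℂ) (hf : DifferentiableOn ℂ f Complex.slitPlane) :
    ∃ (p : ℂ[X]) (h : ℂ → ℂ), DifferentiableOn ℂ h Complex.slitPlane ∧
      ∀ z, f z = p.eval z + (m.map fun a : ℝ => z - a).prod * h z := by
  induction m using Multiset.induction_on generalizing f with
  | empty => exact ⟨0, f, hf, fun z => by simp⟩
  | cons a m ih =>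
    have ha : 0 < a := hm a (by simp)
    have hnhds : Complex.slitPlane ∈ nhds (a : ℂ) :=
      Complex.isOpen_slitPlane.mem_nhds (Complex.ofReal_mem_slitPlane.2 ha)
    obtain ⟨p, h, hh, hp⟩ := ih (fun b hb => hm b (by simp [hb])) (dslope f a)
      ((Complex.differentiableOn_dslope hnhds).2 hf)
    refine ⟨C (f a) + (X - C (a : ℂ)) * p, h, hh, fun z => ?_⟩
    have key := sub_smul_dslope f (a : ℂ) z
    rw [hp z, smul_eq_mul] at key
    simp only [eval_add, eval_C, eval_mul, eval_sub, eval_X, Multiset.map_cons,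
      Multiset.prod_cons]
    linear_combination -key

open Polynomial in
lemma exists_real_eval_eq_re (p : ℂ[X]) : ∃ q : ℝ[X], ∀ t : ℝ, q.eval t = (p.eval (t : ℂ)).re := by
  induction p using Polynomial.induction_on' with
  | add p₁ p₂ h₁ h₂ =>
    obtain ⟨q₁, h₁⟩ := h₁
    obtain ⟨q₂, h₂⟩ := h₂
    exact ⟨q₁ + q₂, fun t => by simp [h₁, h₂]⟩
  | monomial n a =>
    refine ⟨monomial n a.re, fun t => ?_⟩
    rw [eval_monomial, eval_monomial, ← Complex.ofReal_pow, Complex.re_mul_ofReal]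

open Polynomial in
/-- Hermite interpolation of the logarithm at a finite family of positive nodes. -/
lemma exists_log_eq_eval_add_prod_mul (m : Multiset ℝ) (hm : ∀ a ∈ m, 0 < a) :
    ∃ (p : ℝ[X]) (h : ℝ → ℝ), ContinuousOn h (Set.Ioi 0) ∧
      ∀ t, 0 < t → Real.log t = p.eval t + ((m.map fun a => X - C a).prod).eval t * h t := by
  obtain ⟨p, h, hh, hp⟩ := exists_eq_eval_add_prod_mul_of_differentiableOn m hm Complex.log
    (fun z hz => (Complex.differentiableAt_log hz).differentiableWithinAt)
  obtain ⟨q, hq⟩ := exists_real_eval_eq_re p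
  refine ⟨q, fun t => (h t).re, ?_, fun t ht => ?_⟩
  · refine Complex.continuous_re.comp_continuousOn
      (hh.continuousOn.comp Complex.continuous_ofReal.continuousOn fun t ht => ?_)
    exact Complex.ofReal_mem_slitPlane.2 ht
  · have hprod : (m.map fun a : ℝ => (t : ℂ) - a).prod
        = ((((m.map fun a => X - C a).prod).eval t : ℝ) : ℂ) := by
      rw [eval_multiset_prod, Multiset.map_map]
      change _ = Complex.ofRealHom _
      rw [map_multiset_prod, Multiset.map_map]
      simp
    rw [← Complex.log_ofReal_re, hp t, hprod, Complex.add_re, Complex.re_ofReal_mul, hq]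

lemma eval_zero_prod_X_sub_C_ne_zero {m : Multiset ℝ} (hm : ∀ a ∈ m, 0 < a) :
    ((m.map fun a => Polynomial.X - Polynomial.C a).prod).eval 0 ≠ 0 := by
  rw [Polynomial.eval_multiset_prod, Multiset.map_map]
  refine Multiset.prod_ne_zero fun h0 => ?_
  obtain ⟨a, ha, h0⟩ := Multiset.mem_map.1 h0
  have : a = 0 := by simpa using h0
  exact (hm a ha).ne' this

/-- Bounds for the nodal function `v` and the interpolant `p` entering an estimate of
`t log t - t p(t)`. -/
lemma exists_interpolation_bounds {v p h : ℝ → ℝ} (hv : Continuous v) (hv0 : v 0 ≠ 0)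
    (hp : Continuous p) (hh : ContinuousOn h (Set.Ioi 0)) (R : ℝ) :
    ∃ δ c P B H : ℝ, 0 < δ ∧ δ ≤ 1 ∧ 0 < c ∧ 0 ≤ P ∧ 0 ≤ B ∧ 0 ≤ H ∧
      (∀ t ∈ Set.Icc 0 δ, c ≤ v t ^ 2) ∧ (∀ t ∈ Set.Icc 0 δ, |p t| ≤ P) ∧
      (∀ t ∈ Set.Icc 0 δ, v t ^ 4 ≤ B) ∧ ∀ t ∈ Set.Icc δ R, |h t| ≤ H := by
  have hpos : 0 < v 0 ^ 2 := by positivity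
  have hev : ∀ᶠ t in nhds 0, v 0 ^ 2 / 2 < v t ^ 2 :=
    ((hv.pow 2).tendsto 0).eventually (lt_mem_nhds (half_lt_self hpos))
  obtain ⟨d, hd, hball⟩ := Metric.eventually_nhds_iff.1 hev
  set δ := min (d / 2) 1 with hδ
  have hδ0 : 0 < δ := lt_min (half_pos hd) one_pos
  obtain ⟨P, hP⟩ := isCompact_Icc.exists_bound_of_continuousOn
    (hp.continuousOn (s := Set.Icc 0 δ))
  obtain ⟨B, hB⟩ := isCompact_Icc.exists_bound_of_continuousOn
    ((hv.pow 4).continuousOn (s := Set.Icc 0 δ))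
  obtain ⟨H, hH⟩ := isCompact_Icc.exists_bound_of_continuousOn
    (hh.mono fun t (ht : t ∈ Set.Icc δ R) => hδ0.trans_le ht.1)
  have h0 : (0 : ℝ) ∈ Set.Icc 0 δ := ⟨le_rfl, hδ0.le⟩
  refine ⟨δ, v 0 ^ 2 / 2, P, B, max H 0, hδ0, min_le_right _ _, half_pos hpos,
    (norm_nonneg _).trans (hP 0 h0), (norm_nonneg _).trans (hB 0 h0), le_max_right _ _,
    fun t ht => (hball ?_).le, hP, fun t ht => (le_abs_self _).trans (hB t ht),
    fun t ht => (hH t ht).trans (le_max_left _ _)⟩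
  rw [Real.dist_eq, sub_zero, abs_of_nonneg ht.1]
  exact (ht.2.trans (min_le_left _ _)).trans_lt (half_lt_self hd)

/-- Two-sided control of `t log t` by its interpolation `t p(t)`, where `v` is the nodal
function. -/
lemma exists_abs_mul_log_sub_le {v p h : ℝ → ℝ} (hv : Continuous v) (hv0 : v 0 ≠ 0)
    (hp : Continuous p) (hh : ContinuousOn h (Set.Ioi 0))
    (hlog : ∀ t, 0 < t → Real.log t = p t + v t ^ 2 * h t) (R : ℝ) :
    ∃ C, 0 ≤ C ∧ ∀ t ∈ Set.Icc 0 R, |t * Real.log t - t * p t| ≤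
      C * (t * v t ^ 2 + (t * v t ^ 4) ^ (3 / 4 : ℝ)) := by
  obtain ⟨δ, c, P, B, H, hδ, hδ1, hc, hP0, hB0, hH0, hcv, hP, hB, hH⟩ :=
    exists_interpolation_bounds hv hv0 hp hh R
  set D := 4 / (c ^ 2) ^ (3 / 4 : ℝ) with hD
  have hcr : 0 < (c ^ 2) ^ (3 / 4 : ℝ) := by positivity
  have hD0 : 0 ≤ D := by positivity
  have hPc : 0 ≤ P / c := by positivity
  refine ⟨P / c + D + H, by positivity, fun t ht => ?_⟩
  have ht0 : 0 ≤ t := ht.1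
  have hQ2 : 0 ≤ t * v t ^ 2 := by positivity
  have hQ4 : 0 ≤ (t * v t ^ 4) ^ (3 / 4 : ℝ) := by positivity
  rcases ht0.eq_or_lt with rfl | htpos
  · simp
  rcases le_total t δ with htδ | htδ
  · have hmem : t ∈ Set.Icc 0 δ := ⟨ht0, htδ⟩
    have h1 : |t * p t| ≤ P / c * (t * v t ^ 2) := by
      rw [abs_mul, abs_of_nonneg ht0]
      calc t * |p t| ≤ t * P := by gcongr; exact hP t hmem
        _ = P / c * (t * c) := by field_simp
        _ ≤ P / c * (t * v t ^ 2) := by gcongr; exact hcv t hmem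
    have h2 : |t * Real.log t| ≤ D * (t * v t ^ 4) ^ (3 / 4 : ℝ) := by
      have h3 : |Real.log t * t ^ (1 / 4 : ℝ)| < 1 / (1 / 4) :=
        Real.abs_log_mul_self_rpow_lt t (1 / 4) htpos (htδ.trans hδ1) (by norm_num)
      have h4 : t * Real.log t = Real.log t * t ^ (1 / 4 : ℝ) * t ^ (3 / 4 : ℝ) := by
        rw [mul_assoc, ← Real.rpow_add htpos]
        norm_num
        ring
      have h5 : c ^ 2 ≤ v t ^ 4 := by
        have := hcv t hmem
        nlinarith
      have h6 : (t * c ^ 2) ^ (3 / 4 : ℝ) ≤ (t * v t ^ 4) ^ (3 / 4 : ℝ) := by gcongr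
      rw [h4, abs_mul, abs_of_nonneg (by positivity : 0 ≤ t ^ (3 / 4 : ℝ))]
      calc |Real.log t * t ^ (1 / 4 : ℝ)| * t ^ (3 / 4 : ℝ) ≤ 4 * t ^ (3 / 4 : ℝ) := by
            gcongr
            norm_num at h3 ⊢
            exact h3.le
        _ = D * (t * c ^ 2) ^ (3 / 4 : ℝ) := by
            rw [Real.mul_rpow ht0 (by positivity), hD]
            field_simp
        _ ≤ D * (t * v t ^ 4) ^ (3 / 4 : ℝ) := by gcongr
    calc |t * Real.log t - t * p t| ≤ |t * Real.log t| + |t * p t| := abs_sub _ _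
      _ ≤ D * (t * v t ^ 4) ^ (3 / 4 : ℝ) + P / c * (t * v t ^ 2) := add_le_add h2 h1
      _ ≤ _ := by
        have e1 := mul_nonneg hPc hQ4
        have e2 := mul_nonneg hD0 hQ2
        have e3 := mul_nonneg hH0 hQ2
        have e4 := mul_nonneg hH0 hQ4
        linarith
  · have h1 : t * Real.log t - t * p t = t * v t ^ 2 * h t := by rw [hlog t htpos]; ring
    rw [h1, abs_mul, abs_of_nonneg hQ2]
    have h2 : t * v t ^ 2 * |h t| ≤ t * v t ^ 2 * H := by gcongr; exact hH t ⟨htδ, ht.2⟩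
    have e1 := mul_nonneg hPc hQ4
    have e2 := mul_nonneg hD0 hQ2
    have e3 := mul_nonneg hPc hQ2
    have e4 := mul_nonneg hH0 hQ4
    have e5 := mul_nonneg hD0 hQ4
    linarith

/-- One-sided control of `t log t` by its interpolation `t p(t)`, improved near `t = 0` by an
arbitrarily large multiple of `t`. -/
lemma exists_mul_log_sub_le {v p h : ℝ → ℝ} (hv : Continuous v) (hv0 : v 0 ≠ 0)
    (hp : Continuous p) (hh : ContinuousOn h (Set.Ioi 0))
    (hlog : ∀ t, 0 < t → Real.log t = p t + v t ^ 2 * h t) (R : ℝ) :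
    ∃ C, ∀ K, 0 ≤ K → ∃ C', ∀ t ∈ Set.Icc 0 R, t * Real.log t - t * p t ≤
      C * (t * v t ^ 2) - K * (t * v t ^ 4) + C' * (t * v t ^ 2) ^ 2 := by
  obtain ⟨δ, c, P, B, H, hδ, hδ1, hc, hP0, hB0, hH0, hcv, hP, hB, hH⟩ :=
    exists_interpolation_bounds hv hv0 hp hh R
  have hPc : 0 ≤ P / c := by positivity
  refine ⟨P / c + H, fun K hK => ?_⟩
  set η := min δ (Real.exp (-(K * B))) with hη
  have hη0 : 0 < η := lt_min hδ (Real.exp_pos _)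
  refine ⟨K / η, fun t ht => ?_⟩
  have ht0 : 0 ≤ t := ht.1
  have hQ2 : 0 ≤ t * v t ^ 2 := by positivity
  rcases ht0.eq_or_lt with rfl | htpos
  · simp
  have hlarge : η ≤ t → K * (t * v t ^ 4) ≤ K / η * (t * v t ^ 2) ^ 2 := fun h => by
    calc K * (t * v t ^ 4) = K / η * (η * (t * v t ^ 4)) := by field_simp
      _ ≤ K / η * (t * (t * v t ^ 4)) := by gcongr
      _ = K / η * (t * v t ^ 2) ^ 2 := by ring
  have hpos : 0 ≤ K / η * (t * v t ^ 2) ^ 2 := by positivity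
  have e1 := mul_nonneg hPc hQ2
  have e2 := mul_nonneg hH0 hQ2
  rcases le_total t δ with htδ | htδ
  · have hmem : t ∈ Set.Icc 0 δ := ⟨ht0, htδ⟩
    have h1 : -(t * p t) ≤ P / c * (t * v t ^ 2) := by
      calc -(t * p t) = t * (-p t) := by ring
        _ ≤ t * P := by gcongr; exact (neg_le_abs _).trans (hP t hmem)
        _ = P / c * (t * c) := by field_simp
        _ ≤ P / c * (t * v t ^ 2) := by gcongr; exact hcv t hmem
    rcases le_total η t with hηt | hηt
    · have h2 : t * Real.log t ≤ 0 :=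
        mul_nonpos_of_nonneg_of_nonpos ht0 (Real.log_nonpos ht0 (htδ.trans hδ1))
      linarith [hlarge hηt]
    · have h2 : Real.log t ≤ -(K * B) := by
        rw [Real.log_le_iff_le_exp htpos]
        exact hηt.trans (min_le_right _ _)
      have h3 : t * Real.log t ≤ -(K * (t * v t ^ 4)) := by
        calc t * Real.log t ≤ t * -(K * B) := by gcongr
          _ = -(K * (t * B)) := by ring
          _ ≤ -(K * (t * v t ^ 4)) := by gcongr; exact hB t hmem
      linarith
  · have h1 : t * Real.log t - t * p t = t * v t ^ 2 * h t := by rw [hlog t htpos]; ring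
    have h2 : t * v t ^ 2 * h t ≤ t * v t ^ 2 * H := by
      gcongr
      exact (le_abs_self _).trans (hH t ⟨htδ, ht.2⟩)
    linarith [hlarge ((min_le_left _ _).trans htδ)]

/-- Asymptotic data for an entropy-like sum `-∑ λᵢ log λᵢ` over a curve of nonnegative families
`λ`, whose interpolated sum `∑ λᵢ p(λᵢ)` has a second-order expansion at `0`. -/
structure EntropyExpansion {ι : Type*} [Fintype ι] (l : ℝ → ι → ℝ) (v p e g τ : ℝ → ℝ)
    (a₀ a₁ : ℝ) : Prop where
  nonneg : ∀ ε i, 0 ≤ l ε i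
  bdd : ∃ R, ∀ᶠ ε in nhds 0, ∀ i, l ε i ≤ R
  expansion : ∀ ε, ∑ i, l ε i * p (l ε i) = a₀ + a₁ * ε + ε ^ 2 * e ε
  continuous_e : Continuous e
  sum_sq : ∀ ε, ∑ i, l ε i * v (l ε i) ^ 2 = ε ^ 2 * g ε
  continuous_g : Continuous g
  sum_fourth : ∀ ε, ∑ i, l ε i * v (l ε i) ^ 4 = ε ^ 2 * τ ε
  continuous_τ : Continuous τ
  τ_nonneg : ∀ ε, 0 ≤ τ ε

namespace EntropyExpansion

variable {ι : Type*} [Fintype ι] {l : ℝ → ι → ℝ} {v p h e g τ : ℝ → ℝ} {a₀ a₁ : ℝ}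

lemma exists_abs_sub_le (H : EntropyExpansion l v p e g τ a₀ a₁) (hv : Continuous v)
    (hv0 : v 0 ≠ 0) (hp : Continuous p) (hh : ContinuousOn h (Set.Ioi 0))
    (hlog : ∀ t, 0 < t → Real.log t = p t + v t ^ 2 * h t) :
    ∃ C, 0 ≤ C ∧ ∀ᶠ ε in nhds 0,
      |∑ i, l ε i * Real.log (l ε i) - (a₀ + a₁ * ε + ε ^ 2 * e ε)| ≤
        C * (ε ^ 2 * g ε + Fintype.card ι * (ε ^ 2 * τ ε) ^ (3 / 4 : ℝ)) := by
  obtain ⟨R, hR⟩ := H.bdd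
  obtain ⟨C, hC, hb⟩ := exists_abs_mul_log_sub_le hv hv0 hp hh hlog R
  refine ⟨C, hC, hR.mono fun ε hε => ?_⟩
  rw [← H.expansion, ← Finset.sum_sub_distrib, ← H.sum_sq, ← H.sum_fourth]
  have hnn : ∀ i, 0 ≤ l ε i * v (l ε i) ^ 4 := fun i => mul_nonneg (H.nonneg ε i) (by positivity)
  calc |∑ i, (l ε i * Real.log (l ε i) - l ε i * p (l ε i))|
      ≤ ∑ i, |l ε i * Real.log (l ε i) - l ε i * p (l ε i)| := Finset.abs_sum_le_sum_abs _ _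
    _ ≤ ∑ i, C * (l ε i * v (l ε i) ^ 2 +
          (∑ j, l ε j * v (l ε j) ^ 4) ^ (3 / 4 : ℝ)) := by
        gcongr with i
        refine (hb _ ⟨H.nonneg ε i, hε i⟩).trans ?_
        gcongr
        · exact hnn i
        · exact Finset.single_le_sum (f := fun j => l ε j * v (l ε j) ^ 4)
            (fun j _ => hnn j) (Finset.mem_univ i)
    _ = _ := by rw [← Finset.mul_sum, Finset.sum_add_distrib]; simp

lemma sum_zero (H : EntropyExpansion l v p e g τ a₀ a₁) (hv : Continuous v)
    (hv0 : v 0 ≠ 0) (hp : Continuous p) (hh : ContinuousOn h (Set.Ioi 0))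
    (hlog : ∀ t, 0 < t → Real.log t = p t + v t ^ 2 * h t) :
    ∑ i, l 0 i * Real.log (l 0 i) = a₀ := by
  obtain ⟨C, -, hb⟩ := H.exists_abs_sub_le hv hv0 hp hh hlog
  have h0 := hb.self_of_nhds
  rw [zero_pow two_ne_zero, zero_mul, zero_mul, zero_mul, Real.zero_rpow (by norm_num)] at h0
  simp only [mul_zero, add_zero, abs_nonpos_iff] at h0
  linarith

lemma hasDerivAt_sum (H : EntropyExpansion l v p e g τ a₀ a₁) (hv : Continuous v)
    (hv0 : v 0 ≠ 0) (hp : Continuous p) (hh : ContinuousOn h (Set.Ioi 0))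
    (hlog : ∀ t, 0 < t → Real.log t = p t + v t ^ 2 * h t) :
    HasDerivAt (fun ε => ∑ i, l ε i * Real.log (l ε i)) a₁ 0 := by
  obtain ⟨C, hC, hb⟩ := H.exists_abs_sub_le hv hv0 hp hh hlog
  set ω : ℝ → ℝ := fun ε => C * (|ε| * g ε +
    Fintype.card ι * (|ε| ^ (1 / 2 : ℝ) * τ ε ^ (3 / 4 : ℝ))) + |ε| * |e ε| with hω
  have hωc : Continuous ω := by
    have := H.continuous_e
    have := H.continuous_g
    have h1 : Continuous fun ε : ℝ => |ε| ^ (1 / 2 : ℝ) :=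
      continuous_abs.rpow_const fun _ => Or.inr (by norm_num)
    have h2 : Continuous fun ε : ℝ => τ ε ^ (3 / 4 : ℝ) :=
      H.continuous_τ.rpow_const fun _ => Or.inr (by norm_num)
    fun_prop
  have hω0 : ω 0 = 0 := by simp [hω]
  rw [hasDerivAt_iff_isLittleO, Asymptotics.isLittleO_iff]
  intro c hc
  have hsmall : ∀ᶠ ε in nhds 0, ω ε < c :=
    (hωc.tendsto 0).eventually (gt_mem_nhds (by rwa [hω0]))
  filter_upwards [hb, hsmall] with ε h1 h2
  rw [H.sum_zero hv hv0 hp hh hlog, sub_zero, smul_eq_mul, Real.norm_eq_abs, Real.norm_eq_abs]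
  have hpow : (ε ^ 2 * τ ε) ^ (3 / 4 : ℝ) = |ε| * (|ε| ^ (1 / 2 : ℝ) * τ ε ^ (3 / 4 : ℝ)) := by
    rcases eq_or_ne ε 0 with rfl | hε
    · simp
    have hε' : 0 < |ε| := abs_pos.2 hε
    rw [Real.mul_rpow (sq_nonneg _) (H.τ_nonneg ε), ← sq_abs, ← Real.rpow_natCast,
      ← Real.rpow_mul hε'.le, ← mul_assoc]
    congr 1
    rw [← Real.rpow_one_add' hε'.le (by norm_num)]
    norm_num
  have habs : ε ^ 2 = |ε| * |ε| := by rw [← sq, sq_abs]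
  calc |∑ i, l ε i * Real.log (l ε i) - a₀ - ε * a₁|
      = |(∑ i, l ε i * Real.log (l ε i) - (a₀ + a₁ * ε + ε ^ 2 * e ε)) + ε ^ 2 * e ε| := by
        congr 1; ring
    _ ≤ C * (ε ^ 2 * g ε + Fintype.card ι * (ε ^ 2 * τ ε) ^ (3 / 4 : ℝ)) + |ε ^ 2 * e ε| :=
        (abs_add_le _ _).trans (add_le_add_left h1 _)
    _ = ω ε * |ε| := by
        rw [hpow, abs_mul, abs_of_nonneg (sq_nonneg ε), habs, hω]; ring
    _ ≤ c * |ε| := by gcongr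

lemma tendsto_atTop (H : EntropyExpansion l v p e g τ a₀ a₁) (hv : Continuous v)
    (hv0 : v 0 ≠ 0) (hp : Continuous p) (hh : ContinuousOn h (Set.Ioi 0))
    (hlog : ∀ t, 0 < t → Real.log t = p t + v t ^ 2 * h t) (hτ : 0 < τ 0) :
    Tendsto (fun ε => (a₀ + a₁ * ε - ∑ i, l ε i * Real.log (l ε i)) / ε ^ 2)
      (nhdsWithin 0 {0}ᶜ) atTop := by
  obtain ⟨R, hR⟩ := H.bdd
  obtain ⟨C, hC⟩ := exists_mul_log_sub_le hv hv0 hp hh hlog R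
  rw [Filter.tendsto_atTop]
  intro M
  set K := (|M + C * g 0 + e 0| + 1) / τ 0 with hK
  have hK0 : 0 ≤ K := by positivity
  obtain ⟨C', hC'⟩ := hC K hK0
  set b : ℝ → ℝ := fun ε => K * τ ε - C * g ε - |C'| * (ε * g ε) ^ 2 - e ε with hb
  have hbc : Continuous b := by
    have := H.continuous_e
    have := H.continuous_g
    have := H.continuous_τ
    fun_prop
  have hb0 : M < b 0 := by
    have h1 : K * τ 0 = |M + C * g 0 + e 0| + 1 := by rw [hK]; field_simp
    have h2 := le_abs_self (M + C * g 0 + e 0)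
    simp only [hb, h1]
    linarith
  filter_upwards [nhdsWithin_le_nhds ((hbc.tendsto 0).eventually (lt_mem_nhds hb0)),
    nhdsWithin_le_nhds hR, self_mem_nhdsWithin] with ε h1 h2 h3
  have hε : 0 < ε ^ 2 := by
    have : ε ≠ 0 := h3
    positivity
  have hnn : ∀ i, 0 ≤ l ε i * v (l ε i) ^ 2 := fun i => mul_nonneg (H.nonneg ε i) (sq_nonneg _)
  have hsq : ∑ i, (l ε i * v (l ε i) ^ 2) ^ 2 ≤ (ε ^ 2 * g ε) ^ 2 := by
    rw [← H.sum_sq]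
    exact Finset.sum_sq_le_sq_sum_of_nonneg fun i _ => hnn i
  have hsum : ∑ i, l ε i * Real.log (l ε i) - (a₀ + a₁ * ε + ε ^ 2 * e ε) ≤
      C * (ε ^ 2 * g ε) - K * (ε ^ 2 * τ ε) + |C'| * (ε ^ 2 * g ε) ^ 2 := by
    calc ∑ i, l ε i * Real.log (l ε i) - (a₀ + a₁ * ε + ε ^ 2 * e ε)
        = ∑ i, (l ε i * Real.log (l ε i) - l ε i * p (l ε i)) := by
          rw [← H.expansion, Finset.sum_sub_distrib]
      _ ≤ ∑ i, (C * (l ε i * v (l ε i) ^ 2) - K * (l ε i * v (l ε i) ^ 4) +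
            |C'| * (l ε i * v (l ε i) ^ 2) ^ 2) := by
          gcongr with i
          refine (hC' _ ⟨H.nonneg ε i, h2 i⟩).trans ?_
          gcongr
          exact le_abs_self _
      _ = C * (ε ^ 2 * g ε) - K * (ε ^ 2 * τ ε) +
            |C'| * ∑ i, (l ε i * v (l ε i) ^ 2) ^ 2 := by
          rw [Finset.sum_add_distrib, Finset.sum_sub_distrib, ← Finset.mul_sum, ← Finset.mul_sum,
            ← Finset.mul_sum, H.sum_sq, H.sum_fourth]
      _ ≤ _ := by gcongr
  rw [le_div_iff₀ hε]
  calc M * ε ^ 2 ≤ b ε * ε ^ 2 := by gcongr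
    _ = -(C * (ε ^ 2 * g ε) - K * (ε ^ 2 * τ ε) + |C'| * (ε ^ 2 * g ε) ^ 2)
          - ε ^ 2 * e ε := by rw [hb]; ring
    _ ≤ _ := by linarith

lemma not_tendsto_atTop (H : EntropyExpansion l v p e g τ a₀ a₁) (hv : Continuous v)
    (hv0 : v 0 ≠ 0) (hp : Continuous p) (hh : ContinuousOn h (Set.Ioi 0))
    (hlog : ∀ t, 0 < t → Real.log t = p t + v t ^ 2 * h t)
    {σ : ℝ → ℝ} (hσ : Continuous σ) (hσ0 : ∀ ε, 0 ≤ σ ε) (hτσ : ∀ ε, τ ε = ε ^ 2 * σ ε) :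
    ¬ Tendsto (fun ε => (a₀ + a₁ * ε - ∑ i, l ε i * Real.log (l ε i)) / ε ^ 2)
      (nhdsWithin 0 {0}ᶜ) atTop := by
  obtain ⟨C, hC, hb⟩ := H.exists_abs_sub_le hv hv0 hp hh hlog
  set b : ℝ → ℝ := fun ε => C * (g ε + Fintype.card ι * (|ε| * σ ε ^ (3 / 4 : ℝ))) - e ε with hbdef
  have hbc : Continuous b := by
    have := H.continuous_e
    have := H.continuous_g
    have h2 : Continuous fun ε : ℝ => σ ε ^ (3 / 4 : ℝ) :=
      hσ.rpow_const fun _ => Or.inr (by norm_num)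
    fun_prop
  intro hT
  have hbig := hT.eventually_ge_atTop (b 0 + 1)
  have hsmall : ∀ᶠ ε in nhdsWithin (0 : ℝ) {0}ᶜ, b ε < b 0 + 1 :=
    nhdsWithin_le_nhds ((hbc.tendsto 0).eventually (gt_mem_nhds (lt_add_one _)))
  obtain ⟨ε, h1, h2, h3, h4⟩ := (hbig.and (hsmall.and
    ((hb.filter_mono nhdsWithin_le_nhds).and self_mem_nhdsWithin))).exists
  have hε0 : ε ≠ 0 := h4
  have hε : 0 < ε ^ 2 := by positivity
  have hpow : (ε ^ 2 * τ ε) ^ (3 / 4 : ℝ) = ε ^ 2 * (|ε| * σ ε ^ (3 / 4 : ℝ)) := by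
    have hε' : 0 < |ε| := abs_pos.2 hε0
    have h5 : ε ^ 2 * τ ε = |ε| ^ 4 * σ ε := by rw [hτσ, ← sq_abs]; ring
    rw [h5, Real.mul_rpow (by positivity) (hσ0 ε), ← Real.rpow_natCast,
      ← Real.rpow_mul hε'.le, ← mul_assoc]
    congr 1
    rw [← sq_abs, ← pow_succ]
    norm_num
  rw [le_div_iff₀ hε] at h1
  have h5 := neg_abs_le (∑ i, l ε i * Real.log (l ε i) - (a₀ + a₁ * ε + ε ^ 2 * e ε))
  have h6 : (b ε) * ε ^ 2 = C * (ε ^ 2 * g ε + Fintype.card ι * (ε ^ 2 * τ ε) ^ (3 / 4 : ℝ))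
      - ε ^ 2 * e ε := by rw [hpow, hbdef]; ring
  have h7 : b ε * ε ^ 2 < (b 0 + 1) * ε ^ 2 := by gcongr
  linarith

end EntropyExpansion

section QuadraticExpansion

variable {α β : Type*}

/-- The curve `F` of matrices has the expansion `F ε = M₀ + ε M₁ + ε² E(ε)` with `E` continuous. -/
def HasQuadExpansion (F : ℝ → Matrix α β ℂ) (M₀ M₁ : Matrix α β ℂ) : Prop :=
  ∃ E : ℝ → Matrix α β ℂ, Continuous E ∧ ∀ ε, F ε = M₀ + ε • M₁ + ε ^ 2 • E ε

namespace HasQuadExpansion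

variable {F : ℝ → Matrix α β ℂ} {M₀ M₁ : Matrix α β ℂ}

lemma const (M : Matrix α β ℂ) : HasQuadExpansion (fun _ => M) M 0 :=
  ⟨0, continuous_const, fun ε => by simp⟩

lemma line (x y : Matrix α β ℂ) : HasQuadExpansion (fun ε : ℝ => x + ε • y) x y :=
  ⟨0, continuous_const, fun ε => by simp⟩

lemma add {G : ℝ → Matrix α β ℂ} {N₀ N₁ : Matrix α β ℂ}
    (hF : HasQuadExpansion F M₀ M₁) (hG : HasQuadExpansion G N₀ N₁) :
    HasQuadExpansion (fun ε => F ε + G ε) (M₀ + N₀) (M₁ + N₁) := by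
  obtain ⟨E, hE, hF⟩ := hF
  obtain ⟨E', hE', hG⟩ := hG
  refine ⟨fun ε => E ε + E' ε, hE.add hE', fun ε => ?_⟩
  simp only [hF, hG]
  module

lemma mul {γ : Type*} [Fintype β] {G : ℝ → Matrix β γ ℂ} {N₀ N₁ : Matrix β γ ℂ}
    (hF : HasQuadExpansion F M₀ M₁) (hG : HasQuadExpansion G N₀ N₁) :
    HasQuadExpansion (fun ε => F ε * G ε) (M₀ * N₀) (M₀ * N₁ + M₁ * N₀) := by
  obtain ⟨E, hE, hF⟩ := hF
  obtain ⟨E', hE', hG⟩ := hG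
  refine ⟨fun ε => M₀ * E' ε + M₁ * N₁ + E ε * N₀ + ε • (M₁ * E' ε + E ε * N₁)
    + ε ^ 2 • (E ε * E' ε), by fun_prop, fun ε => ?_⟩
  simp only [hF, hG, Matrix.add_mul, Matrix.mul_add, Matrix.smul_mul, Matrix.mul_smul]
  module

lemma conjTranspose (hF : HasQuadExpansion F M₀ M₁) :
    HasQuadExpansion (fun ε => (F ε)ᴴ) M₀ᴴ M₁ᴴ := by
  obtain ⟨E, hE, hF⟩ := hF
  refine ⟨fun ε => (E ε)ᴴ, hE.matrix_conjTranspose, fun ε => ?_⟩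
  simp [hF, Matrix.conjTranspose_add, Matrix.conjTranspose_smul]

lemma aeval [Fintype α] [DecidableEq α] {F : ℝ → Matrix α α ℂ} {M₀ M₁ : Matrix α α ℂ}
    (hF : HasQuadExpansion F M₀ M₁) (q : Polynomial ℝ) :
    ∃ N₁, HasQuadExpansion (fun ε => Polynomial.aeval (F ε) q) (Polynomial.aeval M₀ q) N₁ := by
  induction q using Polynomial.induction_on with
  | C a =>
    simp only [Polynomial.aeval_C]
    exact ⟨0, .const _⟩
  | add q₁ q₂ h₁ h₂ =>
    obtain ⟨N₁, h₁⟩ := h₁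
    obtain ⟨N₂, h₂⟩ := h₂
    simp only [map_add]
    exact ⟨_, h₁.add h₂⟩
  | monomial n a h =>
    obtain ⟨N₁, h⟩ := h
    simp only [pow_succ, ← mul_assoc, map_mul _ _ Polynomial.X, Polynomial.aeval_X]
    exact ⟨_, h.mul hF⟩

lemma exists_eq_add_smul (hF : HasQuadExpansion F M₀ M₁) :
    ∃ D : ℝ → Matrix α β ℂ, Continuous D ∧ ∀ ε, F ε = M₀ + ε • D ε := by
  obtain ⟨E, hE, hF⟩ := hF
  refine ⟨fun ε => M₁ + ε • E ε, by fun_prop, fun ε => ?_⟩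
  rw [hF]
  module

end HasQuadExpansion

end QuadraticExpansion

section Trace

variable {α β : Type*} [Fintype α] [Fintype β]

open scoped ComplexOrder in
lemma Matrix.re_trace_mul_conjTranspose_self_nonneg (z : Matrix α β ℂ) :
    0 ≤ (z * zᴴ).trace.re :=
  (Complex.nonneg_iff.1 (Matrix.posSemidef_self_mul_conjTranspose z).trace_nonneg).1

open scoped ComplexOrder in
lemma Matrix.re_trace_mul_conjTranspose_self_pos {z : Matrix α β ℂ} (hz : z ≠ 0) :
    0 < (z * zᴴ).trace.re := by
  have h := (Matrix.posSemidef_self_mul_conjTranspose z).trace_nonneg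
  have h' := Complex.nonneg_iff.1 h
  refine h'.1.lt_of_ne fun h0 => hz ?_
  rw [← Matrix.trace_mul_conjTranspose_self_eq_zero_iff]
  exact Complex.ext h0.symm h'.2.symm

lemma continuous_re_trace_mul_conjTranspose_self {G : ℝ → Matrix α β ℂ} (hG : Continuous G) :
    Continuous fun ε => (G ε * (G ε)ᴴ).trace.re :=
  Complex.continuous_re.comp (hG.matrix_mul hG.matrix_conjTranspose).matrix_trace

lemma re_trace_smul_mul_conjTranspose_self (c : ℝ) (z : Matrix α β ℂ) :
    ((c • z) * (c • z)ᴴ).trace.re = c ^ 2 * (z * zᴴ).trace.re := by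
  simp [Matrix.conjTranspose_smul, Matrix.trace_smul, sq, mul_assoc]

variable [DecidableEq α]

lemma Matrix.IsHermitian.re_trace_cfc {A : Matrix α α ℂ} (hA : A.IsHermitian) (f : ℝ → ℝ) :
    (cfc f A).trace.re = ∑ i, f (hA.eigenvalues i) := by
  rw [hA.cfc_eq, Matrix.IsHermitian.cfc, Unitary.conjStarAlgAut_apply, Matrix.trace_mul_cycle,
    Unitary.coe_star_mul_self, one_mul, Matrix.trace_diagonal]
  simp

lemma Matrix.IsHermitian.re_trace_aeval {A : Matrix α α ℂ} (hA : A.IsHermitian)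
    (q : Polynomial ℝ) :
    (Polynomial.aeval A q).trace.re = ∑ i, q.eval (hA.eigenvalues i) := by
  rw [← cfc_polynomial q A hA.isSelfAdjoint, hA.re_trace_cfc]

lemma Matrix.IsHermitian.aeval {A : Matrix α α ℂ} (hA : A.IsHermitian) (q : Polynomial ℝ) :
    (Polynomial.aeval A q).IsHermitian := by
  rw [← cfc_polynomial q A hA.isSelfAdjoint]
  exact IsSelfAdjoint.cfc

variable [DecidableEq β] in
lemma Matrix.mul_aeval_conjTranspose_mul_self (z : Matrix α β ℂ) (q : Polynomial ℝ) :
    z * Polynomial.aeval (zᴴ * z) q = Polynomial.aeval (z * zᴴ) q * z := by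
  induction q using Polynomial.induction_on with
  | C a => simp [Polynomial.aeval_C, Algebra.algebraMap_eq_smul_one]
  | add q₁ q₂ h₁ h₂ => simp [Matrix.mul_add, Matrix.add_mul, h₁, h₂]
  | monomial n a h =>
    simp only [pow_succ, ← mul_assoc, map_mul _ _ Polynomial.X, Polynomial.aeval_X] at h ⊢
    rw [← Matrix.mul_assoc, h]
    simp only [Matrix.mul_assoc]

/-- The trace of `A v(A)²` for `A = z z*`. -/
lemma Matrix.trace_aeval_X_mul_sq (z : Matrix α β ℂ) (v : Polynomial ℝ) :
    (Polynomial.aeval (z * zᴴ) (Polynomial.X * v ^ 2)).trace =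
      ((Polynomial.aeval (z * zᴴ) v * z) * (Polynomial.aeval (z * zᴴ) v * z)ᴴ).trace := by
  rw [Matrix.conjTranspose_mul, ((Matrix.isHermitian_mul_conjTranspose_self z).aeval v).eq]
  have : Polynomial.X * v ^ 2 = v * Polynomial.X * v := by ring
  rw [this, map_mul, map_mul, Polynomial.aeval_X]
  simp only [Matrix.mul_assoc]

open scoped ComplexOrder in
lemma Matrix.eigenvalues_self_mul_conjTranspose_pos {z : Matrix α α ℂ} (hz : IsUnit z) (i : α) :
    0 < (Matrix.isHermitian_mul_conjTranspose_self z).eigenvalues i :=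
  (Matrix.PosDef.mul_conjTranspose_self z
    (Matrix.vecMul_injective_of_isUnit hz)).eigenvalues_pos i

lemma vnEntropy_eq_neg_sum (z : Matrix α β ℂ) :
    vnEntropy z = -∑ i, (Matrix.isHermitian_mul_conjTranspose_self z).eigenvalues i *
      Real.log ((Matrix.isHermitian_mul_conjTranspose_self z).eigenvalues i) := by
  rw [vnEntropy, (Matrix.isHermitian_mul_conjTranspose_self z).re_trace_cfc]

variable [DecidableEq β] in
/-- The curve `v(zz*) z v(z*z)` along a line, for `v` annihilating `x`, has linear part
`v(xx*) y v(x*x)`. -/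
lemma exists_aeval_mul_mul_aeval_eq (x y : Matrix α β ℂ) (v : Polynomial ℝ)
    (hv : Polynomial.aeval (x * xᴴ) v * x = 0) :
    (∃ D : ℝ → Matrix α β ℂ, Continuous D ∧ ∀ ε : ℝ,
      Polynomial.aeval ((x + ε • y) * (x + ε • y)ᴴ) v * (x + ε • y) = ε • D ε) ∧
    ∃ G : ℝ → Matrix α β ℂ, Continuous G ∧ ∀ ε : ℝ,
      Polynomial.aeval ((x + ε • y) * (x + ε • y)ᴴ) (v ^ 2) * (x + ε • y) =
        ε • (Polynomial.aeval (x * xᴴ) v * y * Polynomial.aeval (xᴴ * x) v + ε • G ε) := by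
  have hv' : x * Polynomial.aeval (xᴴ * x) v = 0 := by
    rw [Matrix.mul_aeval_conjTranspose_mul_self, hv]
  have hz := HasQuadExpansion.line x y
  obtain ⟨_, hA⟩ := (hz.mul hz.conjTranspose).aeval v
  obtain ⟨_, hB⟩ := (hz.conjTranspose.mul hz).aeval v
  obtain ⟨D, hD, hA⟩ := hA.exists_eq_add_smul
  obtain ⟨E, hE, hB⟩ := hB.exists_eq_add_smul
  have hAz (ε : ℝ) : Polynomial.aeval ((x + ε • y) * (x + ε • y)ᴴ) v * (x + ε • y) =
      ε • (D ε * x + Polynomial.aeval (x * xᴴ) v * y + ε • (D ε * y)) := by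
    rw [hA]
    simp only [Matrix.add_mul, Matrix.mul_add, Matrix.smul_mul, Matrix.mul_smul, hv]
    module
  refine ⟨⟨_, by fun_prop, hAz⟩, fun ε => D ε * x * E ε + D ε * y * Polynomial.aeval (xᴴ * x) v +
    Polynomial.aeval (x * xᴴ) v * y * E ε + ε • (D ε * y * E ε), by fun_prop, fun ε => ?_⟩
  rw [sq, map_mul, Matrix.mul_assoc, ← Matrix.mul_aeval_conjTranspose_mul_self,
    ← Matrix.mul_assoc, hAz, hB]
  simp only [Matrix.add_mul, Matrix.mul_add, Matrix.smul_mul, Matrix.mul_smul,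
    Matrix.mul_assoc, hv', Matrix.mul_zero]
  module

/-- The entropy along a line `x + ε y` as an entropy-like sum, for `v` a polynomial that
annihilates the nonzero spectrum of `x x*`. -/
lemma exists_entropyExpansion {x y : Matrix α β ℂ} {v : Polynomial ℝ} (p : Polynomial ℝ)
    {N : Matrix α β ℂ} {D G : ℝ → Matrix α β ℂ} (hDc : Continuous D)
    (hD : ∀ ε : ℝ, Polynomial.aeval ((x + ε • y) * (x + ε • y)ᴴ) v * (x + ε • y) = ε • D ε)
    (hGc : Continuous G)
    (hG : ∀ ε : ℝ, Polynomial.aeval ((x + ε • y) * (x + ε • y)ᴴ) (v ^ 2) * (x + ε • y) =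
      ε • (N + ε • G ε)) :
    ∃ (l : ℝ → α → ℝ) (e g : ℝ → ℝ) (a₀ a₁ : ℝ),
      (∀ ε : ℝ, vnEntropy (x + ε • y) = -∑ i, l ε i * Real.log (l ε i)) ∧
      EntropyExpansion l v.eval p.eval e g
        (fun ε => ((N + ε • G ε) * (N + ε • G ε)ᴴ).trace.re) a₀ a₁ := by
  have hA (ε : ℝ) := Matrix.isHermitian_mul_conjTranspose_self (x + ε • y)
  have hz := HasQuadExpansion.line x y
  obtain ⟨M₁, E, hE, hM⟩ := (hz.mul hz.conjTranspose).aeval (Polynomial.X * p)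
  have hnn (ε : ℝ) (i : α) : 0 ≤ (hA ε).eigenvalues i :=
    Matrix.eigenvalues_self_mul_conjTranspose_nonneg (x + ε • y) i
  refine ⟨fun ε => (hA ε).eigenvalues, fun ε => (E ε).trace.re,
    fun ε => (D ε * (D ε)ᴴ).trace.re, (Polynomial.aeval (x * xᴴ) (Polynomial.X * p)).trace.re,
    M₁.trace.re, fun ε => vnEntropy_eq_neg_sum _,
    ⟨hnn, ?_, fun ε => ?_, by fun_prop, fun ε => ?_,
    continuous_re_trace_mul_conjTranspose_self hDc, fun ε => ?_,
    continuous_re_trace_mul_conjTranspose_self (by fun_prop),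
    fun ε => Matrix.re_trace_mul_conjTranspose_self_nonneg _⟩⟩
  · have hc : Continuous fun ε : ℝ => ((x + ε • y) * (x + ε • y)ᴴ).trace.re :=
      continuous_re_trace_mul_conjTranspose_self (by fun_prop)
    refine ⟨((x + (0 : ℝ) • y) * (x + (0 : ℝ) • y)ᴴ).trace.re + 1,
      ((hc.tendsto 0).eventually (gt_mem_nhds (lt_add_one _))).mono fun ε hε i => ?_⟩
    refine le_trans ?_ hε.le
    have htr := (hA ε).re_trace_aeval Polynomial.X
    simp only [Polynomial.aeval_X, Polynomial.eval_X] at htr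
    rw [htr]
    exact Finset.single_le_sum (fun j _ => hnn ε j) (Finset.mem_univ i)
  · have h := (hA ε).re_trace_aeval (Polynomial.X * p)
    rw [show Polynomial.aeval _ _ = _ from hM ε] at h
    simp only [Polynomial.eval_mul, Polynomial.eval_X] at h
    rw [← h]
    simp only [Matrix.trace_add, Matrix.trace_smul, Complex.add_re, Complex.smul_re, smul_eq_mul,
      mul_comm]
  · have h := (hA ε).re_trace_aeval (Polynomial.X * v ^ 2)
    rw [Matrix.trace_aeval_X_mul_sq, hD, re_trace_smul_mul_conjTranspose_self] at h
    simpa using h.symm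
  · have h := (hA ε).re_trace_aeval (Polynomial.X * (v ^ 2) ^ 2)
    rw [Matrix.trace_aeval_X_mul_sq, hG, re_trace_smul_mul_conjTranspose_self] at h
    simpa [← pow_mul] using h.symm

variable [DecidableEq β] in
lemma tendsto_second_difference_iff {x y : Matrix α β ℂ} (m : Multiset ℝ) (hm : ∀ a ∈ m, 0 < a)
    {v : Polynomial ℝ} (hvm : v = (m.map fun a => Polynomial.X - Polynomial.C a).prod)
    (hv : Polynomial.aeval (x * xᴴ) v * x = 0) :
    Tendsto (fun ε : ℝ => (vnEntropy (x + ε • y) - vnEntropy x -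
        deriv (fun ε : ℝ => vnEntropy (x + ε • y)) 0 * ε) / ε ^ 2)
      (nhdsWithin 0 {0}ᶜ) atTop ↔
    Polynomial.aeval (x * xᴴ) v * y * Polynomial.aeval (xᴴ * x) v ≠ 0 := by
  obtain ⟨⟨D, hDc, hD⟩, G, hGc, hG⟩ := exists_aeval_mul_mul_aeval_eq x y v hv
  set N := Polynomial.aeval (x * xᴴ) v * y * Polynomial.aeval (xᴴ * x) v
  obtain ⟨p, h, hh, hlog⟩ := exists_log_eq_eval_add_prod_mul (m + m) (by simpa using hm)
  replace hlog (t : ℝ) (ht : 0 < t) : Real.log t = p.eval t + v.eval t ^ 2 * h t := by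
    rw [hlog t ht, Multiset.map_add, Multiset.prod_add, ← hvm, Polynomial.eval_mul, sq]
  obtain ⟨l, e, g, a₀, a₁, hS, hH⟩ := exists_entropyExpansion p hDc hD hGc hG
  have hv0 : v.eval 0 ≠ 0 := hvm ▸ eval_zero_prod_X_sub_C_ne_zero hm
  have hx0 : vnEntropy x = -a₀ := by
    have := hS 0
    rwa [zero_smul, add_zero, hH.sum_zero v.continuous hv0 p.continuous hh hlog] at this
  have hderiv : deriv (fun ε : ℝ => vnEntropy (x + ε • y)) 0 = -a₁ := by
    rw [funext hS]
    exact (hH.hasDerivAt_sum v.continuous hv0 p.continuous hh hlog).neg.deriv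
  have hfun : (fun ε : ℝ => (vnEntropy (x + ε • y) - vnEntropy x -
        deriv (fun ε : ℝ => vnEntropy (x + ε • y)) 0 * ε) / ε ^ 2) =
      fun ε => (a₀ + a₁ * ε - ∑ i, l ε i * Real.log (l ε i)) / ε ^ 2 := by
    funext ε
    rw [hderiv, hx0, hS]
    ring
  rw [hfun]
  constructor
  · intro hT hN
    refine hH.not_tendsto_atTop v.continuous hv0 p.continuous hh hlog
      (continuous_re_trace_mul_conjTranspose_self hGc)
      (fun ε => Matrix.re_trace_mul_conjTranspose_self_nonneg _) (fun ε => ?_) hT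
    rw [hN, zero_add, re_trace_smul_mul_conjTranspose_self]
  · intro hN
    refine hH.tendsto_atTop v.continuous hv0 p.continuous hh hlog ?_
    simpa using Matrix.re_trace_mul_conjTranspose_self_pos hN

end Trace

lemma Matrix.aeval_fromBlocks_diagonal {α β : Type*} [Fintype α] [Fintype β] [DecidableEq α]
    [DecidableEq β] (a : Matrix α α ℂ) (q : Polynomial ℝ) :
    Polynomial.aeval (Matrix.fromBlocks a 0 0 (0 : Matrix β β ℂ)) q =
      Matrix.fromBlocks (Polynomial.aeval a q) 0 0 (q.eval 0 • (1 : Matrix β β ℂ)) := by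
  induction q using Polynomial.induction_on with
  | C c =>
    simp only [Polynomial.aeval_C, Algebra.algebraMap_eq_smul_one, Polynomial.eval_C,
      ← Matrix.fromBlocks_one, Matrix.fromBlocks_smul, smul_zero]
  | add q₁ q₂ h₁ h₂ => simp [h₁, h₂, Matrix.fromBlocks_add, add_smul]
  | monomial n c h =>
    simp only [pow_succ, ← mul_assoc, map_mul _ _ Polynomial.X, Polynomial.aeval_X] at h ⊢
    rw [h]
    simp [Matrix.fromBlocks_multiply]

/-- The product over the eigenvalues annihilates a Hermitian matrix. -/
lemma Matrix.IsHermitian.aeval_prod_eigenvalues {α : Type*} [Fintype α] [DecidableEq α]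
    {A : Matrix α α ℂ} (hA : A.IsHermitian) :
    Polynomial.aeval A (((Finset.univ.val.map hA.eigenvalues).map fun a : ℝ =>
      Polynomial.X - Polynomial.C a).prod) = 0 := by
  rw [← cfc_polynomial _ A hA.isSelfAdjoint, hA.cfc_eq, Matrix.IsHermitian.cfc]
  rw [EmbeddingLike.map_eq_zero_iff, Matrix.diagonal_eq_zero]
  ext i
  simp only [Function.comp_apply, Polynomial.eval_multiset_prod, Multiset.map_map, Pi.zero_apply]
  rw [Multiset.prod_eq_zero, RCLike.ofReal_zero]
  exact Multiset.mem_map.2 ⟨i, Finset.mem_univ i, by simp⟩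

/-- For `x = [[x₁₁,0],[0,0]]` with `x₁₁` invertible and `y = [[y₁₁,y₁₂],[y₂₁,y₂₂]]`,
the second directional derivative `D²_y H(x)` is infinite iff `y₂₂ ≠ 0`: with `L` the
first derivative of `ε ↦ H(x + εy)` at `0`, the quotient
`(H(x + εy) − H(x) − L·ε)/ε²` tends to `+∞` as `ε → 0`, `ε ≠ 0`, iff `y₂₂ ≠ 0`. -/
theorem entropy_second_deriv_infinite_iff
    (r s t : ℕ) (hr : 1 ≤ r)
    (x₁₁ : Matrix (Fin r) (Fin r) ℂ) (hx₁₁ : IsUnit x₁₁)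
    (y₁₁ : Matrix (Fin r) (Fin r) ℂ) (y₁₂ : Matrix (Fin r) (Fin t) ℂ)
    (y₂₁ : Matrix (Fin s) (Fin r) ℂ) (y₂₂ : Matrix (Fin s) (Fin t) ℂ)
    (x y : Matrix (Fin r ⊕ Fin s) (Fin r ⊕ Fin t) ℂ)
    (hx : x = Matrix.fromBlocks x₁₁ 0 0 0)
    (hy : y = Matrix.fromBlocks y₁₁ y₁₂ y₂₁ y₂₂)
    (L : ℝ) (hL : L = deriv (fun ε : ℝ => vnEntropy (x + (ε : ℂ) • y)) 0) :
    y₂₂ ≠ 0 ↔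
      Tendsto (fun ε : ℝ =>
          (vnEntropy (x + (ε : ℂ) • y) - vnEntropy x - L * ε) / ε ^ 2)
        (nhdsWithin 0 {0}ᶜ) atTop := by
  have hA := Matrix.isHermitian_mul_conjTranspose_self x₁₁
  set m : Multiset ℝ := Finset.univ.val.map hA.eigenvalues
  set v : Polynomial ℝ := (m.map fun a => Polynomial.X - Polynomial.C a).prod with hv
  have hv11 : Polynomial.aeval (x₁₁ * x₁₁ᴴ) v = 0 := hA.aeval_prod_eigenvalues
  have hv11' : Polynomial.aeval (x₁₁ᴴ * x₁₁) v = 0 := by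
    refine hx₁₁.mul_right_eq_zero.1 ?_
    rw [Matrix.mul_aeval_conjTranspose_mul_self, hv11, Matrix.zero_mul]
  have hpos : ∀ a ∈ m, 0 < a := by
    intro a ha
    obtain ⟨i, -, rfl⟩ := Multiset.mem_map.1 ha
    exact Matrix.eigenvalues_self_mul_conjTranspose_pos hx₁₁ i
  have hv0 : v.eval 0 ≠ 0 := hv ▸ eval_zero_prod_X_sub_C_ne_zero hpos
  have hxx : x * xᴴ = Matrix.fromBlocks (x₁₁ * x₁₁ᴴ) 0 0 0 := by
    simp [hx, Matrix.fromBlocks_conjTranspose, Matrix.fromBlocks_multiply]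
  have hxx' : xᴴ * x = Matrix.fromBlocks (x₁₁ᴴ * x₁₁) 0 0 0 := by
    simp [hx, Matrix.fromBlocks_conjTranspose, Matrix.fromBlocks_multiply]
  have hvx : Polynomial.aeval (x * xᴴ) v * x = 0 := by
    rw [hxx, Matrix.aeval_fromBlocks_diagonal, hv11, hx]
    simp [Matrix.fromBlocks_multiply]
  have hN : Polynomial.aeval (x * xᴴ) v * y * Polynomial.aeval (xᴴ * x) v =
      Matrix.fromBlocks 0 0 0 (v.eval 0 ^ 2 • y₂₂) := by
    rw [hxx, hxx', Matrix.aeval_fromBlocks_diagonal, Matrix.aeval_fromBlocks_diagonal, hv11,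
      hv11', hy]
    simp [Matrix.fromBlocks_multiply, smul_smul, sq]
  have key := tendsto_second_difference_iff (y := y) m hpos hv hvx
  rw [hN] at key
  simp only [Complex.coe_smul, hL]
  rw [key, not_iff_not, ← Matrix.fromBlocks_zero, Matrix.fromBlocks_inj]
  simp [hv0]
end
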